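/- arXiv:1806.06022 — 4 statements merged into one kernel-verified Lean document; each statement's English description precedes it below -/
import Mathlib

section
/- For every positive integer r and every real α > 0 there is a constant C = C(r, α) such that the following holds. If G is a finite group of exponent at most r and A ⊆ G satisfies |A| ≥ α|G|, then there is a normal subgroup H of G with [G : H] ≤ C and H ⊆ (AA⁻¹)² ∩ A²A⁻² ∩ (A⁻¹A)² ∩ A⁻²A². -/
open Pointwise

lemma bog_trace_fin (r d : ℕ) (hr : 0 < r) : ∃ Z : Finset ℝ, ∀ (I : Type) [Fintype I] [DecidableEq I],
    Fintype.card I = d → ∀ X : Matrix I I ℝ, X ^ r = 1 → X.trace ∈ Z := by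
  classical
  refine ⟨((Polynomial.nthRootsFinset r (1:ℂ)).sym d).image (fun s => (s.val.sum).re), ?_⟩
  intro I _ _ hI X hX
  set Y : Matrix I I ℂ := X.map Complex.ofRealHom with hY
  have hYr : Y ^ r = 1 := by
    have : Y = Complex.ofRealHom.mapMatrix X := rfl
    rw [this, ← map_pow, hX, map_one]
  have htr : Y.trace = (X.trace : ℂ) := by
    simp [hY, Matrix.trace]
  rw [Finset.mem_image]
  have hcard : Y.charpoly.roots.card = d := by
    rw [IsAlgClosed.card_roots_eq_natDegree, Matrix.charpoly_natDegree_eq_dim, hI]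
  refine ⟨Sym.mk Y.charpoly.roots hcard, ?_, ?_⟩
  · rw [Finset.mem_sym_iff]
    intro z hz
    have hz' : z ∈ Y.charpoly.roots := hz
    rw [Polynomial.mem_roots (Matrix.charpoly_monic Y).ne_zero,
      ← Matrix.mem_spectrum_iff_isRoot_charpoly] at hz'
    have h1 := spectrum.pow_mem_pow Y r hz'
    rw [hYr] at h1
    rcases subsingleton_or_nontrivial (Matrix I I ℂ) with hs | hs
    · simp [spectrum.of_subsingleton] at h1
    · rw [spectrum.one_eq] at h1
      rw [Polynomial.mem_nthRootsFinset hr]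
      exact h1
  · change (Y.charpoly.roots.sum).re = _
    rw [← Matrix.trace_eq_sum_roots_charpoly, htr]
    simp

lemma bog_burnside_aux (r d : ℕ) (hr : 0 < r) : ∃ C : ℕ, ∀ (G : Type) [Group G] [Fintype G]
    (I : Type) [Fintype I] [DecidableEq I], Fintype.card I = d →
    ∀ ρ : G →* Matrix I I ℝ, (∀ g : G, g ^ r = 1) → (∀ g, ρ g⁻¹ = (ρ g).transpose) →
    ρ.ker.index ≤ C := by
  classical
  obtain ⟨Z, hZ⟩ := bog_trace_fin r d hr
  refine ⟨(Z.card + 1) ^ (d * d), ?_⟩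
  intro G _ _ I _ _ hI ρ hG hρ
  obtain ⟨b, hb, hspan, hli⟩ := exists_linearIndependent ℝ (Set.range ρ)
  have hbf : Finite b := (Set.toFinite (Set.range ρ)).subset hb
  have : Fintype b := Fintype.ofFinite b
  have hcb : Fintype.card b ≤ d * d := by
    have := hli.fintype_card_le_finrank
    rwa [Module.finrank_matrix, Module.finrank_self, mul_one, hI] at this
  have hmem : ∀ (g : G) (m : b), (ρ g * m.1).trace ∈ Z := by
    intro g m
    obtain ⟨s, hs⟩ := hb m.2
    rw [← hs, ← map_mul]
    apply hZ I hI
    rw [← map_pow, hG, map_one]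
  let f : G → (b → Z) := fun g m => ⟨_, hmem g m⟩
  have hf : ∀ g g', f g = f g' → ρ g = ρ g' := by
    intro g g' h
    have h1 : ∀ m ∈ Submodule.span ℝ (Set.range ρ), ((ρ g - ρ g') * m).trace = 0 := by
      intro m hm
      rw [← hspan] at hm
      induction hm using Submodule.span_induction with
      | mem x hx =>
        have := congrArg Subtype.val (congrFun h ⟨x, hx⟩)
        simp only [f] at this
        rw [sub_mul, Matrix.trace_sub, this, sub_self]
      | zero => simp
      | add x y _ _ hx hy => rw [mul_add, Matrix.trace_add, hx, hy, add_zero]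
      | smul a x _ hx => rw [Matrix.mul_smul, Matrix.trace_smul, hx, smul_zero]
    have h2 := h1 (ρ g⁻¹ - ρ g'⁻¹) (sub_mem (Submodule.subset_span ⟨_, rfl⟩)
      (Submodule.subset_span ⟨_, rfl⟩))
    rw [hρ, hρ, ← Matrix.transpose_sub, ← Matrix.conjTranspose_eq_transpose_of_trivial,
      Matrix.trace_mul_conjTranspose_self_eq_zero_iff] at h2
    exact sub_eq_zero.1 h2
  have hinj : Function.Injective (fun q : G ⧸ ρ.ker => f q.out) := by
    intro q q' h
    have h1 := hf _ _ h
    rw [← q.out_eq', ← q'.out_eq', QuotientGroup.eq, MonoidHom.mem_ker, map_mul, ← h1, ← map_mul,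
      inv_mul_cancel, map_one]
  have h3 : ρ.ker.index ≤ Nat.card (b → Z) := Nat.card_le_card_of_injective _ hinj
  refine h3.trans ?_
  rw [Nat.card_eq_fintype_card, Fintype.card_fun, Fintype.card_coe]
  calc Z.card ^ Fintype.card b ≤ (Z.card + 1) ^ Fintype.card b := Nat.pow_le_pow_left (by lia) _
    _ ≤ _ := Nat.pow_le_pow_right (by lia) hcb

lemma bog_burnside (r D : ℕ) (hr : 0 < r) : ∃ C : ℕ, ∀ (G : Type) [Group G] [Fintype G]
    (I : Type) [Fintype I] [DecidableEq I], Fintype.card I ≤ D →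
    ∀ ρ : G →* Matrix I I ℝ, (∀ g : G, g ^ r = 1) → (∀ g, ρ g⁻¹ = (ρ g).transpose) →
    ρ.ker.index ≤ C := by
  choose C hC using fun d => bog_burnside_aux r d hr
  refine ⟨∑ d ∈ Finset.range (D + 1), C d, ?_⟩
  intro G _ _ I _ _ hI ρ h1 h2
  refine (hC _ G I rfl ρ h1 h2).trans ?_
  exact Finset.single_le_sum (f := C) (fun _ _ => Nat.zero_le _) (Finset.mem_range.2 (by lia))

lemma bog_spectral {n : Type} [Fintype n] [DecidableEq n] (M : Matrix n n ℝ) (hM : M.PosSemidef) :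
    ∃ (U : Matrix n n ℝ) (μ : n → ℝ), U * U.transpose = 1 ∧ U.transpose * U = 1 ∧
      M = U * Matrix.diagonal μ * U.transpose ∧ (∀ i, 0 ≤ μ i) ∧ M.trace = ∑ i, μ i := by
  refine ⟨hM.1.eigenvectorUnitary, hM.1.eigenvalues, ?_, ?_, ?_, hM.eigenvalues_nonneg, ?_⟩
  · have := Unitary.coe_mul_star_self hM.1.eigenvectorUnitary
    rwa [Unitary.coe_star, Matrix.star_eq_conjTranspose, Matrix.conjTranspose_eq_transpose_of_trivial] at this
  · have := Unitary.coe_star_mul_self hM.1.eigenvectorUnitary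
    rwa [Matrix.star_eq_conjTranspose, Matrix.conjTranspose_eq_transpose_of_trivial] at this
  · have := hM.1.spectral_theorem
    rw [Unitary.conjStarAlgAut_apply, Matrix.star_eq_conjTranspose,
      Matrix.conjTranspose_eq_transpose_of_trivial] at this
    exact this
  · simpa using hM.1.trace_eq_sum_eigenvalues

open Matrix in
lemma bog_core {n G : Type} [Fintype n] [DecidableEq n] [Group G] (L : G →* Matrix n n ℝ)
    (hL : ∀ g, L g⁻¹ = (L g)ᵀ) (M : Matrix n n ℝ) (hM : M.PosSemidef)
    (hcomm : ∀ g, M * L g = L g * M) (c : ℝ) (hc : 0 < c) :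
    ∃ (I : Type) (_ : Fintype I) (_ : DecidableEq I) (ρ : G →* Matrix I I ℝ),
      Fintype.card I * c ≤ M.trace ∧ (∀ g, ρ g⁻¹ = (ρ g)ᵀ) ∧
      ∀ h ∈ ρ.ker, ∀ a : n → ℝ,
        a ⬝ᵥ (M *ᵥ a) - 2 * c * (a ⬝ᵥ a) ≤ a ⬝ᵥ (M *ᵥ (L h *ᵥ a)) := by
  classical
  obtain ⟨U, μ, hU1, hU2, hMU, hμ, htr⟩ := bog_spectral M hM
  let P : G →* Matrix n n ℝ :=
    { toFun := fun g => Uᵀ * L g * U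
      map_one' := by simp [hU2]
      map_mul' := by
        intro x y
        calc Uᵀ * L (x * y) * U = Uᵀ * L x * 1 * L y * U := by simp [Matrix.mul_assoc]
          _ = _ := by rw [← hU1]; simp only [Matrix.mul_assoc] }
  have hP : ∀ g, P g = Uᵀ * L g * U := fun g => rfl
  have hPT : ∀ g, P g⁻¹ = (P g)ᵀ := by
    intro g
    simp [hP, hL, Matrix.mul_assoc]
  have hD : diagonal μ = Uᵀ * M * U := by
    rw [hMU]
    calc diagonal μ = 1 * diagonal μ * 1 := by simp
      _ = _ := by rw [← hU2]; simp only [Matrix.mul_assoc]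
  have hPD : ∀ g, diagonal μ * P g = P g * diagonal μ := by
    intro g
    rw [hD, hP]
    calc Uᵀ * M * U * (Uᵀ * L g * U) = Uᵀ * M * (U * Uᵀ) * L g * U := by
          simp only [Matrix.mul_assoc]
      _ = Uᵀ * (M * L g) * U := by rw [hU1]; simp [Matrix.mul_assoc]
      _ = Uᵀ * L g * (U * Uᵀ) * M * U := by rw [hcomm, hU1]; simp [Matrix.mul_assoc]
      _ = _ := by simp only [Matrix.mul_assoc]
  have hzero : ∀ g i j, μ i ≠ μ j → P g i j = 0 := by
    intro g i j hij
    have := congrFun (congrFun (hPD g) i) j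
    rw [diagonal_mul, mul_diagonal] at this
    have h2 : (μ i - μ j) * P g i j = 0 := by linarith
    exact (mul_eq_zero.1 h2).resolve_left (sub_ne_zero.2 hij)
  let I := {i // c ≤ μ i}
  let ρ : G →* Matrix I I ℝ :=
    { toFun := fun g => (P g).submatrix Subtype.val Subtype.val
      map_one' := by
        rw [map_one]
        exact submatrix_one _ Subtype.val_injective
      map_mul' := by
        intro x y
        ext i j
        rw [map_mul, submatrix_apply, mul_apply, mul_apply]
        simp only [submatrix_apply]
        have h1 : ∑ k : I, P x i.1 k.1 * P y k.1 j.1 =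
            ∑ k ∈ Finset.univ.filter (fun k => c ≤ μ k), P x i.1 k * P y k j.1 := by
          symm
          exact Finset.sum_subtype _ (by simp) _
        rw [h1, Finset.sum_filter]
        refine Finset.sum_congr rfl fun k _ => ?_
        split_ifs with hk
        · rfl
        · rw [hzero x i.1 k, zero_mul]
          intro h; exact hk (h ▸ i.2) }
  have hρ : ∀ g i j, ρ g i j = P g i.1 j.1 := fun _ _ _ => rfl
  refine ⟨I, inferInstance, inferInstance, ρ, ?_, ?_, ?_⟩
  · rw [htr]
    calc (Fintype.card I : ℝ) * c = ∑ i : I, c := by simp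
      _ ≤ ∑ i : I, μ i.1 := Finset.sum_le_sum fun i _ => i.2
      _ = ∑ i ∈ Finset.univ.filter (fun i => c ≤ μ i), μ i := by
        rw [Finset.sum_subtype (p := fun i => c ≤ μ i)]; simp
      _ ≤ _ := Finset.sum_le_sum_of_subset_of_nonneg (Finset.subset_univ _) fun i _ _ => hμ i
  · intro g
    ext i j
    rw [hρ, hPT, transpose_apply, transpose_apply, hρ]
  · intro h hh a
    have hh1 : ρ h = 1 := MonoidHom.mem_ker.1 hh
    set v := Uᵀ *ᵥ a with hv
    set w := P h *ᵥ v with hw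
    have hav : a = U *ᵥ v := by rw [hv, mulVec_mulVec, hU1, one_mulVec]
    have hwL : w = Uᵀ *ᵥ (L h *ᵥ a) := by
      rw [hw, hav, hP]
      simp only [mulVec_mulVec, Matrix.mul_assoc]
    have hMx : ∀ x, a ⬝ᵥ (M *ᵥ x) = ∑ i, μ i * (v i * (Uᵀ *ᵥ x) i) := by
      intro x
      rw [hMU, ← mulVec_mulVec, ← mulVec_mulVec, dotProduct_mulVec, ← mulVec_transpose, ← hv,
        dotProduct]
      refine Finset.sum_congr rfl fun i _ => ?_
      rw [mulVec_diagonal]; ring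
    have haa : a ⬝ᵥ a = ∑ i, v i ^ 2 := by
      nth_rewrite 2 [hav]
      rw [dotProduct_mulVec, ← mulVec_transpose, ← hv, dotProduct]
      exact Finset.sum_congr rfl fun i _ => (sq _).symm
    have hww : ∑ i, w i ^ 2 = ∑ i, v i ^ 2 := by
      have : w ⬝ᵥ w = v ⬝ᵥ v := by
        nth_rewrite 2 [hw]
        rw [dotProduct_mulVec, ← mulVec_transpose, ← hPT, hw, mulVec_mulVec, ← map_mul]
        simp
      simpa [dotProduct, sq] using this
    have hwI : ∀ i, c ≤ μ i → w i = v i := by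
      intro i hi
      rw [hw, mulVec, dotProduct]
      rw [Finset.sum_eq_single i]
      · have := congrFun (congrFun hh1 ⟨i, hi⟩) ⟨i, hi⟩
        rw [hρ] at this
        rw [this]; simp
      · intro j _ hj
        by_cases hij : c ≤ μ j
        · have := congrFun (congrFun hh1 ⟨i, hi⟩) ⟨j, hij⟩
          rw [hρ, one_apply_ne (by simpa using hj.symm)] at this
          rw [this]; simp
        · rw [hzero, zero_mul]
          intro h; rw [h] at hi; exact hij hi
      · simp
    rw [hMx, hMx, ← hwL, ← hv, haa]
    have key : ∀ i, μ i * (v i * v i) - c * (3 / 2 * v i ^ 2 + 1 / 2 * w i ^ 2)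
        ≤ μ i * (v i * w i) := by
      intro i
      by_cases hi : c ≤ μ i
      · rw [hwI i hi]; nlinarith [sq_nonneg (v i)]
      · push Not at hi
        have h0 := hμ i
        nlinarith [sq_nonneg (v i + w i), mul_nonneg h0 (sq_nonneg (v i + w i)),
          mul_nonneg (sub_nonneg.2 hi.le) (sq_nonneg (v i)),
          mul_nonneg (sub_nonneg.2 hi.le) (sq_nonneg (w i))]
    have := Finset.sum_le_sum fun i (_ : i ∈ Finset.univ) => key i
    rw [Finset.sum_sub_distrib, ← Finset.mul_sum, Finset.sum_add_distrib, ← Finset.mul_sum,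
      ← Finset.mul_sum, hww] at this
    linarith

open Matrix in
lemma bog_dense (r : ℕ) (hr : 0 < r) (α : ℝ) (hα : 0 < α) :
    ∃ C : ℕ, ∀ (G : Type) [Group G] [Fintype G] [DecidableEq G],
      (∀ x : G, x ^ r = 1) →
      ∀ A B : Finset G, α * (Fintype.card G : ℝ) ≤ (A.card : ℝ) →
      α * (Fintype.card G : ℝ) ≤ (B.card : ℝ) →
      ∃ H : Subgroup G, H.Normal ∧ H.index ≤ C ∧ ∀ h ∈ H, h ∈ (A * B) * (A * B)⁻¹ := by
  obtain ⟨C, hC⟩ := bog_burnside r ⌊3 / α ^ 3⌋₊ hr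
  refine ⟨C, ?_⟩
  intro G _ _ _ hG A B hA hB
  let L : G →* Matrix G G ℝ :=
    { toFun := fun g => Matrix.of fun x y => if x = g * y then 1 else 0
      map_one' := by ext x y; simp [Matrix.one_apply]
      map_mul' := by
        intro g h
        ext x y
        simp [Matrix.mul_apply, mul_assoc] }
  have hLa : ∀ g x y, L g x y = if x = g * y then 1 else 0 := fun _ _ _ => rfl
  have hLT : ∀ g, L g⁻¹ = (L g)ᵀ := by
    intro g
    ext x y
    rw [transpose_apply, hLa, hLa]
    congr 1
    rw [eq_inv_mul_iff_mul_eq]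
    exact propext eq_comm
  have hLv : ∀ g (f : G → ℝ) x, (L g *ᵥ f) x = f (g⁻¹ * x) := by
    intro g f x
    rw [mulVec, dotProduct, Finset.sum_eq_single (g⁻¹ * x)]
    · simp [hLa]
    · intro y _ hy
      rw [hLa, if_neg, zero_mul]
      rintro rfl
      simp at hy
    · simp
  let K : Matrix G G ℝ := Matrix.of fun x y => if y⁻¹ * x ∈ B then 1 else 0
  have hK : ∀ x y, K x y = if y⁻¹ * x ∈ B then 1 else 0 := fun _ _ => rfl
  have hKL : ∀ g, K * L g = L g * K := by
    intro g
    ext x y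
    have h1 : (K * L g) x y = K x (g * y) := by
      simp [Matrix.mul_apply, hLa]
    have h2 : (L g * K) x y = K (g⁻¹ * x) y := hLv g (fun z => K z y) x
    rw [h1, h2, hK, hK]
    simp [mul_assoc]
  have hKTL : ∀ g, Kᵀ * L g = L g * Kᵀ := by
    intro g
    have := congrArg transpose (hKL g⁻¹)
    rw [transpose_mul, transpose_mul, ← hLT, inv_inv] at this
    exact this.symm
  have hMpos : (Kᵀ * K).PosSemidef := by
    rw [← conjTranspose_eq_transpose_of_trivial]
    exact posSemidef_conjTranspose_mul_self K
  have hMc : ∀ g, (Kᵀ * K) * L g = L g * (Kᵀ * K) := by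
    intro g
    rw [Matrix.mul_assoc, hKL, ← Matrix.mul_assoc, hKTL, Matrix.mul_assoc]
  set N : ℝ := (Fintype.card G : ℝ) with hN
  have hNpos : 0 < N := by
    rw [hN]; exact_mod_cast Fintype.card_pos
  have hc : 0 < α ^ 3 / 3 * N ^ 2 := by positivity
  obtain ⟨I, _, _, ρ, hI, hρ, hmain⟩ := bog_core L hLT (Kᵀ * K) hMpos hMc _ hc
  have htr : (Kᵀ * K).trace ≤ N ^ 2 := by
    rw [Matrix.trace]
    calc ∑ i, (Kᵀ * K).diag i ≤ ∑ i : G, ∑ j : G, (1 : ℝ) := by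
          refine Finset.sum_le_sum fun i _ => ?_
          rw [diag_apply, mul_apply]
          refine Finset.sum_le_sum fun j _ => ?_
          rw [transpose_apply, hK]
          split_ifs <;> norm_num
      _ = N ^ 2 := by simp [hN, sq]
  have hId : Fintype.card I ≤ ⌊3 / α ^ 3⌋₊ := by
    apply Nat.le_floor
    rw [le_div_iff₀ (by positivity)]
    have h1 := hI.trans htr
    have h2 : ((Fintype.card I : ℝ) * α ^ 3) * N ^ 2 ≤ 3 * N ^ 2 := by linarith
    exact le_of_mul_le_mul_right h2 (by positivity)
  refine ⟨ρ.ker, inferInstance, hC G I hId ρ hG hρ, ?_⟩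
  intro h hh
  let a : G → ℝ := fun x => if x ∈ A then 1 else 0
  have h1 := hmain h hh a
  have haa : a ⬝ᵥ a = A.card := by
    simp [dotProduct, a]
  have hquad : ∀ x : G → ℝ, a ⬝ᵥ ((Kᵀ * K) *ᵥ x) = (K *ᵥ a) ⬝ᵥ (K *ᵥ x) := by
    intro x
    rw [← mulVec_mulVec, dotProduct_mulVec, vecMul_transpose]
  have hKa : ∀ x, (K *ᵥ a) x ≠ 0 → x ∈ A * B := by
    intro x hx
    rw [mulVec, dotProduct] at hx
    obtain ⟨y, _, hy⟩ := Finset.exists_ne_zero_of_sum_ne_zero hx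
    have hyB : y⁻¹ * x ∈ B := by
      by_contra hcon
      exact hy (by rw [hK, if_neg hcon, zero_mul])
    have hyA : y ∈ A := by
      by_contra hcon
      exact hy (by simp [a, hcon])
    exact Finset.mem_mul.2 ⟨y, hyA, _, hyB, by simp⟩
  have hsum : ∑ x, (K *ᵥ a) x = A.card * B.card := by
    simp only [mulVec, dotProduct]
    rw [Finset.sum_comm]
    have : ∀ y, ∑ x, K x y * a y = a y * B.card := by
      intro y
      rw [← Finset.sum_mul, mul_comm]
      congr 1
      rw [← Equiv.sum_comp (Equiv.mulLeft y)]
      simp [hK]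
    simp only [this]
    rw [← Finset.sum_mul]
    simp [a]
  have hcs : (A.card * B.card : ℝ) ^ 2 ≤ N * ((K *ᵥ a) ⬝ᵥ (K *ᵥ a)) := by
    rw [← hsum]
    have := sq_sum_le_card_mul_sum_sq (s := (Finset.univ : Finset G)) (f := fun x => (K *ᵥ a) x)
    simpa [dotProduct, sq, hN] using this
  rw [hquad, hquad, haa] at h1
  have hpos : 0 < (K *ᵥ a) ⬝ᵥ (K *ᵥ (L h *ᵥ a)) := by
    refine lt_of_lt_of_le ?_ h1
    have hApos : (0:ℝ) < A.card := lt_of_lt_of_le (by positivity) hA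
    have hBB : (α * N) ^ 2 ≤ (B.card : ℝ) ^ 2 := pow_le_pow_left₀ (by positivity) hB 2
    have h3 : (A.card : ℝ) * (α * N) * (α * N) ^ 2 ≤ (A.card * B.card : ℝ) ^ 2 := by
      calc (A.card : ℝ) * (α * N) * (α * N) ^ 2 ≤ (A.card : ℝ) * A.card * (B.card : ℝ) ^ 2 := by
            gcongr
        _ = _ := by ring
    have h4 := h3.trans hcs
    have h5 : N * (A.card * α ^ 3 * N ^ 2) ≤ N * ((K *ᵥ a) ⬝ᵥ (K *ᵥ a)) := by
      refine le_trans (le_of_eq ?_) h4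
      ring
    have h6 := le_of_mul_le_mul_left h5 hNpos
    have h7 : 0 < A.card * α ^ 3 * N ^ 2 := by positivity
    linarith
  rw [mulVec_mulVec, hKL, ← mulVec_mulVec] at hpos
  obtain ⟨x, _, hx⟩ := Finset.exists_ne_zero_of_sum_ne_zero hpos.ne'
  rw [hLv] at hx
  have hx1 := hKa _ (left_ne_zero_of_mul hx)
  have hx2 := hKa _ (right_ne_zero_of_mul hx)
  exact Finset.mem_mul.2 ⟨x, hx1, _, Finset.inv_mem_inv hx2, by simp⟩

/-- **Bogolyubov's Lemma for finite groups of bounded exponent.**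
For every positive integer `r` and real `α > 0` there is `C` such that: if `G` is a
finite group of exponent at most `r` and `A ⊆ G` with `|A| ≥ α|G|`, then there is a
normal subgroup `H ≤ G` of index at most `C` with
`H ⊆ (AA⁻¹)² ∩ A²A⁻² ∩ (A⁻¹A)² ∩ A⁻²A²`. -/
theorem bogolyubov_bounded_exponent (r : ℕ) (hr : 0 < r) (α : ℝ) (hα : 0 < α) :
    ∃ C : ℕ, ∀ (G : Type) [Group G] [Fintype G] [DecidableEq G],
      (∀ x : G, x ^ r = 1) →
      ∀ A : Finset G, α * (Fintype.card G : ℝ) ≤ (A.card : ℝ) →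
      ∃ H : Subgroup G, H.Normal ∧ H.index ≤ C ∧
        (H : Set G) ⊆
          ↑(((A * A⁻¹) ^ 2 ∩ (A ^ 2 * A⁻¹ ^ 2) ∩ (A⁻¹ * A) ^ 2 ∩ (A⁻¹ ^ 2 * A ^ 2) :
            Finset G)) := by
  classical
  obtain ⟨C, hC⟩ := bog_dense r hr α hα
  refine ⟨C * C * C * C, ?_⟩
  intro G _ _ _ hG A hA
  have hA' : α * (Fintype.card G : ℝ) ≤ (A⁻¹.card : ℝ) := by rwa [Finset.card_inv]
  obtain ⟨H1, n1, i1, s1⟩ := hC G hG A A⁻¹ hA hA'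
  obtain ⟨H2, n2, i2, s2⟩ := hC G hG A A hA hA
  obtain ⟨H3, n3, i3, s3⟩ := hC G hG A⁻¹ A hA' hA
  obtain ⟨H4, n4, i4, s4⟩ := hC G hG A⁻¹ A⁻¹ hA' hA'
  refine ⟨H1 ⊓ H2 ⊓ H3 ⊓ H4, inferInstance, ?_, ?_⟩
  · calc (H1 ⊓ H2 ⊓ H3 ⊓ H4).index ≤ (H1 ⊓ H2 ⊓ H3).index * H4.index := Subgroup.index_inf_le
      _ ≤ ((H1 ⊓ H2).index * H3.index) * H4.index := Nat.mul_le_mul_right _ Subgroup.index_inf_le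
      _ ≤ ((H1.index * H2.index) * H3.index) * H4.index :=
        Nat.mul_le_mul_right _ (Nat.mul_le_mul_right _ Subgroup.index_inf_le)
      _ ≤ C * C * C * C := by gcongr
  · rintro h ⟨⟨⟨h1, h2⟩, h3⟩, h4⟩
    have t1 := s1 h h1
    have t2 := s2 h h2
    have t3 := s3 h h3
    have t4 := s4 h h4
    simp only [mul_inv_rev, inv_inv] at t1 t2 t3 t4
    simp only [Finset.mem_coe, Finset.mem_inter, sq]
    exact ⟨⟨⟨t1, t2⟩, t3⟩, t4⟩
end

section
/- For every real α > 0 there is a constant C = C(α) such that the following holds. If G is a finite group and A ⊆ G satisfies |A| ≥ α|G|, then there are a normal subgroup H of G with [G : H] ≤ C and a (δ, n)-Bohr neighborhood B in H with δ⁻¹ ≤ C and n ≤ C, such that B ⊆ (AA⁻¹)² ∩ A²A⁻² ∩ (A⁻¹A)² ∩ A⁻²A². -/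
open Pointwise

/-- The `n`-dimensional torus `(ℝ/ℤ)ⁿ`. -/
abbrev Torus (n : ℕ) : Type := Fin n → AddCircle (1 : ℝ)

/-- `B` is a `(δ, n)`-Bohr neighborhood in the group `H`: there is a homomorphism
`τ : H → 𝕋ⁿ` with `B = {x ∈ H : d(0, τ(x)) < δ}`. -/
def IsBohrNbhd {H : Type*} [Group H] (δ : ℝ) (n : ℕ) (B : Set H) : Prop :=
  ∃ τ : H →* Multiplicative (Torus n),
    B = {x : H | dist (0 : Torus n) (Multiplicative.toAdd (τ x)) < δ}

namespace Bog

set_option linter.unusedSectionVars false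

lemma nss {E : Type*} [NormedRing E] [NormedAlgebra ℂ E] (u : E) (n : ℕ) (hn : 0 < n)
    (hu : u ^ n = 1) (c : ℝ) (hc : c < 1) (h : ∀ k : ℕ, ‖u ^ k - 1‖ ≤ c) : u = 1 := by
  have h1 : (u - 1) * ∑ k ∈ Finset.range n, (u ^ k - 1) = -((n : ℂ) • (u - 1)) := by
    rw [Finset.sum_sub_distrib, mul_sub, mul_geom_sum, hu]
    simp [Nat.cast_smul_eq_nsmul]
    rw [sub_mul, one_mul, mul_sub, mul_one, (Nat.cast_commute n u).eq]
  have h2 : ‖∑ k ∈ Finset.range n, (u ^ k - 1)‖ ≤ n * c := by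
    refine (norm_sum_le _ _).trans ((Finset.sum_le_sum fun k _ => h k).trans ?_)
    simp
  have h3 : (n : ℝ) * ‖u - 1‖ ≤ ‖u - 1‖ * (n * c) := by
    calc (n : ℝ) * ‖u - 1‖ = ‖-((n : ℂ) • (u - 1))‖ := by simp [norm_smul]
      _ ≤ _ := by
        rw [← h1]
        exact (norm_mul_le _ _).trans (by gcongr)
  have hn' : (0 : ℝ) < n := by exact_mod_cast hn
  have h4 : ‖u - 1‖ ≤ 0 := by
    by_contra hh
    push Not at hh
    have : 0 < (n * ‖u - 1‖) * (1 - c) := by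
      apply mul_pos (by positivity); linarith
    nlinarith
  have := norm_le_zero_iff.mp h4
  exact sub_eq_zero.mp this

section
variable {G : Type*} [Group G] {E : Type*} [NormedRing E] [NormedAlgebra ℂ E]
  (ρ : G →* E) (hρ : ∀ g, ‖ρ g‖ ≤ 1)

lemma norm_left (hρ : ∀ g, ‖ρ g‖ ≤ 1) (g : G) (x : E) : ‖ρ g * x‖ ≤ ‖x‖ :=
  (norm_mul_le _ _).trans (mul_le_of_le_one_left (norm_nonneg _) (hρ g))
lemma norm_right (hρ : ∀ g, ‖ρ g‖ ≤ 1) (g : G) (x : E) : ‖x * ρ g‖ ≤ ‖x‖ :=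
  (norm_mul_le _ _).trans (mul_le_of_le_one_right (norm_nonneg _) (hρ g))

lemma len_inv (hρ : ∀ g, ‖ρ g‖ ≤ 1) (g : G) : ‖ρ g⁻¹ - 1‖ ≤ ‖ρ g - 1‖ := by
  have : ρ g⁻¹ - 1 = - (ρ g⁻¹ * (ρ g - 1)) := by
    rw [mul_sub, ← map_mul]; simp
  rw [this, norm_neg]; exact norm_left ρ hρ _ _

lemma len_conj (hρ : ∀ g, ‖ρ g‖ ≤ 1) (h g : G) : ‖ρ (h * g * h⁻¹) - 1‖ ≤ ‖ρ g - 1‖ := by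
  have : ρ (h * g * h⁻¹) - 1 = ρ h * (ρ g - 1) * ρ h⁻¹ := by
    rw [mul_sub, sub_mul, ← map_mul, ← map_mul, mul_one, ← map_mul]; simp
  rw [this]; exact (norm_right ρ hρ _ _).trans (norm_left ρ hρ _ _)

lemma len_mul (hρ : ∀ g, ‖ρ g‖ ≤ 1) (h g : G) :
    ‖ρ (h * g) - 1‖ ≤ ‖ρ h - 1‖ + ‖ρ g - 1‖ := by
  have : ρ (h * g) - 1 = ρ h * (ρ g - 1) + (ρ h - 1) := by
    rw [mul_sub, ← map_mul, mul_one]; abel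
  rw [this, add_comm ‖ρ h - 1‖]
  exact (norm_add_le _ _).trans (by gcongr; exact norm_left ρ hρ _ _)

lemma comm_small [Finite G] (hρ : ∀ g, ‖ρ g‖ ≤ 1) (a b : G) (ha : ‖ρ a - 1‖ < 1 / 2)
    (hb : ‖ρ b - 1‖ < 1 / 2) : ρ a * ρ b = ρ b * ρ a := by
  by_contra hne
  let S : Set G := {b | ‖ρ b - 1‖ < 1 / 2 ∧ ρ a * ρ b ≠ ρ b * ρ a}
  obtain ⟨b, ⟨hb, hne⟩, hmin⟩ := Set.exists_min_image S (fun b => ‖ρ b - 1‖)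
    (Set.toFinite S) ⟨b, hb, hne⟩
  have hpos : 0 < ‖ρ b - 1‖ := by
    rw [norm_pos_iff]; intro h
    rw [sub_eq_zero.mp h] at hne; simp at hne
  set u := b * a * b⁻¹ * a⁻¹ with hu
  have e1 : ρ u - 1 = ((ρ b - 1) * (ρ a - 1) - (ρ a - 1) * (ρ b - 1)) * ρ (b⁻¹ * a⁻¹) := by
    have : (ρ b - 1) * (ρ a - 1) - (ρ a - 1) * (ρ b - 1) = ρ b * ρ a - ρ a * ρ b := by
      noncomm_ring
    rw [this, sub_mul, ← map_mul, ← map_mul, ← map_mul, ← map_mul]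
    congr 1
    · simp [hu, mul_assoc]
    · simp [mul_assoc]
  have e2 : ‖ρ u - 1‖ < ‖ρ b - 1‖ := by
    rw [e1]
    refine (norm_right ρ hρ _ _).trans_lt ?_
    refine (norm_sub_le _ _).trans_lt ?_
    have h1 := norm_mul_le (ρ b - 1) (ρ a - 1)
    have h2 := norm_mul_le (ρ a - 1) (ρ b - 1)
    nlinarith
  have e3 : ρ a * ρ u = ρ u * ρ a := by
    by_contra h
    exact absurd (hmin u ⟨e2.trans hb, h⟩) (not_le.mpr e2)
  have e4 : ρ u = 1 := by
    refine nss (ρ u) (Nat.card G) Nat.card_pos (by rw [← map_pow]; simp)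
      (‖ρ b - 1‖ + ‖ρ b - 1‖) (by linarith) fun k => ?_
    have e5 : ρ u ^ k = ρ (b * (a ^ k * b⁻¹ * (a ^ k)⁻¹)) := by
      have h1 : ρ u ^ k * ρ a ^ k = ρ (b * a ^ k * b⁻¹) := by
        have hc : Commute (ρ u) (ρ a) := e3.symm
        rw [← hc.mul_pow, ← map_mul, ← map_pow, ← conj_pow]
        simp [hu]
      have h2 : ρ u ^ k = ρ u ^ k * ρ a ^ k * ρ (a ^ k)⁻¹ := by
        rw [mul_assoc, ← map_pow ρ a, ← map_mul]; simp
      rw [h2, h1, ← map_mul]; simp [mul_assoc]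
    rw [e5]
    refine (len_mul ρ hρ _ _).trans ?_
    gcongr
    exact (len_conj ρ hρ _ _).trans (len_inv ρ hρ b)
  apply hne
  have : ρ (b * a) = ρ u * ρ (a * b) := by rw [← map_mul]; congr 1; simp [hu, mul_assoc]
  rw [e4, one_mul] at this
  rw [← map_mul, ← map_mul, this]

theorem jordan [Finite G] [FiniteDimensional ℂ E] (hρ : ∀ g, ‖ρ g‖ ≤ 1) (M : ℕ)
    (hM : Module.finrank ℂ E ≤ M) :
    ∃ H : Subgroup G, H.Normal ∧ H.index ≤ 5 ^ (2 * M) ∧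
      ∀ x ∈ H, ∀ y ∈ H, ρ x * ρ y = ρ y * ρ x := by
  classical
  let s : Set G := {g | ‖ρ g - 1‖ < 1 / 2}
  refine ⟨Subgroup.normalClosure s, inferInstance, ?_, ?_⟩
  · set H := Subgroup.normalClosure s
    have : Fintype (G ⧸ H) := Fintype.ofFinite _
    let f : G ⧸ H → E := fun q => (2 : ℂ) • ρ q.out
    have sep : ∀ q q' : G ⧸ H, q ≠ q' → 1 ≤ ‖f q - f q'‖ := by
      intro q q' hq
      have h1 : ¬ (‖ρ (q.out⁻¹ * q'.out) - 1‖ < 1 / 2) := by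
        intro h
        apply hq
        rw [← QuotientGroup.out_eq' q, ← QuotientGroup.out_eq' q']
        exact QuotientGroup.eq.mpr (Subgroup.subset_normalClosure h)
      have h2 : ρ (q.out⁻¹ * q'.out) - 1 = ρ q.out⁻¹ * (ρ q'.out - ρ q.out) := by
        rw [mul_sub, ← map_mul, ← map_mul]; simp
      have h3 : ‖ρ (q.out⁻¹ * q'.out) - 1‖ ≤ ‖ρ q'.out - ρ q.out‖ := by
        rw [h2]; exact norm_left ρ hρ _ _
      simp only [f, ← smul_sub, norm_smul]
      rw [norm_sub_rev]
      simp
      linarith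
    have finj : Function.Injective f := by
      intro q q' h
      by_contra hq
      have := sep q q' hq
      rw [h] at this; simp at this; linarith
    have key := Besicovitch.card_le_of_separated (E := E) (Finset.univ.image f)
      (by
        intro c hc
        obtain ⟨q, -, rfl⟩ := Finset.mem_image.mp hc
        simp only [f, norm_smul]
        have := hρ q.out
        simp; linarith)
      (by
        intro c hc d hd hcd
        obtain ⟨q, -, rfl⟩ := Finset.mem_image.mp hc
        obtain ⟨q', -, rfl⟩ := Finset.mem_image.mp hd
        exact sep q q' (fun h => hcd (by rw [h])))
    rw [Finset.card_image_of_injective _ finj, Finset.card_univ, finrank_real_of_complex] at key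
    rw [Subgroup.index, Nat.card_eq_fintype_card]
    exact key.trans (Nat.pow_le_pow_right (by norm_num) (by omega))
  · intro x hx y hy
    have hs : Group.conjugatesOfSet s ⊆ s := by
      intro g hg
      obtain ⟨a, ha, hag⟩ := Group.mem_conjugatesOfSet_iff.mp hg
      obtain ⟨c, rfl⟩ := isConj_iff.mp hag
      exact (len_conj ρ hρ c a).trans_lt ha
    have hcl : Subgroup.normalClosure s ≤ Subgroup.closure s := Subgroup.closure_mono hs
    replace hx := hcl hx
    replace hy := hcl hy
    have inv_comm : ∀ a b : G, ρ a * ρ b = ρ b * ρ a → ρ a⁻¹ * ρ b = ρ b * ρ a⁻¹ := by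
      intro a b h
      calc ρ a⁻¹ * ρ b = ρ a⁻¹ * (ρ b * ρ a) * ρ a⁻¹ := by
            rw [mul_assoc, mul_assoc, ← map_mul ρ a]; simp
        _ = ρ b * ρ a⁻¹ := by rw [← h, ← mul_assoc, ← map_mul ρ a⁻¹ a]; simp
    induction hx, hy using Subgroup.closure_induction₂ with
    | mem x y hx hy => exact comm_small ρ hρ x y hx hy
    | one_left x hx => simp
    | one_right x hx => simp
    | mul_left x y z _ _ _ h1 h2 => rw [map_mul, mul_assoc, h2, ← mul_assoc, h1, mul_assoc]
    | mul_right x y z _ _ _ h1 h2 => rw [map_mul, ← mul_assoc, h1, mul_assoc, h2, mul_assoc]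
    | inv_left x y _ _ h => exact inv_comm _ _ h
    | inv_right x y _ _ h => exact (inv_comm _ _ h.symm).symm
end

theorem diag {A : Type*} [AddCommGroup A] [Finite A] {E : Type*} [NormedRing E]
    [NormedAlgebra ℂ E] [FiniteDimensional ℂ E] (σ : Multiplicative A →* E)
    (hσ : ∀ g, ‖σ g‖ ≤ 1) :
    ∃ X : Finset (AddChar A ℂ), X.card ≤ Module.finrank ℂ E ∧
      ∀ a : A, ‖σ (.ofAdd a) - 1‖ ≤ ∑ χ ∈ X, ‖χ a - 1‖ := by
  classical
  have := Fintype.ofFinite A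
  have hn : (0 : ℝ) < Fintype.card A := by exact_mod_cast Fintype.card_pos
  have hn' : (Fintype.card A : ℂ) ≠ 0 := by exact_mod_cast hn.ne'
  let P : AddChar A ℂ → E := fun ψ =>
    (Fintype.card A : ℂ)⁻¹ • ∑ a : A, ψ (-a) • σ (.ofAdd a)
  have hsum : ∑ ψ, P ψ = 1 := by
    simp only [P]
    rw [← Finset.smul_sum, Finset.sum_comm]
    simp_rw [← Finset.sum_smul, AddChar.sum_apply_eq_ite]
    simp [hn']
  have heig : ∀ b ψ, σ (.ofAdd b) * P ψ = ψ b • P ψ := by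
    intro b ψ
    simp only [P, mul_smul_comm, Finset.mul_sum]
    rw [smul_comm]
    congr 1
    rw [Finset.smul_sum]
    refine Fintype.sum_equiv (Equiv.addLeft b) _ _ fun a => ?_
    rw [← map_mul, smul_smul, ← AddChar.map_add_eq_mul]
    simp [ofAdd_add]
  have hnorm : ∀ ψ, ‖P ψ‖ ≤ 1 := by
    intro ψ
    simp only [P, norm_smul]
    have : ‖∑ a : A, ψ (-a) • σ (.ofAdd a)‖ ≤ Fintype.card A := by
      refine (norm_sum_le _ _).trans ((Finset.sum_le_sum (g := fun _ => 1) fun a _ => ?_).trans ?_)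
      · rw [norm_smul, AddChar.norm_apply, one_mul]; exact hσ _
      · simp
    rw [norm_inv, Complex.norm_natCast, inv_mul_le_iff₀ hn]; simpa using this
  have horth : ∀ φ ψ, φ ≠ ψ → P φ * P ψ = 0 := by
    intro φ ψ h
    conv_lhs => rw [show P φ = (Fintype.card A : ℂ)⁻¹ • ∑ a : A, φ (-a) • σ (.ofAdd a) from rfl]
    rw [smul_mul_assoc, Finset.sum_mul]
    simp_rw [smul_mul_assoc, heig, smul_smul]
    rw [← Finset.sum_smul]
    have : ∑ a, φ (-a) * ψ a = ∑ a, (ψ - φ) a := by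
      refine Finset.sum_congr rfl fun a _ => ?_
      rw [AddChar.sub_apply', mul_comm, AddChar.map_neg_eq_inv, div_eq_mul_inv]
    rw [this, AddChar.sum_eq_zero_iff_ne_zero.mpr (sub_ne_zero.mpr h.symm)]
    simp
  have hidem : ∀ ψ, P ψ * P ψ = P ψ := by
    intro ψ
    calc P ψ * P ψ = (∑ φ, P φ) * P ψ := by
          rw [Finset.sum_mul, Finset.sum_eq_single ψ]
          · intro b _ hb; exact horth b ψ hb
          · simp
      _ = P ψ := by rw [hsum, one_mul]
  let X : Finset (AddChar A ℂ) := Finset.univ.filter fun ψ => P ψ ≠ 0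
  refine ⟨X, ?_, ?_⟩
  · have li : LinearIndependent ℂ (fun ψ : X => P ψ) := by
      rw [Fintype.linearIndependent_iff]
      intro g hg ψ
      have h1 := congrArg (fun z => P ψ * z) hg
      simp only [Finset.mul_sum, mul_smul_comm, mul_zero] at h1
      rw [Finset.sum_eq_single ψ] at h1
      · rw [hidem] at h1
        exact (smul_eq_zero.mp h1).resolve_right (Finset.mem_filter.mp ψ.2).2
      · intro b _ hb
        rw [horth _ _ (fun h => hb (Subtype.ext h.symm)), smul_zero]
      · simp
    simpa using li.fintype_card_le_finrank
  · intro a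
    have h1 : σ (.ofAdd a) - 1 = ∑ ψ ∈ X, (ψ a - 1) • P ψ := by
      have : ∑ ψ ∈ X, (ψ a - 1) • P ψ = ∑ ψ, (ψ a - 1) • P ψ := by
        refine Finset.sum_subset (Finset.subset_univ _) fun ψ _ h => ?_
        have : P ψ = 0 := by simpa [X] using h
        rw [this, smul_zero]
      rw [this]
      simp_rw [sub_smul, one_smul, Finset.sum_sub_distrib, ← heig, ← Finset.mul_sum, hsum, mul_one]
    rw [h1]
    refine (norm_sum_le _ _).trans (Finset.sum_le_sum fun ψ _ => ?_)
    rw [norm_smul]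
    exact mul_le_of_le_one_right (norm_nonneg _) (hnorm ψ)

lemma toCircle_bound (t : AddCircle (1 : ℝ)) :
    ‖((AddCircle.toCircle t : Circle) : ℂ) - 1‖ ≤ 7 * ‖t‖ := by
  induction t using QuotientAddGroup.induction_on with
  | H x =>
    have h0 : (QuotientAddGroup.mk x : AddCircle (1 : ℝ)) = ((x - round x : ℝ) : AddCircle (1 : ℝ)) := by
      have : ((round x : ℝ) : AddCircle (1 : ℝ)) = 0 := by
        rw [AddCircle.coe_eq_zero_iff]; exact ⟨round x, by simp⟩
      rw [AddCircle.coe_sub, this, sub_zero]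
    have h1 : ‖(QuotientAddGroup.mk x : AddCircle (1 : ℝ))‖ = |x - round x| :=
      UnitAddCircle.norm_eq (x := x)
    rw [h1, h0, AddCircle.toCircle_apply_mk, Circle.coe_exp, mul_comm _ Complex.I]
    refine Real.norm_exp_I_mul_ofReal_sub_one_le.trans ?_
    rw [Real.norm_eq_abs, abs_mul]
    gcongr
    rw [div_one, abs_of_pos (by positivity)]
    linarith [Real.pi_lt_d2]

lemma char_lift {A : Type*} [AddCommGroup A] [Finite A] (ψ : AddChar A ℂ) :
    ∃ τ : Multiplicative A →* Multiplicative (AddCircle (1 : ℝ)),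
      ∀ a, ‖ψ a - 1‖ ≤ 7 * ‖(τ (.ofAdd a)).toAdd‖ := by
  have hsurj : ∀ a, ∃ t : AddCircle (1 : ℝ), ((AddCircle.toCircle t : Circle) : ℂ) = ψ a := by
    intro a
    obtain ⟨z, hz⟩ : ∃ z : Circle, (z : ℂ) = ψ a :=
      ⟨⟨ψ a, mem_sphere_zero_iff_norm.2 (ψ.norm_apply a)⟩, rfl⟩
    refine ⟨(AddCircle.homeomorphCircle one_ne_zero).symm z, ?_⟩
    rw [← hz]
    rw [← AddCircle.homeomorphCircle_apply one_ne_zero, Homeomorph.apply_symm_apply]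
  choose t ht using hsurj
  have hinj : ∀ s s' : AddCircle (1 : ℝ), ((AddCircle.toCircle s : Circle) : ℂ) =
      ((AddCircle.toCircle s' : Circle) : ℂ) → s = s' := fun s s' h =>
    AddCircle.injective_toCircle one_ne_zero (Circle.ext h)
  refine ⟨MonoidHom.mk' (fun a => .ofAdd (t a.toAdd)) fun a b => ?_, fun a => ?_⟩
  · rw [← ofAdd_add]
    congr 1
    apply hinj
    rw [AddCircle.toCircle_add, Circle.coe_mul, ht, ht, ht, toAdd_mul, AddChar.map_add_eq_mul]
  · rw [← ht]
    exact toCircle_bound _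

theorem bohr_of_rep {G : Type*} [Group G] [Finite G] {E : Type*} [NormedRing E]
    [NormedAlgebra ℂ E] [FiniteDimensional ℂ E] (ρ : G →* E) (hρ : ∀ g, ‖ρ g‖ ≤ 1)
    (M : ℕ) (hM : Module.finrank ℂ E ≤ M) (δ : ℝ) (hδ0 : 0 ≤ δ) :
    ∃ H : Subgroup G, H.Normal ∧ H.index ≤ 5 ^ (2 * M) ∧
      ∃ τ : Fin M → (H →* Multiplicative (AddCircle (1 : ℝ))),
        ∀ x : H, (∀ i, ‖(τ i x).toAdd‖ ≤ δ) → ‖ρ x - 1‖ ≤ M * (7 * δ) := by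
  classical
  obtain ⟨H, hn, hi, hc⟩ := jordan ρ hρ M hM
  refine ⟨H, hn, hi, ?_⟩
  have hker : commutator H ≤ (ρ.comp H.subtype).ker := by
    rw [commutator_def, Subgroup.commutator_le]
    intro x _ y _
    rw [MonoidHom.mem_ker, MonoidHom.comp_apply, commutatorElement_def]
    have : ρ (x * y) = ρ (y * x) := by
      rw [map_mul, map_mul, hc x x.2 y y.2]
    have e : ((x * y * x⁻¹ * y⁻¹ : H) : G) = (x * y : G) * ((y : G) * x)⁻¹ := by
      push_cast; group
    change ρ ((x * y * x⁻¹ * y⁻¹ : H) : G) = 1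
    rw [e, map_mul, this, ← map_mul]; simp
  let σ : Multiplicative (Additive (Abelianization H)) →* E :=
    QuotientGroup.lift (commutator H) (ρ.comp H.subtype) hker
  have hσ' : ∀ x : H, σ (.ofAdd (.ofMul (Abelianization.of x))) = ρ x := fun x => rfl
  have hσ : ∀ g, ‖σ g‖ ≤ 1 := by
    intro g
    obtain ⟨x, rfl⟩ := QuotientGroup.mk_surjective (s := commutator H) g
    exact hρ x
  have : Finite (Abelianization H) := Quotient.finite _
  obtain ⟨X, hX, hXb⟩ := diag σ hσ
  choose τ hτ using fun ψ : AddChar (Additive (Abelianization H)) ℂ => char_lift ψ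
  let toA : H →* Multiplicative (Additive (Abelianization H)) := Abelianization.of
  let e := X.equivFin
  refine ⟨fun i => if h : i.1 < X.card then (τ (e.symm ⟨i, h⟩)).comp toA else 1,
    fun x hx => ?_⟩
  rw [← hσ']
  have hδ : ∀ ψ ∈ X, ‖ψ (.ofMul (Abelianization.of x)) - 1‖ ≤ 7 * δ := by
    intro ψ hψ
    refine (hτ ψ _).trans ?_
    gcongr
    have hlt : (e ⟨ψ, hψ⟩).1 < M := (e ⟨ψ, hψ⟩).2.trans_le (hX.trans hM)
    have := hx ⟨(e ⟨ψ, hψ⟩).1, hlt⟩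
    simp only [Fin.eta, Equiv.symm_apply_apply, Fin.is_lt, dite_true] at this
    exact this
  refine (hXb _).trans ((Finset.sum_le_sum hδ).trans ?_)
  rw [Finset.sum_const, nsmul_eq_mul]
  gcongr
  exact hX.trans hM

open scoped InnerProductSpace

theorem spec {W : Type*} [NormedAddCommGroup W] [InnerProductSpace ℂ W] [FiniteDimensional ℂ W]
    (S : W →L[ℂ] W) (ε : ℝ) (hε : 0 < ε) {ι : Type*} [Fintype ι] (b : OrthonormalBasis ι ℂ W)
    (K : ℝ) (hK : ∑ i, ‖S (b i)‖ ^ 2 ≤ K) :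
    ∃ V : Submodule ℂ W, (Module.finrank ℂ V : ℝ) * ε ≤ K ∧
      (∀ q ∈ Vᗮ, ‖S q‖ ^ 2 ≤ ε * ‖q‖ ^ 2) ∧
      ∀ L : W ≃ₗᵢ[ℂ] W, (∀ x, S (L x) = L (S x)) → ∀ v ∈ V, L v ∈ V := by
  classical
  let T : W →ₗ[ℂ] W := (ContinuousLinearMap.adjoint S ∘L S : W →L[ℂ] W)
  have hTl : ∀ x y, ⟪T x, y⟫_ℂ = ⟪S x, S y⟫_ℂ := fun x y => by
    simp [T, ContinuousLinearMap.adjoint_inner_left]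
  have hTr : ∀ x y, ⟪x, T y⟫_ℂ = ⟪S x, S y⟫_ℂ := fun x y => by
    simp [T, ContinuousLinearMap.adjoint_inner_right]
  have hT : T.IsSymmetric := fun x y => by rw [hTl, hTr]
  obtain ⟨n, hn⟩ : ∃ n, Module.finrank ℂ W = n := ⟨_, rfl⟩
  let e := hT.eigenvectorBasis hn
  let μ := hT.eigenvalues hn
  have hTe : ∀ i, T (e i) = (μ i : ℂ) • e i := hT.apply_eigenvectorBasis hn
  have hSe : ∀ i, ‖S (e i)‖ ^ 2 = μ i := by
    intro i
    have h : ((‖S (e i)‖ ^ 2 : ℝ) : ℂ) = (μ i : ℂ) := by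
      have := hTr (e i) (e i)
      rw [hTe, inner_smul_right, inner_self_eq_norm_sq_to_K, inner_self_eq_norm_sq_to_K,
        e.norm_eq_one] at this
      simpa using this.symm
    exact_mod_cast h
  have hμ0 : ∀ i, 0 ≤ μ i := fun i => by rw [← hSe]; positivity
  have htr : ∑ i, μ i = ∑ i, ‖S (b i)‖ ^ 2 := by
    have h1 := LinearMap.trace_eq_sum_inner T e
    have h2 := LinearMap.trace_eq_sum_inner T b
    rw [h1] at h2
    simp_rw [hTr, inner_self_eq_norm_sq_to_K] at h2
    simp_rw [← hSe]
    exact_mod_cast h2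
  let I : Finset (Fin n) := Finset.univ.filter fun i => ε ≤ μ i
  have hI : ∀ i, i ∈ I ↔ ε ≤ μ i := by simp [I]
  refine ⟨Submodule.span ℂ (I.image e : Finset W), ?_, ?_, ?_⟩
  · have h1 : Module.finrank ℂ (Submodule.span ℂ ((I.image e : Finset W) : Set W)) ≤ I.card :=
      (finrank_span_finset_le_card _).trans Finset.card_image_le
    calc _ ≤ (I.card : ℝ) * ε := by gcongr
      _ = ∑ i ∈ I, ε := by simp
      _ ≤ ∑ i ∈ I, μ i := Finset.sum_le_sum fun i hi => (hI i).1 hi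
      _ ≤ ∑ i, μ i := Finset.sum_le_sum_of_subset_of_nonneg (Finset.subset_univ _)
          fun i _ _ => hμ0 i
      _ ≤ K := by rw [htr]; exact hK
  · intro q hq
    have h0 : ∀ i ∈ I, ⟪e i, q⟫_ℂ = 0 := fun i hi =>
      (Submodule.mem_orthogonal _ _).1 hq _ (Submodule.subset_span (by
        simpa using ⟨i, hi, rfl⟩))
    have h1 : ‖S q‖ ^ 2 = ∑ i, μ i * ‖⟪e i, q⟫_ℂ‖ ^ 2 := by
      have h2 : ((‖S q‖ ^ 2 : ℝ) : ℂ) = ((∑ i, μ i * ‖⟪e i, q⟫_ℂ‖ ^ 2 : ℝ) : ℂ) := by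
        have h3 := e.sum_inner_mul_inner (T q) q
        rw [hTl, inner_self_eq_norm_sq_to_K] at h3
        push_cast
        refine Eq.trans h3.symm (Finset.sum_congr rfl fun i _ => ?_)
        rw [hT, hTe, inner_smul_right, mul_assoc, ← inner_conj_symm, mul_comm (starRingEnd ℂ _),
          Complex.mul_conj, Complex.normSq_eq_norm_sq]
        push_cast
        rfl
      exact_mod_cast h2
    rw [h1, ← e.sum_sq_norm_inner_right q, Finset.mul_sum]
    refine Finset.sum_le_sum fun i _ => ?_
    by_cases hi : i ∈ I
    · rw [h0 i hi]; simp
    · have : μ i ≤ ε := by rw [hI] at hi; linarith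
      gcongr
  · intro L hL v hv
    have hLs : ∀ x, S (L.symm x) = L.symm (S x) := by
      intro x
      have := hL (L.symm x)
      rw [L.apply_symm_apply] at this
      rw [this, L.symm_apply_apply]
    have hsymm : ∀ x y, ⟪x, L y⟫_ℂ = ⟪L.symm x, y⟫_ℂ := by
      intro x y
      rw [← L.inner_map_map (L.symm x) y, L.apply_symm_apply]
    induction hv using Submodule.span_induction with
    | mem x hx =>
      obtain ⟨i, hi, rfl⟩ : ∃ i ∈ I, e i = x := by simpa using hx
      rw [← e.sum_repr' (L (e i))]
      refine Submodule.sum_mem _ fun j _ => ?_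
      by_cases h : ⟪e j, L (e i)⟫_ℂ = 0
      · rw [h, zero_smul]; exact Submodule.zero_mem _
      · refine Submodule.smul_mem _ _ (Submodule.subset_span ?_)
        have h1 : (μ j : ℂ) * ⟪e j, L (e i)⟫_ℂ = μ i * ⟪e j, L (e i)⟫_ℂ := by
          calc (μ j : ℂ) * ⟪e j, L (e i)⟫_ℂ = ⟪T (e j), L (e i)⟫_ℂ := by
                rw [hTe, inner_smul_left, Complex.conj_ofReal]
            _ = ⟪L.symm (e j), T (e i)⟫_ℂ := by
                rw [hTl, hL, hsymm, ← hLs, hTr]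
            _ = _ := by rw [hTe, inner_smul_right, hsymm]
        have h2 : μ j = μ i := by exact_mod_cast mul_right_cancel₀ h h1
        have : j ∈ I := by rw [hI, h2]; exact (hI i).1 hi
        simpa using ⟨j, this, rfl⟩
    | zero => simp
    | add x y _ _ hx hy => rw [map_add]; exact Submodule.add_mem _ hx hy
    | smul a x _ hx => rw [map_smul]; exact Submodule.smul_mem _ _ hx

/-- restriction of a unitary representation to an invariant subspace -/
noncomputable def subrep {G : Type*} [Group G] {W : Type*} [NormedAddCommGroup W]
    [InnerProductSpace ℂ W] [FiniteDimensional ℂ W] (L : G →* (W ≃ₗᵢ[ℂ] W))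
    (V : Submodule ℂ W) (hV : ∀ g, ∀ v ∈ V, L g v ∈ V) : G →* (V →L[ℂ] V) where
  toFun g := LinearMap.toContinuousLinearMap
    (((L g).toLinearEquiv : W →ₗ[ℂ] W).restrict (hV g))
  map_one' := by ext v; simp
  map_mul' g h := by ext v; simp

lemma subrep_apply {G : Type*} [Group G] {W : Type*} [NormedAddCommGroup W]
    [InnerProductSpace ℂ W] [FiniteDimensional ℂ W] (L : G →* (W ≃ₗᵢ[ℂ] W))
    (V : Submodule ℂ W) (hV : ∀ g, ∀ v ∈ V, L g v ∈ V) (g : G) (v : V) :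
    ((subrep L V hV g v : V) : W) = L g v := rfl

lemma subrep_norm {G : Type*} [Group G] {W : Type*} [NormedAddCommGroup W]
    [InnerProductSpace ℂ W] [FiniteDimensional ℂ W] (L : G →* (W ≃ₗᵢ[ℂ] W))
    (V : Submodule ℂ W) (hV : ∀ g, ∀ v ∈ V, L g v ∈ V) (g : G) :
    ‖subrep L V hV g‖ ≤ 1 := by
  refine ContinuousLinearMap.opNorm_le_bound _ zero_le_one fun v => ?_
  rw [← Submodule.norm_coe, subrep_apply, LinearIsometryEquiv.norm_map]; simp

/-- left translation -/
noncomputable def Lt {G : Type*} [Group G] [Fintype G] :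
    G →* (EuclideanSpace ℂ G ≃ₗᵢ[ℂ] EuclideanSpace ℂ G) where
  toFun g := LinearIsometryEquiv.piLpCongrLeft 2 ℂ ℂ (Equiv.mulLeft g)
  map_one' := by
    ext f x
    simp [LinearIsometryEquiv.piLpCongrLeft_apply, Equiv.piCongrLeft']
    rfl
  map_mul' g h := by
    ext f x
    simp [LinearIsometryEquiv.piLpCongrLeft_apply, Equiv.piCongrLeft']
    rfl

lemma Lt_apply {G : Type*} [Group G] [Fintype G] (g : G) (f : EuclideanSpace ℂ G) (x : G) :
    Lt g f x = f (g⁻¹ * x) := by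
  simp [Lt, LinearIsometryEquiv.piLpCongrLeft_apply, Equiv.piCongrLeft']

/-- right translation -/
noncomputable def Rt {G : Type*} [Group G] [Fintype G] (g : G) :
    (EuclideanSpace ℂ G ≃ₗᵢ[ℂ] EuclideanSpace ℂ G) :=
  LinearIsometryEquiv.piLpCongrLeft 2 ℂ ℂ (Equiv.mulRight g)

lemma Rt_apply {G : Type*} [Group G] [Fintype G] (g : G) (f : EuclideanSpace ℂ G) (x : G) :
    Rt g f x = f (x * g⁻¹) := by
  simp [Rt, LinearIsometryEquiv.piLpCongrLeft_apply, Equiv.piCongrLeft']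

/-- right convolution by a set -/
noncomputable def conv {G : Type*} [Group G] [Fintype G] (B : Finset G) :
    EuclideanSpace ℂ G →L[ℂ] EuclideanSpace ℂ G :=
  ∑ y ∈ B, ((Rt y).toContinuousLinearEquiv : EuclideanSpace ℂ G →L[ℂ] EuclideanSpace ℂ G)

lemma conv_eq {G : Type*} [Group G] [Fintype G] (B : Finset G) (f : EuclideanSpace ℂ G) :
    conv B f = ∑ y ∈ B, Rt y f := by
  simp [conv]

lemma conv_apply {G : Type*} [Group G] [Fintype G] (B : Finset G) (f : EuclideanSpace ℂ G)
    (x : G) : conv B f x = ∑ y ∈ B, f (x * y⁻¹) := by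
  rw [conv_eq]
  simp [Rt_apply]

lemma conv_comm {G : Type*} [Group G] [Fintype G] (B : Finset G) (g : G)
    (f : EuclideanSpace ℂ G) : conv B (Lt g f) = Lt g (conv B f) := by
  ext x
  simp [conv_apply, Lt_apply, mul_assoc]

lemma conv_norm {G : Type*} [Group G] [Fintype G] (B : Finset G) (f : EuclideanSpace ℂ G) :
    ‖conv B f‖ ≤ Fintype.card G * ‖f‖ := by
  rw [conv_eq]
  refine (norm_sum_le _ _).trans ?_
  simp only [LinearIsometryEquiv.norm_map, Finset.sum_const, nsmul_eq_mul]
  gcongr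
  exact Finset.card_le_univ B

lemma conv_basis {G : Type*} [Group G] [Fintype G] [DecidableEq G] (B : Finset G) (g : G) :
    ‖conv B (EuclideanSpace.single g 1)‖ ^ 2 ≤ Fintype.card G := by
  rw [EuclideanSpace.norm_sq_eq]
  have : ∀ x, ‖conv B (EuclideanSpace.single g 1) x‖ ^ 2 ≤ 1 := by
    intro x
    rw [conv_apply]
    have h : ∑ y ∈ B, (EuclideanSpace.single g (1 : ℂ)) (x * y⁻¹) =
        if g⁻¹ * x ∈ B then 1 else 0 := by
      rw [← Finset.sum_ite_eq' B (g⁻¹ * x) (fun _ => (1 : ℂ))]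
      refine Finset.sum_congr rfl fun y _ => ?_
      have : (x * y⁻¹ = g) ↔ (y = g⁻¹ * x) := by
        constructor
        · rintro rfl; group
        · rintro rfl; group
      simp [this]
    rw [h]
    split_ifs <;> simp
  refine (Finset.sum_le_sum fun x _ => this x).trans ?_
  simp

/-- indicator vector -/
noncomputable def ind {G : Type*} [Fintype G] [DecidableEq G] (A : Finset G) :
    EuclideanSpace ℂ G := WithLp.toLp 2 fun x => if x ∈ A then 1 else 0

lemma ind_norm {G : Type*} [Fintype G] [DecidableEq G] (A : Finset G) :
    ‖ind A‖ ^ 2 ≤ Fintype.card G := by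
  rw [EuclideanSpace.norm_sq_eq]
  refine (Finset.sum_le_sum (g := fun _ => 1) fun x _ => ?_).trans ?_
  · simp only [ind]; split_ifs <;> simp
  · simp

lemma conv_ind_mem {G : Type*} [Group G] [Fintype G] [DecidableEq G] (A B : Finset G) (x : G)
    (h : conv B (ind A) x ≠ 0) : x ∈ A * B := by
  rw [conv_apply] at h
  obtain ⟨y, hy, hne⟩ := Finset.exists_ne_zero_of_sum_ne_zero h
  have : x * y⁻¹ ∈ A := by
    by_contra hh; simp [ind, hh] at hne
  exact Finset.mem_mul.mpr ⟨_, this, y, hy, by group⟩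

lemma conv_ind_norm {G : Type*} [Group G] [Fintype G] [DecidableEq G] (A B : Finset G) :
    ((A.card : ℝ) * B.card) ^ 2 ≤ Fintype.card G * ‖conv B (ind A)‖ ^ 2 := by
  have h1 : ∑ x, conv B (ind A) x = (A.card : ℂ) * B.card := by
    simp_rw [conv_apply]
    rw [Finset.sum_comm]
    have : ∀ y, ∑ x, ind A (x * y⁻¹) = (A.card : ℂ) := by
      intro y
      rw [Fintype.sum_equiv (Equiv.mulRight y⁻¹) (fun x => ind A (x * y⁻¹)) (fun x => ind A x)
        (fun x => by simp)]
      simp [ind]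
    simp_rw [this]
    simp [mul_comm]
  have h2 : (A.card : ℝ) * B.card ≤ ∑ x, ‖conv B (ind A) x‖ := by
    have := norm_sum_le Finset.univ (fun x => conv B (ind A) x)
    rw [h1] at this
    simpa using this
  rw [EuclideanSpace.norm_sq_eq]
  calc _ ≤ (∑ x, ‖conv B (ind A) x‖) ^ 2 := by gcongr
    _ ≤ _ := sq_sum_le_card_mul_sum_sq


lemma subrep_close {G : Type*} [Group G] {W : Type*} [NormedAddCommGroup W]
    [InnerProductSpace ℂ W] [FiniteDimensional ℂ W] (L : G →* (W ≃ₗᵢ[ℂ] W))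
    (V : Submodule ℂ W) (hV : ∀ g, ∀ v ∈ V, L g v ∈ V) (g : G) (θ : ℝ)
    (h : ‖subrep L V hV g - 1‖ ≤ θ) (p : W) (hp : p ∈ V) : ‖L g p - p‖ ≤ θ * ‖p‖ :=
  (subrep L V hV g - 1).le_of_opNorm_le h ⟨p, hp⟩

theorem bohr_end {G : Type*} [Group G] [Finite G] {V : Type*} [NormedAddCommGroup V]
    [InnerProductSpace ℂ V] [FiniteDimensional ℂ V] (ρ : G →* (V →L[ℂ] V))
    (hρ : ∀ g, ‖ρ g‖ ≤ 1) (N : ℕ) (hdim : Module.finrank ℂ V ≤ N) (δ : ℝ) (hδ0 : 0 ≤ δ) :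
    ∃ H : Subgroup G, H.Normal ∧ H.index ≤ 5 ^ (2 * N ^ 2) ∧
      ∃ τ : Fin (N ^ 2) → (H →* Multiplicative (AddCircle (1 : ℝ))),
        ∀ x : H, (∀ i, ‖(τ i x).toAdd‖ ≤ δ) → ‖ρ x - 1‖ ≤ ((N ^ 2 : ℕ) : ℝ) * (7 * δ) := by
  have hE : Module.finrank ℂ (V →L[ℂ] V) ≤ N ^ 2 := by
    rw [← LinearEquiv.finrank_eq (LinearMap.toContinuousLinearMap (𝕜 := ℂ) (E := V) (F' := V)),
      Module.finrank_linearMap, sq]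
    exact Nat.mul_le_mul hdim hdim
  have : FiniteDimensional ℂ (V →L[ℂ] V) :=
    (LinearMap.toContinuousLinearMap (𝕜 := ℂ) (E := V) (F' := V)).finiteDimensional
  exact bohr_of_rep (E := V →L[ℂ] V) ρ hρ (N ^ 2) hE δ hδ0

theorem bohr_subrep {G : Type*} [Group G] [Finite G] {W : Type*} [NormedAddCommGroup W]
    [InnerProductSpace ℂ W] [FiniteDimensional ℂ W] (L : G →* (W ≃ₗᵢ[ℂ] W))
    (V : Submodule ℂ W) (hV : ∀ g, ∀ v ∈ V, L g v ∈ V) (N : ℕ)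
    (hdim : Module.finrank ℂ V ≤ N) (δ : ℝ) (hδ0 : 0 ≤ δ) (θ : ℝ)
    (hθ : ((N ^ 2 : ℕ) : ℝ) * (7 * δ) ≤ θ) :
    ∃ H : Subgroup G, H.Normal ∧ H.index ≤ 5 ^ (2 * N ^ 2) ∧
      ∃ τ : Fin (N ^ 2) → (H →* Multiplicative (AddCircle (1 : ℝ))),
        ∀ x : H, (∀ i, ‖(τ i x).toAdd‖ ≤ δ) → ∀ p ∈ V, ‖L x p - p‖ ≤ θ * ‖p‖ := by
  obtain ⟨H, h1, h2, τ, hτ⟩ :=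
    bohr_end (G := G) (V := V) (subrep L V hV) (subrep_norm L V hV) N hdim δ hδ0
  exact ⟨H, h1, h2, τ, fun x hx p hp => subrep_close L V hV x θ ((hτ x hx).trans hθ) p hp⟩

theorem mem_of_close {G : Type} [Group G] [Fintype G] [DecidableEq G] (A B : Finset G)
    (α : ℝ) (hα : 0 < α) (n : ℝ) (hn : n = Fintype.card G) (hn0 : 0 < n)
    (hA : α * n ≤ A.card) (hB : α * n ≤ B.card)
    (θ : ℝ) (hθ : θ = α ^ 2 / 4) (hθ0 : 0 < θ) (V : Submodule ℂ (EuclideanSpace ℂ G))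
    (hV2 : ∀ q ∈ Vᗮ, ‖conv B q‖ ^ 2 ≤ (θ ^ 2 * n ^ 2) * ‖q‖ ^ 2) (g : G)
    (hx' : ∀ p ∈ V, ‖Lt g p - p‖ ≤ θ * ‖p‖) : g ∈ (A * B) * (A * B)⁻¹ := by
  by_contra hnot
  obtain ⟨r, hr⟩ : ∃ r, r = Real.sqrt n := ⟨_, rfl⟩
  have hr2 : r ^ 2 = n := by rw [hr]; exact Real.sq_sqrt hn0.le
  have hr0 : 0 < r := by rw [hr]; exact Real.sqrt_pos.mpr hn0
  obtain ⟨F, hF⟩ : ∃ F, F = conv B (ind A) := ⟨_, rfl⟩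
  have hdisj : ∀ y, F y = 0 ∨ F (g⁻¹ * y) = 0 := by
    intro y
    by_contra h
    push Not at h
    have m1 := conv_ind_mem A B y (hF ▸ h.1)
    have m2 := conv_ind_mem A B _ (hF ▸ h.2)
    exact hnot (Finset.mem_mul.mpr ⟨y, m1, (g⁻¹ * y)⁻¹, Finset.inv_mem_inv m2, by group⟩)
  have hlow : ‖F‖ ≤ ‖Lt g F - F‖ := by
    rw [EuclideanSpace.norm_eq, EuclideanSpace.norm_eq]
    refine Real.sqrt_le_sqrt (Finset.sum_le_sum fun y _ => ?_)
    rw [PiLp.sub_apply, Lt_apply]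
    rcases hdisj y with h | h
    · rw [h]; simp
    · rw [h]; simp
  have hFn : α ^ 2 * r ^ 3 ≤ ‖F‖ := by
    have k1 := conv_ind_norm A B
    rw [← hF, ← hn] at k1
    have k2 : ((α * n) * (α * n)) ^ 2 ≤ n * ‖F‖ ^ 2 := by
      refine le_trans ?_ k1
      have : 0 ≤ α * n := by positivity
      gcongr
    have k3 : n * (α ^ 2 * r ^ 3) ^ 2 ≤ n * ‖F‖ ^ 2 := by
      refine le_trans (le_of_eq ?_) k2
      rw [← hr2]; ring
    have k4 := le_of_mul_le_mul_left k3 hn0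
    exact (sq_le_sq₀ (by positivity) (by positivity)).1 k4
  obtain ⟨p, hp, q, hq, hpq⟩ := V.exists_add_mem_mem_orthogonal (ind A)
  have hf : ‖p‖ ^ 2 + ‖q‖ ^ 2 ≤ r ^ 2 := by
    have := norm_add_sq_eq_norm_sq_add_norm_sq_of_inner_eq_zero (𝕜 := ℂ) p q
      ((Submodule.mem_orthogonal _ _).1 hq p hp)
    rw [← hpq] at this
    have h3 := ind_norm A
    rw [← hn] at h3
    rw [hr2]
    nlinarith
  have hpn : ‖p‖ ≤ r := by
    exact (sq_le_sq₀ (by positivity) (by positivity)).1 (by nlinarith [sq_nonneg ‖q‖])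
  have hqn : ‖q‖ ≤ r := by
    exact (sq_le_sq₀ (by positivity) (by positivity)).1 (by nlinarith [sq_nonneg ‖p‖])
  have hSq : ‖conv B q‖ ≤ θ * r ^ 3 := by
    have k := hV2 q hq
    have : ‖conv B q‖ ^ 2 ≤ (θ * r ^ 3) ^ 2 := by
      refine k.trans ?_
      calc θ ^ 2 * n ^ 2 * ‖q‖ ^ 2 ≤ θ ^ 2 * n ^ 2 * r ^ 2 := by gcongr
        _ = _ := by rw [← hr2]; ring
    exact (sq_le_sq₀ (by positivity) (by positivity)).1 this
  have hSp : ‖conv B (Lt g p - p)‖ ≤ θ * r ^ 3 := by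
    refine (conv_norm _ _).trans ?_
    rw [← hn]
    have k : ‖Lt g p - p‖ ≤ θ * ‖p‖ := by
      exact hx' p hp
    calc n * ‖Lt g p - p‖ ≤ n * (θ * r) := by
          gcongr
          exact k.trans (by gcongr)
      _ = _ := by rw [← hr2]; ring
  have hup : ‖Lt g F - F‖ ≤ 3 * (θ * r ^ 3) := by
    have e : Lt g F - F = conv B (Lt g p - p) + Lt g (conv B q) - conv B q := by
      rw [hF, hpq, map_add, map_add, map_sub, conv_comm]; abel
    rw [e]
    refine (norm_sub_le _ _).trans ?_
    have := norm_add_le (conv B (Lt g p - p)) (Lt g (conv B q))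
    rw [LinearIsometryEquiv.norm_map] at this
    linarith
  have : 0 < θ * r ^ 3 := by positivity
  have e4 : α ^ 2 * r ^ 3 = 4 * (θ * r ^ 3) := by rw [hθ]; ring
  linarith

theorem one_pair {G : Type} [Group G] [Fintype G] [DecidableEq G] (A B : Finset G)
    (α : ℝ) (hα : 0 < α) (hA : α * Fintype.card G ≤ A.card) (hB : α * Fintype.card G ≤ B.card)
    (N : ℕ) (hN : 1 ≤ (α ^ 2 / 4) ^ 2 * N) (δ : ℝ) (hδ : 0 ≤ δ)
    (hδ' : ((N ^ 2 : ℕ) : ℝ) * (7 * δ) ≤ α ^ 2 / 4) :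
    ∃ H : Subgroup G, H.Normal ∧ H.index ≤ 5 ^ (2 * N ^ 2) ∧
      ∃ τ : Fin (N ^ 2) → (H →* Multiplicative (AddCircle (1 : ℝ))),
        ∀ x : H, (∀ i, ‖(τ i x).toAdd‖ ≤ δ) → (x : G) ∈ (A * B) * (A * B)⁻¹ := by
  obtain ⟨n, hn⟩ : ∃ n : ℝ, n = Fintype.card G := ⟨_, rfl⟩
  rw [← hn] at hA hB
  have hn0 : 0 < n := by rw [hn]; exact_mod_cast Fintype.card_pos
  obtain ⟨θ, hθ⟩ : ∃ θ, θ = α ^ 2 / 4 := ⟨_, rfl⟩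
  rw [← hθ] at hN hδ'
  have hθ0 : 0 < θ := by rw [hθ]; positivity
  have hK : ∑ i, ‖conv B (EuclideanSpace.basisFun G ℂ i)‖ ^ 2 ≤ n ^ 2 := by
      refine (Finset.sum_le_sum (g := fun _ => n) fun g _ => ?_).trans ?_
      · rw [EuclideanSpace.basisFun_apply]; rw [hn]; exact conv_basis B g
      · simp [sq, hn]
  have hsp := spec (conv B) (θ ^ 2 * n ^ 2) (by positivity)
    (EuclideanSpace.basisFun G ℂ) (n ^ 2) hK
  obtain ⟨V, hV1, hV2, hV3⟩ := hsp
  have hV : ∀ g, ∀ v ∈ V, Lt (G := G) g v ∈ V := fun g => hV3 (Lt (G := G) g) (conv_comm B g)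
  have hdim : Module.finrank ℂ V ≤ N := by
    have h1 : (Module.finrank ℂ V : ℝ) * θ ^ 2 ≤ 1 := by
      have : ((Module.finrank ℂ V : ℝ) * θ ^ 2) * n ^ 2 ≤ 1 * n ^ 2 := by linarith
      exact le_of_mul_le_mul_right this (by positivity)
    have h2 : (Module.finrank ℂ V : ℝ) * θ ^ 2 ≤ N * θ ^ 2 := by linarith
    exact_mod_cast le_of_mul_le_mul_right h2 (by positivity)
  obtain ⟨H, h1, h2, τ, hτ⟩ := bohr_subrep (G := G) (W := EuclideanSpace ℂ G) (Lt (G := G)) V hV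
    N hdim δ hδ θ hδ'
  exact ⟨H, h1, h2, τ, fun x hx =>
    mem_of_close A B α hα n hn hn0 hA hB θ hθ hθ0 V hV2 x (hτ x hx)⟩

theorem combine {G : Type} [Group G] [Fintype G] (M K : ℕ) (δ : ℝ) (P : Fin 4 → Set G)
    (h : ∀ j, ∃ H : Subgroup G, H.Normal ∧ H.index ≤ K ∧
      ∃ τ : Fin M → (H →* Multiplicative (AddCircle (1 : ℝ))),
        ∀ x : H, (∀ i, ‖(τ i x).toAdd‖ ≤ δ) → (x : G) ∈ P j) :
    ∃ H : Subgroup G, H.Normal ∧ H.index ≤ K ^ 4 ∧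
      ∃ τ : H →* Multiplicative (Torus (4 * M)),
        ∀ x : H, dist (0 : Torus (4 * M)) (Multiplicative.toAdd (τ x)) < δ →
          ∀ j, (x : G) ∈ P j := by
  choose H hn hi τ hτ using h
  refine ⟨⨅ j, H j, Subgroup.normal_iInf_normal hn, ?_, ?_⟩
  · refine (Subgroup.index_iInf_le H).trans ?_
    refine (Finset.prod_le_prod' fun j _ => hi j).trans ?_
    simp
  · let inc : ∀ j, (⨅ j, H j : Subgroup G) →* H j := fun j => Subgroup.inclusion (iInf_le H j)
    let t : (⨅ j, H j : Subgroup G) →* Multiplicative (Torus (4 * M)) :=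
      MonoidHom.mk' (fun x => .ofAdd fun k =>
        (τ (finProdFinEquiv.symm k).1 (finProdFinEquiv.symm k).2
          (inc (finProdFinEquiv.symm k).1 x)).toAdd) (fun x y => by
            rw [← ofAdd_add]
            congr 1
            funext k
            simp)
    refine ⟨t, fun x hx j => hτ j (inc j x) fun i => ?_⟩
    have h1 := (dist_le_pi_dist _ _ (finProdFinEquiv (j, i))).trans hx.le
    rw [dist_comm, Pi.zero_apply, dist_zero_right] at h1
    have h2 : (Multiplicative.toAdd (t x)) (finProdFinEquiv (j, i)) =
        (τ j i (inc j x)).toAdd := by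
      change (τ (finProdFinEquiv.symm (finProdFinEquiv (j, i))).1
        (finProdFinEquiv.symm (finProdFinEquiv (j, i))).2
          (inc (finProdFinEquiv.symm (finProdFinEquiv (j, i))).1 x)).toAdd = _
      rw [Equiv.symm_apply_apply]
    rwa [h2] at h1

end Bog

/-- **Bogolyubov's Lemma for arbitrary finite groups.** For every real `α > 0` there is `C`
such that: if `G` is a finite group and `A ⊆ G` with `|A| ≥ α|G|`, then there are a normal
subgroup `H ≤ G` of index at most `C`, and a `(δ, n)`-Bohr neighborhood `B` in `H` with
`δ⁻¹, n ≤ C`, such that `B ⊆ (AA⁻¹)² ∩ A²A⁻² ∩ (A⁻¹A)² ∩ A⁻²A²`. -/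
theorem bogolyubov_general (α : ℝ) (hα : 0 < α) :
    ∃ C : ℕ, ∀ (G : Type) [Group G] [Fintype G] [DecidableEq G],
      ∀ A : Finset G, α * (Fintype.card G : ℝ) ≤ (A.card : ℝ) →
      ∃ (H : Subgroup G) (δ : ℝ) (n : ℕ) (B : Set H),
        H.Normal ∧ H.index ≤ C ∧
        0 < δ ∧ δ⁻¹ ≤ (C : ℝ) ∧ 0 < n ∧ n ≤ C ∧
        IsBohrNbhd δ n B ∧
        (∀ x : H, x ∈ B → (x : G) ∈
          ((A * A⁻¹) ^ 2 ∩ (A ^ 2 * A⁻¹ ^ 2) ∩ (A⁻¹ * A) ^ 2 ∩ (A⁻¹ ^ 2 * A ^ 2) :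
            Finset G)) := by
  obtain ⟨N, hN⟩ := exists_nat_ge (1 / (α ^ 2 / 4) ^ 2)
  have hθ : 0 < (α ^ 2 / 4) ^ 2 := by positivity
  have hN1 : 1 ≤ (α ^ 2 / 4) ^ 2 * N := by
    rw [div_le_iff₀ hθ] at hN; linarith
  have hN0 : 0 < N := by
    rcases Nat.eq_zero_or_pos N with h | h
    · rw [h] at hN1; norm_num at hN1
    · exact h
  have hNR : (0 : ℝ) < ((N ^ 2 : ℕ) : ℝ) := by exact_mod_cast pow_pos hN0 2
  set δ : ℝ := (α ^ 2 / 4) / (7 * ((N ^ 2 : ℕ) : ℝ)) with hδ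
  have hδ0 : 0 < δ := by positivity
  have hδ' : ((N ^ 2 : ℕ) : ℝ) * (7 * δ) ≤ α ^ 2 / 4 := by
    apply le_of_eq; rw [hδ]; field_simp
  obtain ⟨D, hD⟩ := exists_nat_ge δ⁻¹
  refine ⟨D + 4 * N ^ 2 + (5 ^ (2 * N ^ 2)) ^ 4, ?_⟩
  intro G _ _ _ A hA
  have hA' : α * (Fintype.card G : ℝ) ≤ (A⁻¹.card : ℝ) := by rwa [Finset.card_inv]
  let X : Fin 4 → Finset G := ![A, A, A⁻¹, A⁻¹]
  let Y : Fin 4 → Finset G := ![A⁻¹, A, A, A⁻¹]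
  have hX : ∀ j, α * (Fintype.card G : ℝ) ≤ ((X j).card : ℝ) := by
    intro j; fin_cases j <;> assumption
  have hY : ∀ j, α * (Fintype.card G : ℝ) ≤ ((Y j).card : ℝ) := by
    intro j; fin_cases j <;> assumption
  obtain ⟨H, hn, hi, τ, hτ⟩ := Bog.combine (G := G) (N ^ 2) (5 ^ (2 * N ^ 2)) δ
    (fun j => (((X j * Y j) * (X j * Y j)⁻¹ : Finset G) : Set G))
    (fun j => Bog.one_pair (X j) (Y j) α hα (hX j) (hY j) N hN1 δ hδ0.le hδ')
  refine ⟨H, δ, 4 * N ^ 2, _, hn, hi.trans (by omega), hδ0, ?_, by positivity, by omega,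
    ⟨τ, rfl⟩, ?_⟩
  · push_cast
    have : (0 : ℝ) ≤ 4 * (N : ℝ) ^ 2 + (5 ^ (2 * N ^ 2)) ^ 4 := by positivity
    linarith
  · intro x hx
    have h := hτ x hx
    have h0 := h 0
    have h1 := h 1
    have h2 := h 2
    have h3 := h 3
    simp only [X, Y, Finset.mem_coe, mul_inv_rev, inv_inv, Matrix.cons_val] at h0 h1 h2 h3
    simp only [Finset.mem_inter, sq]
    refine ⟨⟨⟨?_, ?_⟩, ?_⟩, ?_⟩
    · exact h0
    · exact h1
    · exact h2
    · exact h3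
end

section
/- For every real α > 0 there is a constant C = C(α) such that the following holds. If G is a purely nonabelian finite group and A ⊆ G satisfies |A| ≥ α|G|, then there is a normal subgroup H of G with [G : H] ≤ C and H ⊆ (AA⁻¹)² ∩ A²A⁻² ∩ (A⁻¹A)² ∩ A⁻²A². -/
open Pointwise

/-- A nontrivial group `G` is purely nonabelian if every normal subgroup `H ≤ G`
satisfies `⁅H, H⁆ = H`, i.e. no normal subgroup has a nontrivial abelian quotient. -/
def PurelyNonabelian (G : Type*) [Group G] : Prop :=
  Nontrivial G ∧ ∀ H : Subgroup G, H.Normal → ⁅H, H⁆ = H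


section
open scoped commutatorElement
variable {G : Type*} [Group G] {E : Type*} [NormedAddCommGroup E] [InnerProductSpace ℝ E]

def nearSet (ρ : G →* (E ≃ₗᵢ[ℝ] E)) (V : Submodule ℝ E) (r : ℝ) : Set G :=
  {g | ∀ w ∈ V, ‖ρ g w - w‖ ≤ r * ‖w‖}

def fixSub (ρ : G →* (E ≃ₗᵢ[ℝ] E)) (V : Submodule ℝ E) : Subgroup G where
  carrier := {g | ∀ w ∈ V, ρ g w = w}
  one_mem' := by intro w _; simp
  mul_mem' := by
    intro a b ha hb w hw
    simp only [map_mul, LinearIsometryEquiv.coe_mul, Function.comp]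
    rw [hb w hw, ha w hw]
  inv_mem' := by
    intro a ha w hw
    have := ha w hw
    conv_lhs => rw [← this]
    change (ρ a⁻¹ * ρ a) w = w
    rw [← map_mul]
    simp

lemma rho_mul (ρ : G →* (E ≃ₗᵢ[ℝ] E)) (a b : G) (w : E) : ρ (a * b) w = ρ a (ρ b w) := by
  rw [map_mul]; rfl

lemma rho_one (ρ : G →* (E ≃ₗᵢ[ℝ] E)) (w : E) : ρ 1 w = w := by
  rw [map_one]; rfl

lemma fixSub_normal (ρ : G →* (E ≃ₗᵢ[ℝ] E)) (V : Submodule ℝ E)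
    (hV : ∀ g, ∀ w ∈ V, ρ g w ∈ V) : (fixSub ρ V).Normal := by
  constructor
  intro n hn g w hw
  have h1 := hn (ρ g⁻¹ w) (hV _ _ hw)
  rw [rho_mul, rho_mul, h1, ← rho_mul]
  simp

lemma near_conj (ρ : G →* (E ≃ₗᵢ[ℝ] E)) (V : Submodule ℝ E)
    (hV : ∀ g, ∀ w ∈ V, ρ g w ∈ V) (r : ℝ) (g h : G) (hg : g ∈ nearSet ρ V r) :
    h * g * h⁻¹ ∈ nearSet ρ V r := by
  intro w hw
  have h1 := hg (ρ h⁻¹ w) (hV _ _ hw)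
  rw [LinearIsometryEquiv.norm_map] at h1
  have h2 : ρ (h * g * h⁻¹) w - w = ρ h (ρ g (ρ h⁻¹ w) - ρ h⁻¹ w) := by
    rw [map_sub, ← rho_mul, ← rho_mul, ← rho_mul]
    simp [mul_assoc]
  rw [h2, LinearIsometryEquiv.norm_map]
  exact h1

lemma near_comm (ρ : G →* (E ≃ₗᵢ[ℝ] E)) (V : Submodule ℝ E)
    (hV : ∀ g, ∀ w ∈ V, ρ g w ∈ V) (r s : ℝ) (hr : 0 ≤ r) (hs : 0 ≤ s) (a b : G)
    (ha : a ∈ nearSet ρ V r) (hb : b ∈ nearSet ρ V s) :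
    ⁅a, b⁆ ∈ nearSet ρ V (2 * r * s) := by
  intro w hw
  set u := ρ (b * a)⁻¹ w with hu
  have huV : u ∈ V := hV _ _ hw
  have hun : ‖w‖ = ‖u‖ := by rw [hu, LinearIsometryEquiv.norm_map]
  have hwu : w = ρ b (ρ a u) := by
    rw [hu, ← rho_mul, ← rho_mul, mul_inv_cancel, rho_one]
  have hcu : ρ ⁅a, b⁆ w = ρ a (ρ b u) := by
    rw [hu, ← rho_mul, ← rho_mul, commutatorElement_def]
    congr 2; group
  have key : ρ ⁅a, b⁆ w - w = (ρ a (ρ b u - u) - (ρ b u - u)) - (ρ b (ρ a u - u) - (ρ a u - u)) := by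
    rw [hcu, hwu]; simp only [map_sub]; abel
  have h1 := ha _ (V.sub_mem (hV b u huV) huV)
  have h2 := hb _ (V.sub_mem (hV a u huV) huV)
  have h3 := ha _ huV
  have h4 := hb _ huV
  rw [key, hun]
  refine (norm_sub_le _ _).trans ?_
  have h5 := mul_le_mul_of_nonneg_left h4 hr
  have h6 := mul_le_mul_of_nonneg_left h3 hs
  linarith

lemma closure_comm_le (S T : Set G) (K : Subgroup G) [hK : K.Normal]
    (h : ∀ a ∈ S, ∀ b ∈ T, ⁅a, b⁆ ∈ K) :
    ⁅Subgroup.closure S, Subgroup.closure T⁆ ≤ K := by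
  have hq : ∀ a b : G, ⁅a, b⁆ ∈ K ↔ Commute (QuotientGroup.mk' K a) (QuotientGroup.mk' K b) := by
    intro a b
    rw [← commutatorElement_eq_one_iff_commute, ← map_commutatorElement]
    simp only [QuotientGroup.mk'_apply, QuotientGroup.eq_one_iff]
  rw [Subgroup.commutator_le]
  intro a ha b hb
  rw [hq]
  induction ha using Subgroup.closure_induction with
  | one => simp
  | mul x y _ _ hx hy => rw [map_mul]; exact hx.mul_left hy
  | inv x _ hx => rw [map_inv]; exact hx.inv_left
  | mem x hx =>
    induction hb using Subgroup.closure_induction with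
    | one => simp
    | mul x y _ _ hx hy => rw [map_mul]; exact hx.mul_right hy
    | inv x _ hx => rw [map_inv]; exact hx.inv_right
    | mem y hy => exact (hq _ _).1 (h _ hx _ hy)

lemma near_normal (ρ : G →* (E ≃ₗᵢ[ℝ] E)) (V : Submodule ℝ E)
    (hV : ∀ g, ∀ w ∈ V, ρ g w ∈ V) (r : ℝ) : (Subgroup.closure (nearSet ρ V r)).Normal := by
  have : Group.conjugatesOfSet (nearSet ρ V r) = nearSet ρ V r := by
    apply Set.Subset.antisymm _ Group.subset_conjugatesOfSet
    intro x hx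
    rw [Group.mem_conjugatesOfSet_iff] at hx
    obtain ⟨a, ha, hax⟩ := hx
    obtain ⟨c, rfl⟩ := isConj_iff.1 hax
    exact near_conj ρ V hV r a c ha
  rw [← this]
  exact Subgroup.normalClosure_normal

lemma near_fix [Finite G] (hG : ∀ H : Subgroup G, H.Normal → ⁅H, H⁆ = H)
    (ρ : G →* (E ≃ₗᵢ[ℝ] E)) (V : Submodule ℝ E)
    (hV : ∀ g, ∀ w ∈ V, ρ g w ∈ V) : nearSet ρ V (1/4) ⊆ fixSub ρ V := by
  have step : ∀ k : ℕ, Subgroup.closure (nearSet ρ V (1/4)) ≤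
      Subgroup.closure (nearSet ρ V (1/4 * (1/2) ^ k)) := by
    intro k
    induction k with
    | zero => simp
    | succ k ih =>
      have hn := near_normal ρ V hV (1/4)
      have hn' := near_normal ρ V hV (1/4 * (1/2) ^ (k+1))
      calc _ = ⁅Subgroup.closure (nearSet ρ V (1/4)), Subgroup.closure (nearSet ρ V (1/4))⁆ := (hG _ hn).symm
        _ ≤ ⁅Subgroup.closure (nearSet ρ V (1/4)), Subgroup.closure (nearSet ρ V (1/4 * (1/2)^k))⁆ :=
          Subgroup.commutator_mono le_rfl ih
        _ ≤ _ := by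
          apply closure_comm_le
          intro a ha b hb
          apply Subgroup.subset_closure
          have := near_comm ρ V hV _ _ (by norm_num) (by positivity) a b ha hb
          have e : (1/4 * (1/2) ^ (k+1) : ℝ) = 2 * (1/4) * (1/4 * (1/2) ^ k) := by ring
          rw [e]; exact this
  have ev : ∀ g : G, ∀ᶠ k : ℕ in Filter.atTop,
      g ∈ nearSet ρ V (1/4 * (1/2) ^ k) → g ∈ fixSub ρ V := by
    intro g
    by_cases hg : g ∈ fixSub ρ V
    · exact Filter.Eventually.of_forall fun _ _ => hg
    have : ∃ w ∈ V, ρ g w ≠ w := by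
      by_contra! hc
      exact hg hc
    obtain ⟨w, hw, hne⟩ := this
    have hpos : 0 < ‖ρ g w - w‖ := norm_pos_iff.2 (sub_ne_zero.2 hne)
    have lim : Filter.Tendsto (fun k : ℕ => (1/4 * (1/2 : ℝ) ^ k) * ‖w‖) Filter.atTop (nhds 0) := by
      have := ((tendsto_pow_atTop_nhds_zero_of_lt_one (r := (1/2 : ℝ)) (by norm_num) (by norm_num)).const_mul (1/4)).mul_const ‖w‖
      simpa using this
    filter_upwards [lim.eventually (gt_mem_nhds hpos)] with k hk hn
    exact absurd (hn w hw) (not_le.2 hk)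
  obtain ⟨k, hk⟩ := (Filter.eventually_all.2 ev).exists
  intro g hg
  have h1 := step k (Subgroup.subset_closure hg)
  exact (Subgroup.closure_le _).2 (fun x hx => hk x hx) h1

lemma jordan (n : ℕ) : ∃ C : ℕ, ∀ (G : Type) [Group G] [Finite G]
    (_hG : ∀ H : Subgroup G, H.Normal → ⁅H, H⁆ = H)
    (E : Type) [NormedAddCommGroup E] [InnerProductSpace ℝ E] [FiniteDimensional ℝ E]
    (ρ : G →* (E ≃ₗᵢ[ℝ] E)) (V : Submodule ℝ E)
    (_hV : ∀ g, ∀ w ∈ V, ρ g w ∈ V), Module.finrank ℝ V = n → (fixSub ρ V).index ≤ C := by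
  have hc : TotallyBounded (Metric.closedBall (0 : Fin n → EuclideanSpace ℝ (Fin n)) 1) :=
    (isCompact_closedBall _ _).totallyBounded
  have hδ : (0:ℝ) < 1 / (8 * (n + 1)) := by positivity
  obtain ⟨t, ht, hcov⟩ := Metric.totallyBounded_iff.1 hc _ hδ
  refine ⟨t.ncard, ?_⟩
  intro G _ _ hG E _ _ _ ρ V hV hn
  let b : OrthonormalBasis (Fin n) ℝ V := (stdOrthonormalBasis ℝ V).reindex (finCongr hn)
  let F : G → (Fin n → EuclideanSpace ℝ (Fin n)) := fun g j => b.repr ⟨ρ g (b j), hV g _ (b j).2⟩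
  have hF : ∀ g, F g ∈ Metric.closedBall (0 : Fin n → EuclideanSpace ℝ (Fin n)) 1 := by
    intro g
    rw [mem_closedBall_zero_iff, pi_norm_le_iff_of_nonneg zero_le_one]
    intro j
    simp only [F, LinearIsometryEquiv.norm_map]
    rw [Submodule.coe_norm]
    simp only [LinearIsometryEquiv.norm_map]
    rw [← Submodule.coe_norm, b.norm_eq_one]
  have hx : ∀ g, ∃ y : t, dist (F g) y < 1 / (8 * (n + 1)) := by
    intro g
    have := hcov (hF g)
    simp only [Set.mem_iUnion, Metric.mem_ball] at this
    obtain ⟨y, hy, h⟩ := this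
    exact ⟨⟨y, hy⟩, h⟩
  choose f hf using hx
  have hclose : ∀ g g', f g = f g' → g'⁻¹ * g ∈ fixSub ρ V := by
    intro g g' hgg
    apply near_fix hG ρ V hV
    intro w hw
    have hd : dist (F g) (F g') ≤ 1 / (4 * (n+1)) := by
      have h1 := hf g
      have h2 := hf g'
      rw [← hgg] at h2
      have := dist_triangle_right (F g) (F g') (f g)
      have e : (1:ℝ) / (4 * (n+1)) = 1 / (8 * (n + 1)) + 1 / (8 * (n + 1)) := by field_simp; norm_num
      linarith
    have hj : ∀ j, ‖ρ g (b j) - ρ g' (b j)‖ ≤ 1 / (4 * (n+1)) := by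
      intro j
      have := (dist_le_pi_dist (F g) (F g') j).trans hd
      simp only [F, LinearIsometryEquiv.dist_map] at this
      rwa [Subtype.dist_eq, dist_eq_norm] at this
    have e1 : ρ (g'⁻¹ * g) w - w = ρ g'⁻¹ (ρ g w - ρ g' w) := by
      rw [map_sub, ← rho_mul, ← rho_mul]; simp
    rw [e1, LinearIsometryEquiv.norm_map]
    have e2 : w = ∑ j, (b.repr ⟨w, hw⟩ j) • (b j : E) := by
      have := congrArg (Subtype.val) (b.sum_repr ⟨w, hw⟩)
      simpa using this.symm
    have e3 : ρ g w - ρ g' w = ∑ j, (b.repr ⟨w, hw⟩ j) • (ρ g (b j) - ρ g' (b j)) := by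
      conv_lhs => rw [e2]
      simp [smul_sub, Finset.sum_sub_distrib]
    rw [e3]
    calc _ ≤ ∑ j : Fin n, ‖(b.repr ⟨w, hw⟩ j) • (ρ g (b j) - ρ g' (b j))‖ := norm_sum_le _ _
      _ ≤ ∑ j : Fin n, ‖w‖ * (1 / (4 * (n+1))) := by
        apply Finset.sum_le_sum
        intro j _
        rw [norm_smul]
        apply mul_le_mul _ (hj j) (norm_nonneg _) (norm_nonneg _)
        have := PiLp.norm_apply_le (b.repr ⟨w, hw⟩) j
        rw [LinearIsometryEquiv.norm_map] at this
        exact this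
      _ ≤ 1/4 * ‖w‖ := by
        simp only [Finset.sum_const, Finset.card_univ, Fintype.card_fin, nsmul_eq_mul]
        have : (n:ℝ) * (1 / (4 * (n+1))) ≤ 1/4 := by
          rw [mul_one_div, div_le_iff₀ (by positivity)]; linarith
        nlinarith [norm_nonneg w]
  have : Finite t := ht
  rw [Subgroup.index, ← Nat.card_coe_set_eq t]
  apply Nat.card_le_card_of_injective (fun q : G ⧸ fixSub ρ V => f q.out)
  intro q q' h
  have := hclose _ _ h
  rw [← QuotientGroup.out_eq' q, ← QuotientGroup.out_eq' q', eq_comm]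
  exact QuotientGroup.eq.2 this
end

section
variable {G : Type} [Group G] {E : Type} [NormedAddCommGroup E] [InnerProductSpace ℝ E]
  [FiniteDimensional ℝ E]

def coordSub {ι : Type} [Fintype ι] (b : OrthonormalBasis ι ℝ E) (I : Set ι) : Submodule ℝ E where
  carrier := {w | ∀ j, j ∉ I → inner ℝ (b j) w = 0}
  zero_mem' := by intro j _; simp
  add_mem' := by intro x y hx hy j hj; rw [inner_add_right, hx j hj, hy j hj, add_zero]
  smul_mem' := by intro c x hx j hj; rw [inner_smul_right, hx j hj, mul_zero]

lemma coordSub_finrank {ι : Type} [Fintype ι] (b : OrthonormalBasis ι ℝ E) (I : Set ι) :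
    Module.finrank ℝ (coordSub b I) ≤ I.ncard := by
  classical
  have h : coordSub b I ≤ Submodule.span ℝ (b '' I) := by
    intro w hw
    rw [← b.sum_repr' w]
    apply Submodule.sum_mem
    intro i _
    by_cases hi : i ∈ I
    · exact Submodule.smul_mem _ _ (Submodule.subset_span ⟨i, hi, rfl⟩)
    · rw [hw i hi]; simp
  refine (Submodule.finrank_mono h).trans ?_
  have hfin : (b '' I).Finite := Set.toFinite _
  have := hfin.fintype
  refine (finrank_span_le_card (R := ℝ) (b '' I)).trans ?_
  rw [← Set.ncard_eq_toFinset_card']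
  exact Set.ncard_image_le (Set.toFinite _)

lemma coordSub_inv {ι : Type} [Fintype ι] (b : OrthonormalBasis ι ℝ E) (I : Set ι)
    (M : E →ₗ[ℝ] E) (hM : M.IsSymmetric) (l : ι → ℝ) (hb : ∀ i, M (b i) = l i • b i)
    (hI : ∀ i j, l i = l j → i ∈ I → j ∈ I)
    (ρ : G →* (E ≃ₗᵢ[ℝ] E)) (hρ : ∀ g w, M (ρ g w) = ρ g (M w)) (g : G) (w : E)
    (hw : w ∈ coordSub b I) : ρ g w ∈ coordSub b I := by
  intro j hj
  have e : inner ℝ (b j) (ρ g w) = inner ℝ (ρ g⁻¹ (b j)) w := by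
    rw [← LinearIsometryEquiv.inner_map_map (ρ g⁻¹) (b j), ← rho_mul]; simp
  rw [e, ← b.sum_inner_mul_inner]
  apply Finset.sum_eq_zero
  intro i _
  by_cases hi : i ∈ I
  · have hne : l i ≠ l j := fun h => hj (hI i j h hi)
    have h1 := hM (ρ g⁻¹ (b j)) (b i)
    rw [hρ, hb, hb, map_smul, real_inner_smul_left, real_inner_smul_right] at h1
    have : (l i - l j) * inner ℝ (ρ g⁻¹ (b j)) (b i) = 0 := by linarith
    rcases mul_eq_zero.1 this with h | h
    · exact absurd (sub_eq_zero.1 h) hne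
    · rw [h, zero_mul]
  · rw [hw i hi, mul_zero]

lemma spectral (T : E →ₗ[ℝ] E) (ρ : G →* (E ≃ₗᵢ[ℝ] E)) (hρ : ∀ g w, T (ρ g w) = ρ g (T w))
    (ε τ : ℝ) (hε : 0 < ε)
    (hτ : ∀ (n : ℕ) (b : OrthonormalBasis (Fin n) ℝ E), ∑ i, ‖T (b i)‖ ^ 2 ≤ τ) :
    ∃ V : Submodule ℝ E, (∀ g, ∀ w ∈ V, ρ g w ∈ V) ∧ Module.finrank ℝ V * ε ≤ τ ∧
      ∀ g ∈ fixSub ρ V, ∀ v, ‖T v‖ ^ 2 - 2 * ε * ‖v‖ ^ 2 ≤ inner ℝ (T v) (T (ρ g v)) := by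
  classical
  set M : E →ₗ[ℝ] E := T.adjoint ∘ₗ T with hMdef
  have hin : ∀ u w, inner ℝ (M u) w = inner ℝ (T u) (T w) := by
    intro u w; simp [hMdef, LinearMap.adjoint_inner_left]
  have hM : M.IsSymmetric := by
    intro u w
    rw [hin, real_inner_comm, ← hin, real_inner_comm]
  have hMρ : ∀ g w, M (ρ g w) = ρ g (M w) := by
    intro g w
    apply ext_inner_right ℝ
    intro z
    have e : ∀ a c, inner ℝ (ρ g a) c = inner ℝ a (ρ g⁻¹ c) := by
      intro a c
      rw [← LinearIsometryEquiv.inner_map_map (ρ g⁻¹) (ρ g a), ← rho_mul]; simp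
    rw [hin, e, hin, hρ, hρ, e]
  set b := hM.eigenvectorBasis rfl with hbdef
  set l := hM.eigenvalues rfl with hl
  have hb : ∀ i, M (b i) = l i • b i := fun i => hM.apply_eigenvectorBasis rfl i
  have hTb : ∀ i, ‖T (b i)‖ ^ 2 = l i := by
    intro i
    rw [← real_inner_self_eq_norm_sq, ← hin, hb, real_inner_smul_left,
      real_inner_self_eq_norm_sq, b.norm_eq_one]; simp
  set I : Set (Fin (Module.finrank ℝ E)) := {i | ε ≤ l i} with hI
  have hform : ∀ u w, inner ℝ (T u) (T w) = ∑ i, l i * (inner ℝ (b i) u * inner ℝ (b i) w) := by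
    intro u w
    rw [← hin, ← b.sum_inner_mul_inner]
    apply Finset.sum_congr rfl
    intro i _
    rw [hM u (b i), hb, real_inner_smul_right, real_inner_comm]; ring
  have hVinv := coordSub_inv b I M hM l hb
    (by intro i j h hi; simpa [hI, ← h] using hi) ρ hMρ
  have hWinv := coordSub_inv b Iᶜ M hM l hb
    (by intro i j h hi; simpa [hI, ← h] using hi) ρ hMρ
  refine ⟨coordSub b I, hVinv, ?_, ?_⟩
  · have h1 : (I.ncard : ℝ) * ε ≤ ∑ i, ‖T (b i)‖ ^ 2 := by
      simp_rw [hTb]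
      rw [Set.ncard_eq_toFinset_card', ← nsmul_eq_mul, ← Finset.sum_const]
      refine (Finset.sum_le_sum (g := l) ?_).trans
        (Finset.sum_le_sum_of_subset_of_nonneg (Finset.subset_univ _) ?_)
      · intro i hi; simpa [hI] using hi
      · intro i _ _; rw [← hTb]; positivity
    have h2 : (Module.finrank ℝ (coordSub b I) : ℝ) ≤ I.ncard := by
      exact_mod_cast coordSub_finrank b I
    have := hτ _ b
    nlinarith
  · intro g hg v
    set p : E := ∑ i ∈ I.toFinset, inner ℝ (b i) v • b i with hp
    have hbp : ∀ j, inner ℝ (b j) p = if j ∈ I then inner ℝ (b j) v else 0 := by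
      intro j
      simp [hp, inner_sum, real_inner_smul_right, b.inner_eq_ite]
    have hpV : p ∈ coordSub b I := by
      intro j hj
      rw [hbp, if_neg hj]
    set q := v - p with hq
    have hbq : ∀ j, inner ℝ (b j) q = if j ∈ I then 0 else inner ℝ (b j) v := by
      intro j
      rw [hq, inner_sub_right, hbp]; split_ifs <;> simp
    have hqW : q ∈ coordSub b Iᶜ := by
      intro j hj
      rw [hbq, if_pos (by simpa using hj)]
    have orth : ∀ x ∈ coordSub b I, ∀ y ∈ coordSub b Iᶜ, inner ℝ (T x) (T y) = 0 := by
      intro x hx y hy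
      rw [hform]
      apply Finset.sum_eq_zero
      intro i _
      by_cases hi : i ∈ I
      · rw [hy i (by simpa using hi)]; simp
      · rw [hx i hi]; simp
    have hv : v = p + q := by rw [hq]; abel
    have hgv : ρ g v = p + ρ g q := by
      conv_lhs => rw [hv]
      rw [map_add, hg p hpV]
    have e1 : inner ℝ (T v) (T (ρ g v)) = ‖T p‖ ^ 2 + inner ℝ (T q) (T (ρ g q)) := by
      rw [hgv]
      conv_lhs => rw [hv]
      rw [map_add, map_add, inner_add_left, inner_add_right, inner_add_right,
        orth p hpV _ (hWinv g q hqW), real_inner_comm (T p) (T q), orth p hpV q hqW,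
        real_inner_self_eq_norm_sq]
      ring
    have e2 : ‖T v‖ ^ 2 = ‖T p‖ ^ 2 + ‖T q‖ ^ 2 := by
      conv_lhs => rw [hv]
      rw [map_add, norm_add_sq_real, orth p hpV q hqW]; ring
    have e3 : -‖T q‖ ^ 2 ≤ inner ℝ (T q) (T (ρ g q)) := by
      have := abs_real_inner_le_norm (T q) (T (ρ g q))
      rw [hρ, LinearIsometryEquiv.norm_map] at this
      rw [hρ]
      nlinarith [neg_abs_le (inner ℝ (T q) (ρ g (T q)))]
    have e4 : ‖T q‖ ^ 2 ≤ ε * ‖v‖ ^ 2 := by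
      rw [← real_inner_self_eq_norm_sq, hform, ← b.sum_sq_norm_inner_right v, Finset.mul_sum]
      apply Finset.sum_le_sum
      intro i _
      rw [hbq]
      split_ifs with hi
      · simp; positivity
      · have : l i < ε := by simpa [hI] using hi
        rw [Real.norm_eq_abs, sq_abs]
        nlinarith [sq_nonneg (inner ℝ (b i) v)]
    rw [e1]; linarith
end

section
variable {G : Type} [Group G] [Fintype G]

noncomputable def leftTr : G →* (EuclideanSpace ℝ G ≃ₗᵢ[ℝ] EuclideanSpace ℝ G) where
  toFun g := LinearIsometryEquiv.piLpCongrLeft 2 ℝ ℝ (Equiv.mulLeft g)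
  map_one' := by
    ext f x
    change f (1⁻¹ * x) = f x
    simp
  map_mul' a b := by
    ext f x
    change f ((a * b)⁻¹ * x) = f (b⁻¹ * (a⁻¹ * x))
    simp [mul_assoc]

lemma leftTr_apply (g : G) (f : EuclideanSpace ℝ G) (x : G) : leftTr g f x = f (g⁻¹ * x) := by
  simp [leftTr, LinearIsometryEquiv.piLpCongrLeft_apply, Equiv.piCongrLeft'_apply]

noncomputable def convR (Y : Finset G) : EuclideanSpace ℝ G →ₗ[ℝ] EuclideanSpace ℝ G where
  toFun f := WithLp.toLp 2 fun y => ∑ b ∈ Y, f (y * b⁻¹)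
  map_add' f g := by ext x; simp [Finset.sum_add_distrib]
  map_smul' c f := by ext x; simp [Finset.mul_sum]

lemma convR_apply (Y : Finset G) (f : EuclideanSpace ℝ G) (y : G) :
    convR Y f y = ∑ b ∈ Y, f (y * b⁻¹) := rfl

noncomputable def indic [DecidableEq G] (X : Finset G) : EuclideanSpace ℝ G := WithLp.toLp 2 fun y => if y ∈ X then 1 else 0

lemma indic_apply [DecidableEq G] (X : Finset G) (y : G) : indic X y = if y ∈ X then 1 else 0 := rfl

lemma indic_norm [DecidableEq G] (X : Finset G) : ‖indic X‖ ^ 2 = X.card := by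
  rw [EuclideanSpace.norm_sq_eq]
  simp [indic_apply]

lemma convR_hs [DecidableEq G] (Y : Finset G) (n : ℕ)
    (b : OrthonormalBasis (Fin n) ℝ (EuclideanSpace ℝ G)) :
    ∑ i, ‖convR Y (b i)‖ ^ 2 ≤ (Fintype.card G : ℝ) * Y.card := by
  have h : ∀ f y, convR Y f y = inner ℝ (indic (Y.image fun b => y * b⁻¹)) f := by
    intro f y
    rw [convR_apply, PiLp.inner_apply]
    simp only [indic_apply]
    rw [← Finset.sum_image (s := Y) (f := fun z => f z) (g := fun b => y * b⁻¹)
      (by intro a _ c _ h; simpa using h)]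
    rw [← Finset.sum_subset (Finset.subset_univ (Y.image fun b => y * b⁻¹))
      (by intro z _ hz; rw [if_neg hz]; simp)]
    apply Finset.sum_congr rfl
    intro z hz
    rw [if_pos hz]; simp
  simp_rw [EuclideanSpace.norm_sq_eq]
  rw [Finset.sum_comm]
  simp_rw [h]
  simp_rw [b.sum_sq_norm_inner_left, indic_norm]
  rw [← nsmul_eq_mul, ← Finset.card_univ, ← Finset.sum_const]
  apply Finset.sum_le_sum
  intro y _
  exact_mod_cast Finset.card_image_le

lemma main_aux (α : ℝ) (hα : 0 < α) :
    ∃ C : ℕ, ∀ (G : Type) [Group G] [Fintype G] [DecidableEq G],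
      (∀ H : Subgroup G, H.Normal → ⁅H, H⁆ = H) →
      ∀ Y : Finset G, α * (Fintype.card G : ℝ) ≤ (Y.card : ℝ) →
      ∃ H : Subgroup G, H.Normal ∧ H.index ≤ C ∧
        ∀ X : Finset G, α * (Fintype.card G : ℝ) ≤ (X.card : ℝ) → ∀ x ∈ H,
          ∃ a ∈ X, ∃ b ∈ Y, ∃ b' ∈ Y, ∃ a' ∈ X, x = a * b * b'⁻¹ * a'⁻¹ := by
  choose Cn hCn using jordan
  refine ⟨∑ n ∈ Finset.range (⌊4 / α ^ 3⌋₊ + 1), Cn n, ?_⟩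
  intro G _ _ _ hG Y hY
  have hN : (0:ℝ) < Fintype.card G := by exact_mod_cast Fintype.card_pos
  set N : ℝ := (Fintype.card G : ℝ) with hNdef
  have hcomm : ∀ (g : G) w, convR Y (leftTr g w) = leftTr g (convR Y w) := by
    intro g w
    ext y
    rw [leftTr_apply, convR_apply, convR_apply]
    simp_rw [leftTr_apply, mul_assoc]
  have hε : 0 < α ^ 3 * N ^ 2 / 4 := by positivity
  obtain ⟨V, hV, hdim, hfix⟩ := spectral (convR Y) leftTr hcomm _ _ hε (fun n b => convR_hs Y n b)
  refine ⟨fixSub leftTr V, fixSub_normal _ _ hV, ?_, ?_⟩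
  · refine (hCn _ G hG _ leftTr V hV rfl).trans ?_
    apply Finset.single_le_sum (f := Cn) (fun _ _ => Nat.zero_le _)
    rw [Finset.mem_range, Nat.lt_succ_iff]
    apply Nat.le_floor
    rw [le_div_iff₀ (by positivity)]
    have hYN : (Y.card : ℝ) ≤ N := by rw [hNdef]; exact_mod_cast Finset.card_le_univ Y
    have : (Module.finrank ℝ V * α ^ 3) * N ^ 2 ≤ 4 * N ^ 2 := by nlinarith
    exact le_of_mul_le_mul_right this (by positivity)
  · intro X hX x hx
    have h1 := hfix x hx (indic X)
    rw [indic_norm, hcomm] at h1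
    have hXpos : (0:ℝ) < X.card := lt_of_lt_of_le (by positivity) hX
    have hsum : ∑ y, convR Y (indic X) y = X.card * Y.card := by
      simp_rw [convR_apply]
      rw [Finset.sum_comm]
      have : ∀ b : G, ∑ y, indic X (y * b⁻¹) = X.card := by
        intro b
        refine (Equiv.sum_comp (Equiv.mulRight b⁻¹) (fun y => indic X y)).trans ?_
        simp [indic_apply]
      simp_rw [this]
      simp [mul_comm]
    have hcs : (X.card * Y.card : ℝ) ^ 2 ≤ N * ‖convR Y (indic X)‖ ^ 2 := by
      rw [← hsum, EuclideanSpace.norm_sq_eq]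
      have := sq_sum_le_card_mul_sum_sq (s := Finset.univ) (f := fun y => convR Y (indic X) y)
      simpa [hNdef] using this
    have hbig : α ^ 3 * N ^ 2 * X.card ≤ ‖convR Y (indic X)‖ ^ 2 := by
      have h2 : N * (α ^ 3 * N ^ 2 * X.card) ≤ (X.card * Y.card : ℝ) ^ 2 := by
        calc N * (α ^ 3 * N ^ 2 * X.card) = X.card * (α * N) * ((α * N) * (α * N)) := by ring
          _ ≤ X.card * X.card * (Y.card * Y.card) := by gcongr
          _ = _ := by ring
      exact le_of_mul_le_mul_left (h2.trans hcs) hN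
    have hpos : 0 < inner ℝ (convR Y (indic X)) (leftTr x (convR Y (indic X))) := by
      have : 0 < α ^ 3 * N ^ 2 * X.card := by positivity
      linarith
    have hne : ∃ y, inner ℝ (convR Y (indic X) y) (leftTr x (convR Y (indic X)) y) ≠ 0 := by
      by_contra! hc
      rw [PiLp.inner_apply, Finset.sum_eq_zero (fun y _ => hc y)] at hpos
      exact lt_irrefl _ hpos
    obtain ⟨y, hy⟩ := hne
    rw [leftTr_apply] at hy
    have hsupp : ∀ z, convR Y (indic X) z ≠ 0 → ∃ a ∈ X, ∃ b ∈ Y, z = a * b := by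
      intro z hz
      rw [convR_apply] at hz
      obtain ⟨b, hb, hb'⟩ := Finset.exists_ne_zero_of_sum_ne_zero hz
      rw [indic_apply] at hb'
      refine ⟨z * b⁻¹, by_contra fun h => hb' (if_neg h), b, hb, by simp⟩
    obtain ⟨a, ha, b, hb, hab⟩ := hsupp y (by intro h; apply hy; rw [h]; simp)
    obtain ⟨a', ha', b', hb', hab'⟩ := hsupp (x⁻¹ * y) (by intro h; apply hy; rw [h]; simp)
    refine ⟨a, ha, b, hb, b', hb', a', ha', ?_⟩
    have : x = y * (x⁻¹ * y)⁻¹ := by group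
    rw [this, hab', hab]; group
end

/-- **Bogolyubov for purely nonabelian finite groups.** For every real `α > 0` there is `C`
such that: if `G` is a purely nonabelian finite group and `A ⊆ G` with `|A| ≥ α|G|`, then
there is a normal subgroup `H ≤ G` of index at most `C` with
`H ⊆ (AA⁻¹)² ∩ A²A⁻² ∩ (A⁻¹A)² ∩ A⁻²A²`. -/
theorem bogolyubov_purely_nonabelian (α : ℝ) (hα : 0 < α) :
    ∃ C : ℕ, ∀ (G : Type) [Group G] [Fintype G] [DecidableEq G],
      PurelyNonabelian G →
      ∀ A : Finset G, α * (Fintype.card G : ℝ) ≤ (A.card : ℝ) →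
      ∃ H : Subgroup G, H.Normal ∧ H.index ≤ C ∧
        (H : Set G) ⊆
          ↑(((A * A⁻¹) ^ 2 ∩ (A ^ 2 * A⁻¹ ^ 2) ∩ (A⁻¹ * A) ^ 2 ∩ (A⁻¹ ^ 2 * A ^ 2) :
            Finset G)) := by
  obtain ⟨C, hC⟩ := main_aux α hα
  refine ⟨C * C, ?_⟩
  intro G _ _ _ hG A hA
  have hA' : α * (Fintype.card G : ℝ) ≤ ((A⁻¹ : Finset G).card : ℝ) := by
    rwa [Finset.card_inv]
  obtain ⟨H, hHn, hHi, hH⟩ := hC G hG.2 A hA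
  obtain ⟨K, hKn, hKi, hK⟩ := hC G hG.2 A⁻¹ hA'
  refine ⟨H ⊓ K, inferInstance, ?_, ?_⟩
  · exact (Subgroup.index_inf_le).trans (Nat.mul_le_mul hHi hKi)
  · intro x hx
    obtain ⟨hxH, hxK⟩ := hx
    have gen : ∀ X Y : Finset G, (∃ a ∈ X, ∃ b ∈ Y, ∃ b' ∈ Y, ∃ a' ∈ X,
        x = a * b * b'⁻¹ * a'⁻¹) → x ∈ X * Y * Y⁻¹ * X⁻¹ := by
      rintro X Y ⟨a, ha, b, hb, b', hb', a', ha', rfl⟩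
      exact Finset.mul_mem_mul (Finset.mul_mem_mul (Finset.mul_mem_mul ha hb)
        (Finset.inv_mem_inv hb')) (Finset.inv_mem_inv ha')
    have h1 := gen _ _ (hH A hA x hxH)
    have h2 := gen _ _ (hH A⁻¹ hA' x hxH)
    have h3 := gen _ _ (hK A hA x hxK)
    have h4 := gen _ _ (hK A⁻¹ hA' x hxK)
    rw [inv_inv] at h2 h3 h4
    try rw [inv_inv] at h4
    simp only [Finset.coe_inter, Set.mem_inter_iff, Finset.mem_coe, pow_two]
    simp only [mul_assoc] at h1 h2 h3 h4 ⊢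
    exact ⟨⟨⟨h3, h1⟩, h2⟩, h4⟩
end

section
/- For all positive integers k and r there is a constant C = C(k, r) such that the following holds. If G is a group of exponent r and A ⊆ G is a nonempty finite symmetric set with |A³| ≤ k|A|, then there is a subgroup H of G such that A is covered by at most C left translates of H (i.e., there is a finite set F ⊆ G with |F| ≤ C and A ⊆ FH) and H ⊆ A⁴. -/
open Pointwise

set_option linter.unusedSectionVars false


namespace STB

abbrev E (G : Type) := MonoidAlgebra ℝ G

noncomputable section

variable {G : Type}

def ip (f g : E G) : ℝ := f.coeff.sum fun x a => a * g.coeff x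

lemma ip_eq_sum [DecidableEq G] (f g : E G) (s : Finset G) (hs : f.coeff.support ⊆ s) :
    ip f g = ∑ x ∈ s, f.coeff x * g.coeff x := by
  unfold ip
  rw [Finsupp.sum_of_support_subset _ hs]
  simp

@[reducible] def core : InnerProductSpace.Core ℝ (E G) where
  inner := ip
  conj_inner_symm f g := by
    classical
    rw [ip_eq_sum f g (f.coeff.support ∪ g.coeff.support) Finset.subset_union_left,
      ip_eq_sum g f (f.coeff.support ∪ g.coeff.support) Finset.subset_union_right]
    simp [mul_comm]
  re_inner_nonneg f := by
    classical
    rw [ip_eq_sum f f _ subset_rfl]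
    exact Finset.sum_nonneg fun i _ => mul_self_nonneg _
  add_left f g h := by
    unfold ip
    rw [MonoidAlgebra.coeff_add, Finsupp.sum_add_index']
    · simp
    · intros; ring
  smul_left f g r := by
    unfold ip
    rw [MonoidAlgebra.coeff_smul, Finsupp.sum_smul_index']
    · simp [Finsupp.sum, Finset.mul_sum, mul_assoc]
    · simp
  definite f h := by
    classical
    rw [ip_eq_sum f f _ subset_rfl, Finset.sum_eq_zero_iff_of_nonneg (fun i _ => mul_self_nonneg _)] at h
    ext x
    by_cases hx : x ∈ f.coeff.support
    · simpa using h x hx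
    · simpa using hx

instance instN : NormedAddCommGroup (E G) := core.toNormedAddCommGroup
instance instI : InnerProductSpace ℝ (E G) := InnerProductSpace.ofCore core.toCore

lemma inner_eq_ip (f g : E G) : inner ℝ f g = ip f g := rfl

lemma inner_single (f : E G) (x : G) (c : ℝ) :
    inner ℝ (MonoidAlgebra.single x c) f = c * f.coeff x := by
  rw [inner_eq_ip]; unfold ip; simp

lemma inner_single_right (f : E G) (x : G) (c : ℝ) :
    inner ℝ f (MonoidAlgebra.single x c) = c * f.coeff x := by
  rw [real_inner_comm, inner_single]

def s (x : G) : E G := MonoidAlgebra.single x 1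

lemma s_mul [Group G] (x y : G) : s x * s y = s (x * y) := by simp [s]
lemma s_one [Group G] : s (1 : G) = 1 := rfl
lemma s_pow [Group G] (x : G) (n : ℕ) : s x ^ n = s (x ^ n) := by
  simp [s, MonoidAlgebra.single_pow]

lemma inner_s (f : E G) (x : G) : inner ℝ (s x) f = f.coeff x := by simp [s, inner_single]
lemma inner_s_right (f : E G) (x : G) : inner ℝ f (s x) = f.coeff x := by
  simp [s, inner_single_right]

lemma norm_s (x : G) : ‖s x‖ = 1 := by
  have : ‖s x‖ ^ 2 = 1 := by
    rw [← real_inner_self_eq_norm_sq, inner_s]; simp [s]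
  nlinarith [norm_nonneg (s x)]

lemma single_eq_smul (x : G) (c : ℝ) : (MonoidAlgebra.single x c : E G) = c • s x := by
  simp [s]

lemma ind {P : E G → Prop} (f : E G) (h0 : P 0) (ha : ∀ f g, P f → P g → P (f + g))
    (hs : ∀ x (c : ℝ), P (c • s x)) : P f :=
  MonoidAlgebra.induction_linear f h0 ha (fun x c => by rw [single_eq_smul]; exact hs x c)

/-- supported submodule -/
def Sp (X : Set G) : Submodule ℝ (E G) where
  carrier := {f | ∀ g, g ∉ X → f.coeff g = 0}
  add_mem' := by intro a b ha hb g hg; simp [ha g hg, hb g hg]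
  zero_mem' := by intro g _; simp
  smul_mem' := by intro c f hf g hg; simp [hf g hg]

lemma mem_Sp {X : Set G} {f : E G} : f ∈ Sp X ↔ ∀ g, g ∉ X → f.coeff g = 0 := Iff.rfl

variable [Group G]

lemma inner_mul_s (f g : E G) (y : G) : inner ℝ (f * s y) g = inner ℝ f (g * s y⁻¹) := by
  classical
  induction f using ind with
  | h0 => simp
  | ha f g hf hg => simp [add_mul, inner_add_left, hf, hg]
  | hs x c =>
    rw [smul_mul_assoc, inner_smul_left, inner_smul_left, s_mul, inner_s, inner_s]
    congr 1
    simp [s, MonoidAlgebra.coeff_mul_single_apply]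

lemma inner_s_mul (f g : E G) (y : G) : inner ℝ (s y * f) g = inner ℝ f (s y⁻¹ * g) := by
  classical
  induction f using ind with
  | h0 => simp
  | ha f g hf hg => simp [mul_add, inner_add_left, hf, hg]
  | hs x c =>
    rw [mul_smul_comm, inner_smul_left, inner_smul_left, s_mul, inner_s, inner_s]
    congr 1
    simp [s, MonoidAlgebra.coeff_single_mul_apply]

lemma norm_s_mul (y : G) (f : E G) : ‖s y * f‖ = ‖f‖ := by
  have : ‖s y * f‖ ^ 2 = ‖f‖ ^ 2 := by
    rw [← real_inner_self_eq_norm_sq, inner_s_mul, ← mul_assoc, s_mul]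
    simp [s_one]
  exact (sq_eq_sq₀ (norm_nonneg _) (norm_nonneg _)).1 this

lemma norm_mul_s (y : G) (f : E G) : ‖f * s y‖ = ‖f‖ := by
  have : ‖f * s y‖ ^ 2 = ‖f‖ ^ 2 := by
    rw [← real_inner_self_eq_norm_sq, inner_mul_s, mul_assoc, s_mul]
    simp [s_one]
  exact (sq_eq_sq₀ (norm_nonneg _) (norm_nonneg _)).1 this

lemma inner_one (f : E G) : inner ℝ f 1 = f.coeff 1 := by
  rw [← s_one, inner_s_right]

lemma trace_comm (f g : E G) : inner ℝ (f * g) 1 = inner ℝ (g * f) 1 := by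
  classical
  induction f using ind with
  | h0 => simp
  | ha f f' hf hf' => simp [add_mul, mul_add, inner_add_left, hf, hf']
  | hs x c =>
    rw [smul_mul_assoc, mul_smul_comm, inner_smul_left, inner_smul_left, inner_s_mul, inner_mul_s]
    simp

end

end STB

namespace STB
noncomputable section
variable {G : Type}

def mu (A : Finset G) : E G := (A.card : ℝ)⁻¹ • ∑ a ∈ A, s a

lemma Sp_mono {X Y : Set G} (h : X ⊆ Y) : Sp X ≤ Sp Y :=
  fun _ hf g hg => hf g (fun hx => hg (h hx))

lemma s_mem {X : Set G} {x : G} (hx : x ∈ X) : s x ∈ Sp X := by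
  classical
  intro g hg
  have : x ≠ g := by rintro rfl; exact hg hx
  simp [s, Finsupp.single_apply, this]

lemma mu_mem (A : Finset G) : mu A ∈ Sp (A : Set G) :=
  Submodule.smul_mem _ _ (Submodule.sum_mem _ fun a ha => s_mem ha)

lemma coeff_mu [DecidableEq G] (A : Finset G) (x : G) :
    (mu A).coeff x = if x ∈ A then (A.card : ℝ)⁻¹ else 0 := by
  simp [mu, s, Finsupp.single_apply]

lemma eq_sum (f : E G) : f = ∑ z ∈ f.coeff.support, f.coeff z • s z := by
  conv_lhs => rw [← MonoidAlgebra.sum_coeff_single f]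
  rw [Finsupp.sum]
  exact Finset.sum_congr rfl fun z _ => single_eq_smul _ _

lemma norm_mu_sq (A : Finset G) (hA : A.Nonempty) : ‖mu A‖ ^ 2 = (A.card : ℝ)⁻¹ := by
  classical
  have h : (A.card : ℝ) ≠ 0 := by simpa using hA.ne_empty
  rw [← real_inner_self_eq_norm_sq]
  nth_rw 1 [mu]
  rw [inner_smul_left, sum_inner]
  rw [Finset.sum_congr rfl (g := fun _ => (A.card : ℝ)⁻¹)]
  · simp [h]
  · intro x hx
    rw [inner_s, coeff_mu, if_pos hx]

/-- ℓ¹ seminorm -/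
def n1 (f : E G) : ℝ := f.coeff.sum fun _ a => |a|

lemma n1_eq_sum (f : E G) (t : Finset G) (ht : f.coeff.support ⊆ t) :
    n1 f = ∑ x ∈ t, |f.coeff x| := by
  unfold n1
  rw [Finsupp.sum_of_support_subset _ ht]
  simp

lemma n1_nonneg (f : E G) : 0 ≤ n1 f := Finset.sum_nonneg fun _ _ => abs_nonneg _

lemma n1_zero : n1 (0 : E G) = 0 := by simp [n1]

lemma n1_smul (c : ℝ) (f : E G) : n1 (c • f) = |c| * n1 f := by
  classical
  rw [n1_eq_sum (c • f) f.coeff.support, n1_eq_sum f _ subset_rfl, Finset.mul_sum]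
  · simp [abs_mul]
  · rw [MonoidAlgebra.coeff_smul]; exact Finsupp.support_smul

lemma n1_add_le (f g : E G) : n1 (f + g) ≤ n1 f + n1 g := by
  classical
  rw [n1_eq_sum (f + g) (f.coeff.support ∪ g.coeff.support),
    n1_eq_sum f (f.coeff.support ∪ g.coeff.support) Finset.subset_union_left,
    n1_eq_sum g (f.coeff.support ∪ g.coeff.support) Finset.subset_union_right,
    ← Finset.sum_add_distrib]
  · exact Finset.sum_le_sum fun x _ => by simpa using abs_add_le _ _
  · rw [MonoidAlgebra.coeff_add]; exact Finsupp.support_add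

lemma n1_neg (f : E G) : n1 (-f) = n1 f := by
  have := n1_smul (-1) f
  simpa using this

lemma n1_sub_le (f g : E G) : n1 (f - g) ≤ n1 f + n1 g := by
  rw [sub_eq_add_neg, ← n1_neg g]; exact n1_add_le _ _

lemma n1_sum_le {ι : Type*} (t : Finset ι) (F : ι → E G) : n1 (∑ i ∈ t, F i) ≤ ∑ i ∈ t, n1 (F i) := by
  classical
  induction t using Finset.induction_on with
  | empty => simp [n1_zero]
  | insert a t ha ih =>
    rw [Finset.sum_insert ha, Finset.sum_insert ha]
    exact (n1_add_le _ _).trans (by linarith)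

lemma n1_s (x : G) : n1 (s x) = 1 := by simp [n1, s]

lemma n1_lin (L : E G →ₗ[ℝ] E G) (c : ℝ) {X : Set G} {f : E G} (hf : f ∈ Sp X)
    (h : ∀ z ∈ X, n1 (L (s z)) ≤ c) : n1 (L f) ≤ c * n1 f := by
  conv_lhs => rw [eq_sum f]
  rw [map_sum]
  refine (n1_sum_le _ _).trans ?_
  rw [n1_eq_sum f _ subset_rfl, Finset.mul_sum]
  refine Finset.sum_le_sum fun z hz => ?_
  have hzX : z ∈ X := by
    by_contra hzX
    exact (Finsupp.mem_support_iff.1 hz) (hf z hzX)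
  rw [map_smul, n1_smul, mul_comm]
  exact mul_le_mul_of_nonneg_right (h z hzX) (abs_nonneg _)

lemma norm_lin (L : E G →ₗ[ℝ] E G) (c : ℝ) (f : E G)
    (h : ∀ z, ‖L (s z)‖ ≤ c) : ‖L f‖ ≤ c * n1 f := by
  conv_lhs => rw [eq_sum f]
  rw [map_sum]
  refine (norm_sum_le _ _).trans ?_
  rw [n1_eq_sum f _ subset_rfl, Finset.mul_sum]
  refine Finset.sum_le_sum fun z hz => ?_
  rw [map_smul, norm_smul, mul_comm, Real.norm_eq_abs]
  exact mul_le_mul_of_nonneg_right (h z) (abs_nonneg _)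

lemma mem_univ_Sp (f : E G) : f ∈ Sp (Set.univ : Set G) := fun g hg => (hg trivial).elim

lemma n1_mu_le (A : Finset G) : n1 (mu A) ≤ 1 := by
  rw [mu, n1_smul, abs_of_nonneg (by positivity)]
  have : n1 (∑ a ∈ A, s a) ≤ A.card := (n1_sum_le _ _).trans (by simp [n1_s])
  calc _ ≤ (A.card : ℝ)⁻¹ * A.card := by gcongr
    _ ≤ 1 := inv_mul_le_one

variable [Group G]

lemma mul_mem_Sp {X Y : Set G} {f g : E G} (hf : f ∈ Sp X) (hg : g ∈ Sp Y) : f * g ∈ Sp (X * Y) := by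
  rw [eq_sum f, eq_sum g, Finset.sum_mul_sum]
  refine Submodule.sum_mem _ fun z hz => Submodule.sum_mem _ fun w hw => ?_
  rw [smul_mul_smul_comm, s_mul]
  refine Submodule.smul_mem _ _ (s_mem (Set.mul_mem_mul ?_ ?_))
  · by_contra h; exact (Finsupp.mem_support_iff.1 hz) (hf z h)
  · by_contra h; exact (Finsupp.mem_support_iff.1 hw) (hg w h)

lemma pow_mem_Sp {X : Set G} {f : E G} (hf : f ∈ Sp X) (n : ℕ) : f ^ n ∈ Sp (X ^ n) := by
  induction n with
  | zero => rw [pow_zero, pow_zero, ← s_one]; exact s_mem (by simp)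
  | succ n ih => rw [pow_succ, pow_succ]; exact mul_mem_Sp ih hf

lemma norm_mul_mu_le (f : E G) (A : Finset G) : ‖f * mu A‖ ≤ ‖f‖ := by
  rw [mu, mul_smul_comm, norm_smul, Finset.mul_sum, norm_inv, Real.norm_natCast]
  calc _ ≤ (A.card : ℝ)⁻¹ * (A.card * ‖f‖) := by
        gcongr
        refine (norm_sum_le _ _).trans ?_
        simp [norm_mul_s]
    _ = ((A.card : ℝ)⁻¹ * A.card) * ‖f‖ := by ring
    _ ≤ 1 * ‖f‖ := by gcongr; exact inv_mul_le_one
    _ = ‖f‖ := one_mul _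

lemma norm_mul_mu_pow_le (f : E G) (A : Finset G) (n : ℕ) : ‖f * mu A ^ n‖ ≤ ‖f‖ := by
  induction n with
  | zero => simp
  | succ n ih => rw [pow_succ, ← mul_assoc]; exact (norm_mul_mu_le _ _).trans ih

lemma inner_mul_mu [DecidableEq G] (A : Finset G) (hA : A⁻¹ = A) (f g : E G) :
    inner ℝ (f * mu A) g = inner ℝ f (g * mu A) := by
  simp only [mu, mul_smul_comm, inner_smul_left, inner_smul_right, Finset.mul_sum, sum_inner,
    inner_sum, inner_mul_s]
  simp only [conj_trivial]
  rw [← Finset.mul_sum, ← Finset.mul_sum]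
  congr 1
  conv_rhs => rw [← hA]
  rw [← Finset.image_inv_eq_inv, Finset.sum_image (by intro a _ b _ h; exact inv_injective h)]

lemma inner_mul_mu_pow [DecidableEq G] (A : Finset G) (hA : A⁻¹ = A) (n : ℕ) (f g : E G) :
    inner ℝ (f * mu A ^ n) g = inner ℝ f (g * mu A ^ n) := by
  induction n generalizing f g with
  | zero => simp
  | succ n ih =>
    nth_rw 1 [pow_succ]
    rw [pow_succ', ← mul_assoc, ← mul_assoc, inner_mul_mu A hA, ih]

lemma n1_s_mul (x : G) (f : E G) : n1 (s x * f) ≤ n1 f := by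
  have := n1_lin (LinearMap.mulLeft ℝ (s x)) 1 (mem_univ_Sp f) (by
    intro z _
    simp [s_mul, n1_s])
  simpa using this

lemma n1_mul_mu (A : Finset G) (f : E G) : n1 (f * mu A) ≤ n1 f := by
  have := n1_lin (LinearMap.mulRight ℝ (mu A)) 1 (mem_univ_Sp f) (by
    intro z _
    simpa using (n1_s_mul z _).trans (n1_mu_le A))
  simpa using this

lemma n1_mu_pow (A : Finset G) (n : ℕ) : n1 (mu A ^ n) ≤ 1 := by
  induction n with
  | zero => rw [pow_zero, ← s_one, n1_s]
  | succ n ih => rw [pow_succ]; exact (n1_mul_mu _ _).trans ih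

lemma norm_mul_le_n1 (f : E G) (g : E G) : ‖f * g‖ ≤ ‖g‖ * n1 f := by
  have := norm_lin (LinearMap.mulRight ℝ g) ‖g‖ f (by intro z; simp [norm_s_mul])
  simpa using this

/-- right translates of symmetric functions -/
lemma right_left [DecidableEq G] (A : Finset G) (hA : A⁻¹ = A) (n : ℕ) (b : G) :
    ‖mu A ^ n * s b - mu A ^ n‖ = ‖s b * mu A ^ n - mu A ^ n‖ := by
  have key : inner ℝ (mu A ^ n * s b) (mu A ^ n) = inner ℝ (s b * mu A ^ n) (mu A ^ n) := by
    have h1 := inner_mul_mu_pow A hA n (mu A ^ n * s b) 1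
    have h2 := inner_mul_mu_pow A hA n (s b * mu A ^ n) 1
    rw [one_mul] at h1 h2
    rw [← h1, ← h2, mul_assoc, trace_comm]
  have : ‖mu A ^ n * s b - mu A ^ n‖ ^ 2 = ‖s b * mu A ^ n - mu A ^ n‖ ^ 2 := by
    rw [norm_sub_sq_real, norm_sub_sq_real, norm_mul_s, norm_s_mul, key]
  exact (sq_eq_sq₀ (norm_nonneg _) (norm_nonneg _)).1 this

/-- translation invariance in ℓ¹ -/
lemma n1_mu_translate [DecidableEq G] (B B' : Finset G) (ε : ℝ) (w : G)
    (hw : ∀ b ∈ B, w * b ∈ B') (hB : B ⊆ B') (hB0 : B.Nonempty)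
    (h : (B'.card : ℝ) ≤ (1 + ε) * B.card) :
    n1 (s w * mu B - mu B) ≤ 2 * ε := by
  set C := B.image (w * ·) with hC
  have hinj : Function.Injective (w * · : G → G) := mul_right_injective w
  have hCc : C.card = B.card := Finset.card_image_of_injective _ hinj
  have hCB : C ⊆ B' := by
    intro x hx
    obtain ⟨b, hb, rfl⟩ := Finset.mem_image.1 hx
    exact hw b hb
  have e1 : s w * mu B - mu B = (B.card : ℝ)⁻¹ • (∑ x ∈ C \ B, s x - ∑ x ∈ B \ C, s x) := by
    rw [Finset.sum_sdiff_sub_sum_sdiff, hC, Finset.sum_image (fun a _ b _ h => hinj h), mu,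
      mul_smul_comm, ← smul_sub, Finset.mul_sum]
    simp [s_mul]
  have hc : (0:ℝ) < B.card := by exact_mod_cast hB0.card_pos
  have c1 : ((C \ B).card : ℝ) ≤ ε * B.card := by
    have : ((C \ B).card : ℝ) ≤ (B' \ B).card := by
      exact_mod_cast Finset.card_le_card (Finset.sdiff_subset_sdiff hCB subset_rfl)
    have h2 : ((B' \ B).card : ℝ) + B.card = B'.card := by
      exact_mod_cast Finset.card_sdiff_add_card_eq_card hB
    linarith
  have c2 : ((B \ C).card : ℝ) ≤ ε * B.card := by
    have : ((B \ C).card : ℝ) ≤ (B' \ C).card := by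
      exact_mod_cast Finset.card_le_card (Finset.sdiff_subset_sdiff hB subset_rfl)
    have h2 : ((B' \ C).card : ℝ) + C.card = B'.card := by
      exact_mod_cast Finset.card_sdiff_add_card_eq_card hCB
    rw [hCc] at h2
    linarith
  rw [e1, n1_smul, abs_of_nonneg (by positivity)]
  have d1 : n1 (∑ x ∈ C \ B, s x) ≤ (C \ B).card := (n1_sum_le _ _).trans (by simp [n1_s])
  have d2 : n1 (∑ x ∈ B \ C, s x) ≤ (B \ C).card := (n1_sum_le _ _).trans (by simp [n1_s])
  have d3 := n1_sub_le (∑ x ∈ C \ B, s x) (∑ x ∈ B \ C, s x)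
  rw [inv_mul_le_iff₀ hc]
  linarith

end
end STB

namespace STB
noncomputable section

section abs
variable {V : Type*} [NormedAddCommGroup V] [InnerProductSpace ℝ V]

lemma greedy (X : Submodule ℝ V) (T : V →ₗ[ℝ] V) (K δ : ℝ) (hδ : 0 < δ)
    (hK : ∀ n (e : Fin n → V), Orthonormal ℝ e → (∀ j, e j ∈ X) → ∑ j, ‖T (e j)‖ ^ 2 ≤ K) :
    ∃ W : Finset V, (W.card : ℝ) * δ ^ 2 ≤ K ∧
      ∀ f ∈ X, (∀ w ∈ W, inner ℝ w f = 0) → ‖T f‖ ≤ δ * ‖f‖ := by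
  classical
  by_contra hcon
  push Not at hcon
  have bound : ∀ n (e : Fin n → V), Orthonormal ℝ e → (∀ j, e j ∈ X) → (∀ j, δ < ‖T (e j)‖) →
      (n : ℝ) * δ ^ 2 ≤ K := by
    intro n e he hX hT
    refine le_trans ?_ (hK n e he hX)
    calc (n : ℝ) * δ ^ 2 = ∑ j : Fin n, δ ^ 2 := by simp
      _ ≤ _ := Finset.sum_le_sum fun j _ => by
        have := hT j
        gcongr
  have all : ∀ n : ℕ, ∃ e : Fin n → V, Orthonormal ℝ e ∧ (∀ j, e j ∈ X) ∧ ∀ j, δ < ‖T (e j)‖ := by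
    intro n
    induction n with
    | zero => exact ⟨Fin.elim0, by simp [Orthonormal], by simp, by simp⟩
    | succ n ih =>
      obtain ⟨e, he, hX, hT⟩ := ih
      have hb := bound n e he hX hT
      obtain ⟨f, hfX, hf, hlt⟩ := hcon (Finset.univ.image e) (by
        refine le_trans ?_ hb
        gcongr
        simpa using Finset.card_image_le (s := Finset.univ) (f := e))
      have hf0 : f ≠ 0 := by rintro rfl; simp at hlt
      have hfn : 0 < ‖f‖ := norm_pos_iff.2 hf0
      have hpe : ∀ j, inner ℝ (e j) f = 0 := fun j => hf _ (by simp)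
      refine ⟨Fin.cons (‖f‖⁻¹ • f) e, ?_, ?_, ?_⟩
      · constructor
        · intro i
          refine Fin.cases ?_ (fun j => ?_) i
          · simp [norm_smul, hfn.ne']
          · simpa using he.1 j
        · intro i j
          refine Fin.cases ?_ (fun i => ?_) i <;> refine Fin.cases ?_ (fun j => ?_) j
          · intro h; exact (h rfl).elim
          · intro _; simp only [Fin.cons_zero, Fin.cons_succ, inner_smul_left]
            rw [real_inner_comm, hpe]; simp
          · intro _; simp only [Fin.cons_zero, Fin.cons_succ, inner_smul_right]
            rw [hpe]; simp
          · intro h; simpa using he.2 (fun hh => h (by rw [hh]))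
      · intro j
        refine Fin.cases ?_ (fun j => ?_) j
        · simpa using X.smul_mem _ hfX
        · simpa using hX j
      · intro j
        refine Fin.cases ?_ (fun j => ?_) j
        · simp only [Fin.cons_zero, map_smul, norm_smul, norm_inv, norm_norm]
          rw [lt_inv_mul_iff₀ hfn]; linarith
        · simpa using hT j
  obtain ⟨n, hn⟩ := exists_nat_gt (K / δ ^ 2)
  obtain ⟨e, he, hX, hT⟩ := all n
  have := bound n e he hX hT
  rw [div_lt_iff₀ (by positivity)] at hn
  linarith

lemma split (W : Finset V) (X : Submodule ℝ V) (hW : ∀ w ∈ W, w ∈ X) :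
    ∃ (d : ℕ) (b : Fin d → V), d ≤ W.card ∧ (∀ p, ‖b p‖ ≤ 1) ∧
      ∀ f ∈ X, ∃ (c : Fin d → ℝ) (f2 : V), (∀ p, |c p| ≤ ‖f‖) ∧ f2 ∈ X ∧
        (∀ w ∈ W, inner ℝ w f2 = 0) ∧ ‖f2‖ ≤ ‖f‖ ∧ ‖∑ p, c p • b p‖ ≤ ‖f‖ ∧
        f = ∑ p, c p • b p + f2 := by
  classical
  set P := Submodule.span ℝ (W : Set V) with hP
  have : FiniteDimensional ℝ P := FiniteDimensional.span_finset ℝ W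
  let b := stdOrthonormalBasis ℝ P
  refine ⟨Module.finrank ℝ P, fun p => (b p : V), finrank_span_finset_le_card W, ?_, ?_⟩
  · intro p
    have := b.orthonormal.1 p
    show ‖((b p : P) : V)‖ ≤ 1
    exact this.le
  intro f hf
  let f1 : P := P.orthogonalProjectionOnto f
  have hf1 : ‖f1‖ ≤ ‖f‖ := Submodule.norm_orthogonalProjectionOnto_apply_le P f
  have hsum : ∑ p, b.repr f1 p • (b p : V) = (f1 : V) := by
    conv_rhs => rw [← b.sum_repr f1]
    simp
  have hfo : f - (f1 : V) ∈ Pᗮ := Submodule.sub_starProjection_mem_orthogonal (K := P) f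
  have hPX : P ≤ X := Submodule.span_le.2 hW
  have horth : inner ℝ (f1 : V) (f - (f1 : V)) = 0 := hfo _ f1.2
  refine ⟨fun p => b.repr f1 p, f - f1, ?_, X.sub_mem hf (hPX f1.2), ?_, ?_, ?_, ?_⟩
  · intro p
    show |b.repr f1 p| ≤ ‖f‖
    rw [b.repr_apply_apply]
    refine (abs_real_inner_le_norm _ _).trans ?_
    rw [b.orthonormal.1 p, one_mul]; exact hf1
  · intro w hw
    exact hfo _ (Submodule.subset_span hw)
  · have : ‖f‖ ^ 2 = ‖(f1 : V)‖ ^ 2 + ‖f - f1‖ ^ 2 := by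
      have h := norm_add_sq_real (f1 : V) (f - f1)
      rw [horth] at h
      simpa using h
    exact le_of_sq_le_sq (by nlinarith [sq_nonneg ‖(f1:V)‖]) (norm_nonneg _)
  · rw [hsum]; exact hf1
  · rw [hsum]; simp

lemma net {Y : Type*} (S : Finset Y) (U : Y → V →ₗ[ℝ] V) (hU : ∀ y f, ‖U y f‖ ≤ ‖f‖)
    (M : V →ₗ[ℝ] V) (hM : ∀ f, ‖M f‖ ≤ ‖f‖) (X X' : Submodule ℝ V) (W W' : Finset V)
    (hW : ∀ w ∈ W, w ∈ X) (hW' : ∀ w ∈ W', w ∈ X') (η : ℝ)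
    (h : ∀ f ∈ X, (∀ w ∈ W, inner ℝ w f = 0) → ‖M f‖ ≤ η * ‖f‖)
    (h' : ∀ f ∈ X', (∀ w ∈ W', inner ℝ w f = 0) → ‖M f‖ ≤ η * ‖f‖) (hη : 0 ≤ η)
    (Q : ℕ) (hQ : 0 < Q) :
    ∃ F ⊆ S, F.card ≤ (2 * Q + 1) ^ (W.card * W'.card) ∧ ∀ y ∈ S, ∃ y' ∈ F, ∀ f ∈ X, ∀ v ∈ X',
      |inner ℝ (U y (M f) - U y' (M f)) (M v)| ≤
        (4 * η + (W.card * W'.card : ℕ) / (Q : ℝ)) * ‖f‖ * ‖v‖ := by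
  classical
  obtain ⟨d, b, hd, hb, hdec⟩ := split W X hW
  obtain ⟨d', b', hd', hb', hdec'⟩ := split W' X' hW'
  let m : Y → Fin d × Fin d' → ℝ := fun y p => inner ℝ (U y (M (b p.1))) (M (b' p.2))
  have hm : ∀ y p, |m y p| ≤ 1 := by
    intro y p
    refine (abs_real_inner_le_norm _ _).trans ?_
    have h1 : ‖U y (M (b p.1))‖ ≤ 1 := (hU _ _).trans ((hM _).trans (hb _))
    have h2 : ‖M (b' p.2)‖ ≤ 1 := (hM _).trans (hb' _)
    calc _ ≤ (1 : ℝ) * 1 := by gcongr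
      _ = 1 := one_mul 1
  let code : Y → Fin d × Fin d' → ℤ := fun y p => ⌊Q * m y p⌋
  have hQ' : (0 : ℝ) < Q := by exact_mod_cast hQ
  have hcode : ∀ y, code y ∈ Fintype.piFinset (fun _ : Fin d × Fin d' => Finset.Icc (-(Q : ℤ)) Q) := by
    intro y
    rw [Fintype.mem_piFinset]
    intro p
    have := abs_le.1 (hm y p)
    rw [Finset.mem_Icc]
    constructor
    · rw [Int.le_floor]; push_cast; nlinarith
    · have : code y p ≤ ⌊(Q : ℝ)⌋ := Int.floor_le_floor (by nlinarith)
      simpa using this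
  let rep : (Fin d × Fin d' → ℤ) → Option Y := fun z =>
    if hz : ∃ y ∈ S, code y = z then some hz.choose else none
  let F : Finset Y := S.filter (fun y => rep (code y) = some y)
  have hrep : ∀ y ∈ S, ∃ y' ∈ F, code y' = code y := by
    intro y hy
    have hz : ∃ y' ∈ S, code y' = code y := ⟨y, hy, rfl⟩
    have h1 := hz.choose_spec
    refine ⟨hz.choose, ?_, h1.2⟩
    rw [Finset.mem_filter]
    refine ⟨h1.1, ?_⟩
    rw [h1.2]
    simp only [rep]
    rw [dif_pos hz]
  refine ⟨F, Finset.filter_subset _ _, ?_, ?_⟩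
  · have hinj : Set.InjOn code F := by
      intro y hy y' hy' hyy
      have h1 := (Finset.mem_filter.1 hy).2
      have h2 := (Finset.mem_filter.1 hy').2
      rw [hyy, h2] at h1
      exact (Option.some.inj h1).symm
    have h3 := Finset.card_le_card_of_injOn code (s := F) (fun y _ => hcode y) hinj
    refine h3.trans ?_
    rw [Fintype.card_piFinset]
    simp only [Int.card_Icc, Finset.prod_const, Finset.card_univ, Fintype.card_prod, Fintype.card_fin]
    have : ((Q : ℤ) + 1 - -(Q : ℤ)).toNat = 2 * Q + 1 := by omega
    rw [this]
    exact Nat.pow_le_pow_right (by omega) (Nat.mul_le_mul hd hd')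
  · intro y hy
    obtain ⟨y', hy', hyy⟩ := hrep y hy
    refine ⟨y', hy', ?_⟩
    have hdiff : ∀ p, |m y p - m y' p| ≤ 1 / Q := by
      intro p
      have := congrFun hyy p
      have h1 := Int.abs_sub_lt_one_of_floor_eq_floor this
      rw [← mul_sub, abs_mul, abs_of_pos hQ'] at h1
      rw [le_div_iff₀ hQ', abs_sub_comm]; linarith
    intro f hf v hv
    obtain ⟨c, f2, hc, hf2X, hf2o, hf2n, hf1n, hfe⟩ := hdec f hf
    obtain ⟨c', v2, hc', hv2X, hv2o, hv2n, hv1n, hve⟩ := hdec' v hv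
    set f1 := ∑ p, c p • b p with hf1
    set v1 := ∑ p, c' p • b' p with hv1
    let D : V →ₗ[ℝ] V := U y - U y'
    have hD : ∀ g, ‖D g‖ ≤ 2 * ‖g‖ := by
      intro g
      refine (norm_sub_le _ _).trans ?_
      linarith [hU y g, hU y' g]
    have hDe : U y (M f) - U y' (M f) = D (M f) := rfl
    have e : inner ℝ (D (M f)) (M v) = inner ℝ (D (M f1)) (M v1) + inner ℝ (D (M f1)) (M v2)
        + inner ℝ (D (M f2)) (M v) := by
      conv_lhs => rw [hfe]
      rw [map_add, map_add, inner_add_left, ← inner_add_right, ← map_add, ← hve]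
    have t3 : |inner ℝ (D (M f2)) (M v)| ≤ 2 * η * ‖f‖ * ‖v‖ := by
      refine (abs_real_inner_le_norm _ _).trans ?_
      have h1 : ‖D (M f2)‖ ≤ 2 * (η * ‖f‖) := by
        refine (hD _).trans ?_
        have := h f2 hf2X hf2o
        have : η * ‖f2‖ ≤ η * ‖f‖ := by gcongr
        linarith
      calc _ ≤ 2 * (η * ‖f‖) * ‖v‖ := by gcongr; exact hM _
        _ = _ := by ring
    have t2 : |inner ℝ (D (M f1)) (M v2)| ≤ 2 * η * ‖f‖ * ‖v‖ := by
      refine (abs_real_inner_le_norm _ _).trans ?_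
      have h1 : ‖M v2‖ ≤ η * ‖v‖ := by
        refine (h' v2 hv2X hv2o).trans ?_
        gcongr
      have h2 : ‖D (M f1)‖ ≤ 2 * ‖f‖ := by
        refine (hD _).trans ?_
        linarith [hM f1]
      calc _ ≤ (2 * ‖f‖) * (η * ‖v‖) := by gcongr
        _ = _ := by ring
    have t1 : |inner ℝ (D (M f1)) (M v1)| ≤ ((W.card * W'.card : ℕ) / (Q : ℝ)) * ‖f‖ * ‖v‖ := by
      have e1 : inner ℝ (D (M f1)) (M v1) =
          ∑ p, ∑ q, c p * c' q * (m y (p, q) - m y' (p, q)) := by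
        rw [hf1, hv1]
        simp only [map_sum, map_smul]
        rw [sum_inner]
        refine Finset.sum_congr rfl fun p _ => ?_
        rw [inner_sum]
        refine Finset.sum_congr rfl fun q _ => ?_
        rw [inner_smul_left, inner_smul_right]
        have : inner ℝ (D (M (b p))) (M (b' q)) = m y (p, q) - m y' (p, q) := by
          simp only [D, m, LinearMap.sub_apply, inner_sub_left]
        rw [this]; simp; ring
      rw [e1]
      refine (Finset.abs_sum_le_sum_abs _ _).trans ?_
      have : ∀ p, |∑ q, c p * c' q * (m y (p, q) - m y' (p, q))| ≤ (d' : ℝ) * (‖f‖ * ‖v‖ * (1 / Q)) := by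
        intro p
        refine (Finset.abs_sum_le_sum_abs _ _).trans ?_
        calc _ ≤ ∑ q : Fin d', ‖f‖ * ‖v‖ * (1 / (Q : ℝ)) := by
              refine Finset.sum_le_sum fun q _ => ?_
              rw [abs_mul, abs_mul]
              gcongr
              · exact hc p
              · exact hc' q
              · exact hdiff _
          _ = _ := by simp
      calc _ ≤ ∑ p : Fin d, (d' : ℝ) * (‖f‖ * ‖v‖ * (1 / Q)) := Finset.sum_le_sum fun p _ => this p
        _ = (d * d' : ℕ) * (‖f‖ * ‖v‖ * (1 / Q)) := by simp; ring
        _ ≤ (W.card * W'.card : ℕ) * (‖f‖ * ‖v‖ * (1 / Q)) := by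
            gcongr
        _ = _ := by ring
    rw [hDe, e]
    refine (abs_add_three _ _ _).trans ?_
    nlinarith
end abs

end
end STB

namespace STB
noncomputable section

variable {G : Type} [Group G] [DecidableEq G]

structure Hyp (A : Finset G) (k : ℕ) : Prop where
  one : (1 : G) ∈ A
  inv : A⁻¹ = A
  trip : (A ^ 3).card ≤ k * A.card
  kpos : 0 < k

lemma Hyp.nonempty {A : Finset G} {k : ℕ} (h : Hyp A k) : A.Nonempty := ⟨1, h.one⟩

lemma Hyp.mono {A : Finset G} {k : ℕ} (h : Hyp A k) {m n : ℕ} (hmn : m ≤ n) : A ^ m ⊆ A ^ n :=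
  Finset.pow_subset_pow_right h.one hmn

lemma Hyp.cardpos {A : Finset G} {k : ℕ} (h : Hyp A k) : (0 : ℝ) < A.card := by
  exact_mod_cast h.nonempty.card_pos

lemma Hyp.card_pow {A : Finset G} {k : ℕ} (h : Hyp A k) (n : ℕ) :
    ((A ^ n).card : ℝ) ≤ (k : ℝ) ^ n * A.card := by
  have hk1 : (1 : ℝ) ≤ k := by exact_mod_cast h.kpos
  have htr : ((A ^ 3).card : ℝ) ≤ k * A.card := by exact_mod_cast h.trip
  have hc := h.cardpos
  rcases Nat.lt_or_ge n 3 with hn | hn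
  · rcases Nat.eq_zero_or_pos n with rfl | hn0
    · have : (1 : ℝ) ≤ A.card := by exact_mod_cast h.nonempty.card_pos
      simpa using this
    · have h1 : ((A ^ n).card : ℝ) ≤ (A ^ 3).card := by
        exact_mod_cast Finset.card_le_card (h.mono hn.le)
      have h2 : (k : ℝ) ≤ k ^ n := by
        calc (k : ℝ) = k ^ 1 := (pow_one _).symm
          _ ≤ k ^ n := pow_le_pow_right₀ hk1 hn0
      calc _ ≤ (k : ℝ) * A.card := h1.trans htr
        _ ≤ _ := by gcongr
  · have h1 := Finset.small_pow_of_small_tripling hn htr h.inv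
    refine h1.trans ?_
    gcongr
    omega

lemma s_mul_s (x y : G) (f : E G) : s x * (s y * f) = s (x * y) * f := by
  rw [← mul_assoc, s_mul]

lemma mul_mem_Spf {X Y : Finset G} {f g : E G} (hf : f ∈ Sp (X : Set G)) (hg : g ∈ Sp (Y : Set G)) :
    f * g ∈ Sp ((X * Y : Finset G) : Set G) := by
  rw [Finset.coe_mul]; exact mul_mem_Sp hf hg

lemma mu_pow_mem (A : Finset G) (n : ℕ) : mu A ^ n ∈ Sp ((A ^ n : Finset G) : Set G) := by
  rw [Finset.coe_pow]; exact pow_mem_Sp (mu_mem A) n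

lemma mul_mu_pow_mem {A : Finset G} {i : ℕ} {f : E G} (hf : f ∈ Sp ((A ^ i : Finset G) : Set G))
    (n : ℕ) : f * mu A ^ n ∈ Sp ((A ^ (i + n) : Finset G) : Set G) := by
  rw [pow_add]; exact mul_mem_Spf hf (mu_pow_mem A n)

lemma s_mul_mem {A : Finset G} {i c : ℕ} {f : E G} (hf : f ∈ Sp ((A ^ i : Finset G) : Set G))
    {y : G} (hy : y ∈ A ^ c) : s y * f ∈ Sp ((A ^ (c + i) : Finset G) : Set G) := by
  rw [pow_add]; exact mul_mem_Spf (s_mem (by exact_mod_cast hy)) hf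

lemma norm_sq_of_Sp (X : Finset G) {f : E G} (hf : f ∈ Sp (X : Set G)) :
    ‖f‖ ^ 2 = ∑ g ∈ X, f.coeff g ^ 2 := by
  rw [← real_inner_self_eq_norm_sq, inner_eq_ip, ip_eq_sum f f X]
  · simp [sq]
  · intro g hg
    by_contra hgX
    exact (Finsupp.mem_support_iff.1 hg) (hf g (by simpa using hgX))

lemma hs {A : Finset G} {k : ℕ} (h : Hyp A k) (i n : ℕ) (e : Fin n → E G) (he : Orthonormal ℝ e)
    (hX : ∀ j, e j ∈ Sp ((A ^ i : Finset G) : Set G)) :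
    ∑ j, ‖e j * mu A‖ ^ 2 ≤ (k : ℝ) ^ (i + 1) := by
  have hc := h.cardpos
  calc ∑ j, ‖e j * mu A‖ ^ 2 = ∑ j, ∑ g ∈ A ^ (i + 1), (e j * mu A).coeff g ^ 2 := by
        refine Finset.sum_congr rfl fun j _ => norm_sq_of_Sp _ ?_
        have := mul_mu_pow_mem (hX j) 1
        simpa using this
    _ = ∑ g ∈ A ^ (i + 1), ∑ j, ‖inner ℝ (e j) (s g * mu A)‖ ^ 2 := by
        rw [Finset.sum_comm]
        refine Finset.sum_congr rfl fun g _ => Finset.sum_congr rfl fun j _ => ?_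
        rw [← inner_s_right, inner_mul_mu A h.inv, Real.norm_eq_abs, sq_abs]
    _ ≤ ∑ g ∈ A ^ (i + 1), (A.card : ℝ)⁻¹ := by
        refine Finset.sum_le_sum fun g _ => ?_
        refine (he.sum_inner_products_le (x := s g * mu A) (s := Finset.univ)).trans ?_
        rw [norm_s_mul, norm_mu_sq A h.nonempty]
    _ = (A ^ (i + 1)).card * (A.card : ℝ)⁻¹ := by simp
    _ ≤ _ := by
        rw [mul_inv_le_iff₀ hc]; exact h.card_pow _

lemma iter {A : Finset G} {k : ℕ} (h : Hyp A k) (δ : ℝ) (hδ : 0 < δ) (I : ℕ) (m : ℕ) :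
    ∀ i, i + m ≤ I → ∃ W : Finset (E G), (W.card : ℝ) * δ ^ 2 ≤ m * (k : ℝ) ^ I ∧
      ∀ f ∈ Sp ((A ^ i : Finset G) : Set G), (∀ w ∈ W, inner ℝ w f = 0) →
        ‖f * mu A ^ m‖ ≤ δ ^ m * ‖f‖ := by
  classical
  induction m with
  | zero => intro i _; exact ⟨∅, by simp, by simp⟩
  | succ m ih =>
    intro i hi
    have hk1 : (1 : ℝ) ≤ k := by exact_mod_cast h.kpos
    obtain ⟨W1, hW1, h1⟩ := ih (i + 1) (by omega)
    obtain ⟨W0, hW0, h0⟩ := greedy (Sp ((A ^ i : Finset G) : Set G)) (LinearMap.mulRight ℝ (mu A))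
      ((k : ℝ) ^ I) δ hδ (by
        intro n e he hX
        refine le_trans (by simpa using hs h i n e he hX) ?_
        exact pow_le_pow_right₀ hk1 (by omega))
    refine ⟨W0 ∪ W1.image (· * mu A), ?_, ?_⟩
    · have : ((W0 ∪ W1.image (· * mu A)).card : ℝ) ≤ W0.card + W1.card := by
        exact_mod_cast (Finset.card_union_le _ _).trans
          (Nat.add_le_add_left Finset.card_image_le _)
      push_cast
      nlinarith [sq_nonneg δ]
    · intro f hf hw
      have e0 := h0 f hf (fun w hw0 => hw w (by simp [hw0]))
      have hf1 : f * mu A ∈ Sp ((A ^ (i + 1) : Finset G) : Set G) := by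
        simpa using mul_mu_pow_mem hf 1
      have e1 := h1 (f * mu A) hf1 (fun w hw1 => by
        rw [← inner_mul_mu A h.inv]
        exact hw _ (Finset.mem_union_right _ (Finset.mem_image_of_mem _ hw1)))
      simp only [LinearMap.mulRight_apply] at e0
      rw [pow_succ', ← mul_assoc]
      calc _ ≤ δ ^ m * ‖f * mu A‖ := e1
        _ ≤ δ ^ m * (δ * ‖f‖) := by gcongr
        _ = _ := by ring

lemma restrict (X : Finset G) (W : Finset (E G)) :
    ∃ W' : Finset (E G), W'.card ≤ W.card ∧ (∀ w ∈ W', w ∈ Sp (X : Set G)) ∧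
      ∀ f ∈ Sp (X : Set G), (∀ w ∈ W', inner ℝ w f = 0) → ∀ w ∈ W, inner ℝ w f = 0 := by
  classical
  let res : E G → E G := fun w => ∑ g ∈ X, w.coeff g • s g
  refine ⟨W.image res, Finset.card_image_le, ?_, ?_⟩
  · intro w hw
    obtain ⟨w, _, rfl⟩ := Finset.mem_image.1 hw
    exact Submodule.sum_mem _ fun g hg => Submodule.smul_mem _ _ (s_mem (by exact_mod_cast hg))
  · intro f hf h w hw
    rw [← h _ (Finset.mem_image_of_mem res hw), real_inner_comm, inner_eq_ip, ip_eq_sum f w X]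
    · simp only [res, sum_inner, inner_smul_left, inner_s]
      refine Finset.sum_congr rfl fun g _ => ?_
      simp [mul_comm]
    · intro g hg
      by_contra hgX
      exact (Finsupp.mem_support_iff.1 hg) (hf g (by simpa using hgX))

def Bl (A : Finset G) (i : ℕ) (ρ : ℝ) : Set G :=
  {y | ∀ f ∈ Sp ((A ^ i : Finset G) : Set G),
    ‖s y * (f * mu A ^ 32) - f * mu A ^ 32‖ ≤ ρ * ‖f‖}

lemma iter' {A : Finset G} {k : ℕ} (h : Hyp A k) (t : ℕ) (ht : 1 ≤ t) (I i : ℕ) (hi : i + 16 ≤ I) :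
    ∃ W : Finset (E G), W.card ≤ 16 * k ^ I * t ^ 2 ∧ (∀ w ∈ W, w ∈ Sp ((A ^ i : Finset G) : Set G)) ∧
      ∀ f ∈ Sp ((A ^ i : Finset G) : Set G), (∀ w ∈ W, inner ℝ w f = 0) →
        ‖f * mu A ^ 16‖ ≤ 1 / (t : ℝ) ^ 16 * ‖f‖ := by
  have ht' : (0 : ℝ) < t := by exact_mod_cast ht
  obtain ⟨W, hW, h1⟩ := iter h (1 / t) (by positivity) I 16 i hi
  obtain ⟨W', hc, hm, h2⟩ := restrict (A ^ i) W
  refine ⟨W', ?_, hm, ?_⟩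
  · refine hc.trans ?_
    have : (W.card : ℝ) ≤ 16 * k ^ I * t ^ 2 := by
      rw [div_pow, one_pow, mul_one_div, div_le_iff₀ (by positivity)] at hW
      exact_mod_cast hW
    exact_mod_cast this
  · intro f hf hw
    have := h1 f hf (h2 f hf hw)
    simpa using this

lemma netlem (k i : ℕ) (hk : 0 < k) : ∃ C : ℕ, ∀ t : ℕ, 1 ≤ t → ∀ (G : Type) [Group G] [DecidableEq G]
    (A : Finset G), Hyp A k → ∃ F ⊆ A, F.card ≤ 2 ^ (C * t ^ 5) ∧ ∀ y ∈ A, ∃ y' ∈ F,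
      y'⁻¹ * y ∈ Bl A i (8 / (t : ℝ) ^ 16) := by
  obtain ⟨K, hK⟩ : ∃ K, K = k ^ (i + 60) := ⟨_, rfl⟩
  have hKpos : 0 < K := by rw [hK]; positivity
  refine ⟨(28 + 2 * K) * (256 * K ^ 2), ?_⟩
  intro t ht G _ _ A h
  have ht' : (0 : ℝ) < t := by exact_mod_cast ht
  have hKr : (0 : ℝ) < K := by exact_mod_cast hKpos
  obtain ⟨W, hWc, hWm, hW⟩ := iter' h t ht (i + 60) i (by omega)
  obtain ⟨W', hWc', hWm', hW'⟩ := iter' h t ht (i + 60) (i + 33) (by omega)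
  rw [← hK] at hWc hWc'
  obtain ⟨Q, hQ⟩ : ∃ Q, Q = 64 * K ^ 2 * t ^ 20 := ⟨_, rfl⟩
  have hQpos : 0 < Q := by rw [hQ]; positivity
  have hdd : W.card * W'.card ≤ 256 * K ^ 2 * t ^ 4 := by
    calc _ ≤ (16 * K * t ^ 2) * (16 * K * t ^ 2) := Nat.mul_le_mul hWc hWc'
      _ = _ := by ring
  obtain ⟨F, hFA, hFc, hF⟩ := net A (fun y => LinearMap.mulLeft ℝ (s y))
    (fun y f => by simp [norm_s_mul]) (LinearMap.mulRight ℝ (mu A ^ 16))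
    (fun f => by simpa using norm_mul_mu_pow_le f A 16) _ _ W W' hWm hWm' (1 / (t : ℝ) ^ 16)
    (by simpa using hW) (by simpa using hW') (by positivity) Q hQpos
  refine ⟨F, hFA, ?_, ?_⟩
  · refine hFc.trans ?_
    have h1 : 2 * Q + 1 ≤ 2 ^ ((28 + 2 * K) * t) := by
      have a1 : K ≤ 2 ^ K := Nat.lt_two_pow_self.le
      have a2 : t ≤ 2 ^ t := Nat.lt_two_pow_self.le
      have : 1 ≤ K ^ 2 * t ^ 20 := Nat.one_le_iff_ne_zero.2 (by positivity)
      calc 2 * Q + 1 ≤ 2 ^ 8 * K ^ 2 * t ^ 20 := by rw [hQ]; nlinarith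
        _ ≤ 2 ^ 8 * (2 ^ K) ^ 2 * (2 ^ t) ^ 20 := by gcongr
        _ = 2 ^ (8 + 2 * K + 20 * t) := by rw [← pow_mul, ← pow_mul, ← pow_add, ← pow_add]; ring_nf
        _ ≤ _ := by
          apply Nat.pow_le_pow_right (by norm_num)
          nlinarith
    calc _ ≤ (2 * Q + 1) ^ (256 * K ^ 2 * t ^ 4) := Nat.pow_le_pow_right (by omega) hdd
      _ ≤ (2 ^ ((28 + 2 * K) * t)) ^ (256 * K ^ 2 * t ^ 4) := Nat.pow_le_pow_left h1 _
      _ = _ := by rw [← pow_mul]; ring_nf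
  · intro y hy
    obtain ⟨y', hy', hyy⟩ := hF y hy
    refine ⟨y', hy', ?_⟩
    intro f hf
    set g := f * mu A ^ 32 with hg
    have e0 : s (y'⁻¹ * y) * g - g = s y'⁻¹ * (s y * g - s y' * g) := by
      rw [mul_sub, s_mul_s, s_mul_s, inv_mul_cancel, s_one, one_mul]
    rw [e0, norm_s_mul]
    set v := s y * g - s y' * g with hv
    have hgm := mul_mu_pow_mem hf 32
    have hvm : v ∈ Sp ((A ^ (i + 33) : Finset G) : Set G) := by
      have a := s_mul_mem (c := 1) hgm (y := y) (by simpa using hy)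
      have b := s_mul_mem (c := 1) hgm (y := y') (by simpa using hFA hy')
      have : 1 + (i + 32) = i + 33 := by omega
      rw [this] at a b
      exact Submodule.sub_mem _ a b
    have h1 := hyy f hf v hvm
    simp only [LinearMap.mulLeft_apply, LinearMap.mulRight_apply] at h1
    rw [← inner_mul_mu_pow A h.inv] at h1
    have e1 : (s y * (f * mu A ^ 16) - s y' * (f * mu A ^ 16)) * mu A ^ 16 = v := by
      simp only [hv, hg, sub_mul, mul_assoc, ← pow_add]
    rw [e1, real_inner_self_eq_norm_sq, abs_of_nonneg (sq_nonneg _)] at h1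
    have h2 : ((W.card * W'.card : ℕ) : ℝ) / Q ≤ 4 / (t : ℝ) ^ 16 := by
      rw [div_le_div_iff₀ (by positivity) (by positivity)]
      have : ((W.card * W'.card : ℕ) : ℝ) ≤ 256 * K ^ 2 * t ^ 4 := by exact_mod_cast hdd
      calc _ ≤ (256 * (K : ℝ) ^ 2 * t ^ 4) * t ^ 16 := by gcongr
        _ = _ := by rw [hQ]; push_cast; ring
    have h3 : 4 * (1 / (t : ℝ) ^ 16) + ((W.card * W'.card : ℕ) : ℝ) / Q ≤ 8 / (t : ℝ) ^ 16 := by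
      calc _ ≤ 4 * (1 / (t : ℝ) ^ 16) + 4 / (t : ℝ) ^ 16 := by gcongr
        _ = _ := by ring
    have h4 : ‖v‖ ^ 2 ≤ 8 / (t : ℝ) ^ 16 * ‖f‖ * ‖v‖ := h1.trans (by gcongr)
    by_cases hv0 : ‖v‖ = 0
    · rw [hv0]; positivity
    · have : 0 < ‖v‖ := lt_of_le_of_ne (norm_nonneg _) (Ne.symm hv0)
      nlinarith

end
end STB

namespace STB
noncomputable section

variable {G : Type} [Group G] [DecidableEq G]

lemma Bl_one (A : Finset G) (i : ℕ) {ρ : ℝ} (hρ : 0 ≤ ρ) : (1 : G) ∈ Bl A i ρ := by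
  intro f _
  rw [s_one, one_mul, sub_self, norm_zero]; positivity

lemma Bl_inv {A : Finset G} {i : ℕ} {ρ : ℝ} {y : G} (hy : y ∈ Bl A i ρ) : y⁻¹ ∈ Bl A i ρ := by
  intro f hf
  have := hy f hf
  rw [← norm_s_mul y, mul_sub, s_mul_s, mul_inv_cancel, s_one, one_mul, norm_sub_rev]
  exact this

lemma Bl_mul {A : Finset G} {i : ℕ} {ρ ρ' : ℝ} {y z : G} (hy : y ∈ Bl A i ρ) (hz : z ∈ Bl A i ρ') :
    y * z ∈ Bl A i (ρ + ρ') := by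
  intro f hf
  have h1 := hy f hf
  have h2 := hz f hf
  set g := f * mu A ^ 32
  have : s (y * z) * g - g = s y * (s z * g - g) + (s y * g - g) := by
    rw [mul_sub, s_mul_s]; abel
  rw [this]
  refine (norm_add_le _ _).trans ?_
  rw [norm_s_mul]; linarith

lemma Bl_mono {A : Finset G} {i : ℕ} {ρ ρ' : ℝ} (h : ρ ≤ ρ') : Bl A i ρ ⊆ Bl A i ρ' := by
  intro y hy f hf
  refine (hy f hf).trans ?_
  gcongr

lemma Bl_anti {A : Finset G} {k : ℕ} (h : Hyp A k) {i i' : ℕ} (hi : i ≤ i') {ρ : ℝ} :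
    Bl A i' ρ ⊆ Bl A i ρ := by
  intro y hy f hf
  exact hy f (Sp_mono (by exact_mod_cast h.mono hi) hf)

lemma Bl_pow {A : Finset G} {i : ℕ} {ρ : ℝ} {y : G} (hy : y ∈ Bl A i ρ) (n : ℕ) :
    y ^ n ∈ Bl A i (n * ρ) := by
  induction n with
  | zero => simpa using Bl_one A i le_rfl
  | succ n ih =>
    rw [pow_succ]
    have := Bl_mul ih hy
    push_cast
    rwa [add_mul, one_mul]

lemma Bl_conj {A : Finset G} {i c : ℕ} {ρ : ℝ} {y z : G} (hz : z ∈ A ^ c)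
    (hy : y ∈ Bl A (c + i) ρ) : z⁻¹ * y * z ∈ Bl A i ρ := by
  intro f hf
  have := hy _ (s_mul_mem hf hz)
  rw [norm_s_mul, mul_assoc, s_mul_s] at this
  rw [← norm_s_mul z, mul_sub, s_mul_s]
  have e : z * (z⁻¹ * y * z) = y * z := by group
  rw [e]; exact this

def f0 (A : Finset G) : E G := Real.sqrt A.card • mu A
def u (A : Finset G) : E G := f0 A * mu A ^ 32

lemma norm_f0 {A : Finset G} (hA : A.Nonempty) : ‖f0 A‖ = 1 := by
  have hc : (0 : ℝ) < A.card := by exact_mod_cast hA.card_pos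
  have : ‖f0 A‖ ^ 2 = 1 := by
    rw [f0, norm_smul, mul_pow, norm_mu_sq A hA, Real.norm_eq_abs, sq_abs, Real.sq_sqrt hc.le,
      mul_inv_cancel₀ hc.ne']
  nlinarith [norm_nonneg (f0 A)]

lemma f0_mem (A : Finset G) : f0 A ∈ Sp ((A ^ 1 : Finset G) : Set G) := by
  rw [pow_one]; exact Submodule.smul_mem _ _ (mu_mem A)

lemma u_eq (A : Finset G) : u A = Real.sqrt A.card • mu A ^ 33 := by
  rw [u, f0, smul_mul_assoc, ← pow_succ']

lemma u_mem (A : Finset G) : u A ∈ Sp ((A ^ 33 : Finset G) : Set G) :=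
  mul_mu_pow_mem (f0_mem A) 32

lemma n1_u (A : Finset G) : n1 (u A) ≤ Real.sqrt A.card := by
  rw [u_eq, n1_smul, abs_of_nonneg (Real.sqrt_nonneg _)]
  have := n1_mu_pow A 33
  nlinarith [Real.sqrt_nonneg (A.card : ℝ)]

lemma Bl_u {A : Finset G} {k : ℕ} (h : Hyp A k) {i : ℕ} (hi : 1 ≤ i) {ρ : ℝ} {y : G}
    (hy : y ∈ Bl A i ρ) : ‖s y * u A - u A‖ ≤ ρ := by
  have := Bl_anti h hi hy _ (f0_mem A)
  rwa [norm_f0 h.nonempty, mul_one] at this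

lemma norm_sq_lower {A : Finset G} {k : ℕ} (h : Hyp A k) :
    1 / (k : ℝ) ≤ A.card * ‖mu A * mu A‖ ^ 2 := by
  have hc := h.cardpos
  have hkp : (0 : ℝ) < k := by exact_mod_cast h.kpos
  have hne : (A ^ 2).Nonempty := h.nonempty.pow
  have hc2 : (0 : ℝ) < (A ^ 2).card := by exact_mod_cast hne.card_pos
  have h2 : ((A ^ 2).card : ℝ) ≤ k * A.card := by
    exact_mod_cast (Finset.card_le_card (h.mono (by norm_num))).trans h.trip
  have e : inner ℝ (mu A * mu A) (mu (A ^ 2)) = ((A ^ 2).card : ℝ)⁻¹ := by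
    nth_rw 1 [mu]
    nth_rw 1 [mu]
    rw [smul_mul_smul_comm, Finset.sum_mul_sum, inner_smul_left, sum_inner]
    have : ∀ a ∈ A, inner ℝ (∑ b ∈ A, s a * s b) (mu (A ^ 2)) = A.card * ((A ^ 2).card : ℝ)⁻¹ := by
      intro a ha
      rw [sum_inner]
      have : ∀ b ∈ A, inner ℝ (s a * s b) (mu (A ^ 2)) = ((A ^ 2).card : ℝ)⁻¹ := by
        intro b hb
        rw [s_mul, inner_s, coeff_mu, if_pos]
        rw [pow_two]; exact Finset.mul_mem_mul ha hb
      rw [Finset.sum_congr rfl this]; simp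
    rw [Finset.sum_congr rfl this]
    simp only [Finset.sum_const, nsmul_eq_mul, conj_trivial]
    field_simp
  have cs := abs_real_inner_le_norm (mu A * mu A) (mu (A ^ 2))
  rw [e, abs_of_pos (by positivity)] at cs
  have cs2 : (((A ^ 2).card : ℝ)⁻¹) ^ 2 ≤ ‖mu A * mu A‖ ^ 2 * ((A ^ 2).card : ℝ)⁻¹ := by
    rw [← norm_mu_sq _ hne, ← mul_pow, norm_mu_sq _ hne]
    gcongr
  have cs3 : ((A ^ 2).card : ℝ)⁻¹ ≤ ‖mu A * mu A‖ ^ 2 := by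
    have : 0 < ((A ^ 2).card : ℝ)⁻¹ := by positivity
    nlinarith
  calc 1 / (k : ℝ) = A.card * (k * A.card : ℝ)⁻¹ := by field_simp
    _ ≤ A.card * ((A ^ 2).card : ℝ)⁻¹ := by gcongr
    _ ≤ _ := by gcongr

lemma small_mem {A : Finset G} {k : ℕ} (h : Hyp A k) {x : G}
    (hx : ‖s x * u A - u A‖ ≤ 1 / (2 * k : ℝ) ^ 16) : x ∈ A ^ 4 := by
  by_contra hxA
  have hc := h.cardpos
  have hkp : (0 : ℝ) < k := by exact_mod_cast h.kpos
  set w := s x * f0 A - f0 A with hw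
  have hw2 : ‖w‖ ≤ 2 := by
    refine (norm_sub_le _ _).trans ?_
    rw [norm_s_mul, norm_f0 h.nonempty]; norm_num
  have step : ∀ j, ‖w * mu A ^ j‖ ^ 2 ≤ 2 * ‖w * mu A ^ (2 * j)‖ := by
    intro j
    rw [← real_inner_self_eq_norm_sq, inner_mul_mu_pow A h.inv, mul_assoc, ← pow_add, ← two_mul]
    refine (real_inner_le_norm _ _).trans ?_
    gcongr
  have e32 : w * mu A ^ 32 = s x * u A - u A := by
    rw [hw, sub_mul, mul_assoc]; rfl
  have p1 := step 1
  have p2 := step 2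
  have p4 := step 4
  have p8 := step 8
  have p16 := step 16
  norm_num only at p1 p2 p4 p8 p16
  rw [e32] at p16
  have key : ‖w * mu A ^ 1‖ ^ 32 ≤ 2 ^ 31 * ‖s x * u A - u A‖ := by
    calc ‖w * mu A ^ 1‖ ^ 32 = (‖w * mu A ^ 1‖ ^ 2) ^ 16 := by ring
      _ ≤ (2 * ‖w * mu A ^ 2‖) ^ 16 := by gcongr
      _ = 2 ^ 16 * (‖w * mu A ^ 2‖ ^ 2) ^ 8 := by ring
      _ ≤ 2 ^ 16 * (2 * ‖w * mu A ^ 4‖) ^ 8 := by gcongr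
      _ = 2 ^ 24 * (‖w * mu A ^ 4‖ ^ 2) ^ 4 := by ring
      _ ≤ 2 ^ 24 * (2 * ‖w * mu A ^ 8‖) ^ 4 := by gcongr
      _ = 2 ^ 28 * (‖w * mu A ^ 8‖ ^ 2) ^ 2 := by ring
      _ ≤ 2 ^ 28 * (2 * ‖w * mu A ^ 16‖) ^ 2 := by gcongr
      _ = 2 ^ 30 * (‖w * mu A ^ 16‖ ^ 2) := by ring
      _ ≤ 2 ^ 30 * (2 * ‖s x * u A - u A‖) := by gcongr
      _ = _ := by ring
  have e1 : ‖w * mu A ^ 1‖ ^ 2 = 2 * (A.card * ‖mu A * mu A‖ ^ 2) := by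
    have e : w * mu A ^ 1 = Real.sqrt A.card • (s x * (mu A * mu A) - mu A * mu A) := by
      rw [hw, pow_one, f0, smul_sub, sub_mul, mul_smul_comm, smul_mul_assoc, smul_mul_assoc, mul_assoc]
    rw [e, norm_smul, mul_pow, Real.norm_eq_abs, sq_abs, Real.sq_sqrt hc.le, norm_sub_sq_real,
      norm_s_mul]
    have hm : mu A * mu A ∈ Sp ((A ^ 2 : Finset G) : Set G) := by
      rw [← pow_two]; exact mu_pow_mem A 2
    have : inner ℝ (s x * (mu A * mu A)) (mu A * mu A) = 0 := by
      rw [real_inner_comm, inner_eq_ip, ip_eq_sum _ _ (A ^ 2)]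
      · refine Finset.sum_eq_zero fun g hg => ?_
        have : (s x * (mu A * mu A)).coeff g = (mu A * mu A).coeff (x⁻¹ * g) := by
          rw [← inner_s_right, inner_s_mul, s_mul, inner_s_right]
        rw [this, hm (x⁻¹ * g), mul_zero]
        intro hmem
        have hmem : x⁻¹ * g ∈ A ^ 2 := by exact_mod_cast hmem
        apply hxA
        have : x = g * (x⁻¹ * g)⁻¹ := by group
        rw [this, show (4 : ℕ) = 2 + 2 from rfl, pow_add]
        refine Finset.mul_mem_mul hg ?_
        have hi : (A ^ 2)⁻¹ = A ^ 2 := by rw [← inv_pow, h.inv]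
        rw [← hi]; exact Finset.inv_mem_inv hmem
      · intro g hg
        by_contra hgX
        exact (Finsupp.mem_support_iff.1 hg) (hm g (by exact_mod_cast hgX))
    rw [this]; ring
  have low := norm_sq_lower h
  have : (2 * (1 / (k : ℝ))) ^ 16 ≤ 2 ^ 31 * (1 / (2 * k : ℝ) ^ 16) := by
    calc _ ≤ (‖w * mu A ^ 1‖ ^ 2) ^ 16 := by rw [e1]; gcongr
      _ = ‖w * mu A ^ 1‖ ^ 32 := by ring
      _ ≤ _ := key.trans (by gcongr)
  have hk16 : (0 : ℝ) < 1 / (k : ℝ) ^ 16 := by positivity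
  have l : (2 * (1 / (k : ℝ))) ^ 16 = 2 ^ 16 * (1 / (k : ℝ) ^ 16) := by
    rw [mul_pow, div_pow, one_pow]
  have r : 2 ^ 31 * (1 / (2 * k : ℝ) ^ 16) = 2 ^ 15 * (1 / (k : ℝ) ^ 16) := by
    rw [mul_pow]; field_simp
  rw [l, r] at this
  linarith

lemma Bl_sub {A : Finset G} {k : ℕ} (h : Hyp A k) {i : ℕ} (hi : 1 ≤ i) {ρ : ℝ}
    (hρ : ρ ≤ 1 / (2 * k : ℝ) ^ 16) {y : G} (hy : y ∈ Bl A i ρ) : y ∈ A ^ 4 :=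
  small_mem h ((Bl_u h hi hy).trans hρ)

lemma u_beta {A : Finset G} {k : ℕ} (h : Hyp A k) {ρ : ℝ} (B : Finset G) (hB : B.Nonempty)
    (hBl : ∀ b ∈ B, b ∈ Bl A 1 ρ) (n : ℕ) : ‖u A * mu B ^ n - u A‖ ≤ n * ρ := by
  have hc : (0 : ℝ) < B.card := by exact_mod_cast hB.card_pos
  have h1 : ‖u A * mu B - u A‖ ≤ ρ := by
    have e : u A * mu B - u A = (B.card : ℝ)⁻¹ • ∑ b ∈ B, (u A * s b - u A) := by
      rw [Finset.sum_sub_distrib, smul_sub, mu, mul_smul_comm, Finset.mul_sum, Finset.sum_const,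
        ← Nat.cast_smul_eq_nsmul ℝ, smul_smul, inv_mul_cancel₀ hc.ne', one_smul]
    rw [e, norm_smul, norm_inv, Real.norm_natCast, inv_mul_le_iff₀ hc]
    refine (norm_sum_le _ _).trans ?_
    calc _ ≤ ∑ b ∈ B, ρ := by
          refine Finset.sum_le_sum fun b hb => ?_
          have := Bl_u h le_rfl (hBl b hb)
          rw [u_eq] at this ⊢
          rw [mul_smul_comm, ← smul_sub, norm_smul] at this
          rw [smul_mul_assoc, ← smul_sub, norm_smul, right_left A h.inv]
          exact this
      _ = _ := by simp
  induction n with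
  | zero => simp
  | succ n ih =>
    have e : u A * mu B ^ (n + 1) - u A = (u A * mu B ^ n - u A) * mu B + (u A * mu B - u A) := by
      rw [sub_mul, mul_assoc, ← pow_succ]; abel
    rw [e]
    refine (norm_add_le _ _).trans ?_
    have := norm_mul_mu_le (u A * mu B ^ n - u A) B
    push_cast; linarith

end
end STB

namespace STB
noncomputable section

variable {G : Type} [Group G] [DecidableEq G]

lemma half {c : ℕ} {A B B' : Finset G} {σ : ℝ} (hB : B.Nonempty) (hBB : B ⊆ B')
    (hc : (B'.card : ℝ) ≤ (1 + 1 / 4) * B.card)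
    (hm : ∀ w ∈ Bl A 1 σ, ∀ b ∈ B, w * b ∈ B') {y : G} (hy : y ∈ Bl A (c + 1) σ)
    {f : E G} (hf : f ∈ Sp ((A ^ c : Finset G) : Set G)) :
    n1 (s y * (f * mu B) - f * mu B) ≤ 1 / 2 * n1 f := by
  have := n1_lin ((LinearMap.mulLeft ℝ (s y) - LinearMap.id).comp (LinearMap.mulRight ℝ (mu B)))
    (1 / 2) hf (by
      intro z hz
      have hz : z ∈ A ^ c := Finset.mem_coe.1 hz
      have hw : z⁻¹ * y * z ∈ Bl A 1 σ := Bl_conj (c := c) (i := 1) hz hy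
      have h1 := n1_mu_translate B B' (1 / 4) (z⁻¹ * y * z) (hm _ hw) hBB hB hc
      have e : s y * (s z * mu B) - s z * mu B = s z * (s (z⁻¹ * y * z) * mu B - mu B) := by
        rw [mul_sub, s_mul_s, s_mul_s]
        congr 3
        group
      simp only [LinearMap.comp_apply, LinearMap.sub_apply, LinearMap.mulLeft_apply,
        LinearMap.mulRight_apply, LinearMap.id_apply]
      rw [e]
      refine (n1_s_mul _ _).trans (h1.trans ?_)
      norm_num)
  simpa using this

lemma core_step {A B : Finset G} {σ : ℝ} {r : ℕ} (hr : 0 < r)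
    (hh : ∀ y ∈ Bl A 42 σ, ∀ f ∈ Sp ((A ^ 41 : Finset G) : Set G),
      n1 (s y * (f * mu B) - f * mu B) ≤ 1 / 2 * n1 f) {x : G} (hx : x ^ r = 1)
    (hxl : ∀ l < r, x ^ l ∈ Bl A 42 σ) {g : E G}
    (hg : s x * g - g ∈ Sp ((A ^ 41 : Finset G) : Set G)) :
    n1 (s x * (g * mu B) - g * mu B) ≤ 1 / 2 * n1 (s x * g - g) := by
  set h := s x * g - g with hh'
  have e0 : s x * (g * mu B) - g * mu B = h * mu B := by rw [hh', sub_mul, mul_assoc]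
  rw [e0]
  have tel : ∑ l ∈ Finset.range r, s (x ^ l) * (h * mu B) = 0 := by
    have : ∀ l ∈ Finset.range r, s (x ^ l) * (h * mu B)
        = s (x ^ (l + 1)) * (g * mu B) - s (x ^ l) * (g * mu B) := by
      intro l _
      rw [← e0, mul_sub, s_mul_s, pow_succ]
    rw [Finset.sum_congr rfl this, Finset.sum_range_sub (fun l => s (x ^ l) * (g * mu B)), hx]
    simp
  have e1 : (r : ℝ) • (h * mu B) = -∑ l ∈ Finset.range r, (s (x ^ l) * (h * mu B) - h * mu B) := by
    rw [Finset.sum_sub_distrib, tel, zero_sub, neg_neg, Finset.sum_const, Finset.card_range,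
      Nat.cast_smul_eq_nsmul]
  have h1 : n1 ((r : ℝ) • (h * mu B)) ≤ r * (1 / 2 * n1 h) := by
    rw [e1, n1_neg]
    refine (n1_sum_le _ _).trans ?_
    refine (Finset.sum_le_sum fun l hl => hh _ (hxl l (Finset.mem_range.1 hl)) h hg).trans ?_
    simp
  rw [n1_smul, abs_of_nonneg (by positivity)] at h1
  have hr' : (0 : ℝ) < r := by exact_mod_cast hr
  exact le_of_mul_le_mul_left h1 hr'

lemma Bl_setpow {A : Finset G} {i : ℕ} {ρ : ℝ} (B : Set G) (hB : ∀ b ∈ B, b ∈ Bl A i ρ) (n : ℕ) :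
    ∀ y ∈ B ^ n, y ∈ Bl A i (n * ρ) := by
  induction n with
  | zero => intro y hy; simp at hy; subst hy; simpa using Bl_one A i le_rfl
  | succ n ih =>
    intro y hy
    rw [pow_succ] at hy
    obtain ⟨a, ha, b, hb, rfl⟩ := Set.mem_mul.1 hy
    have := Bl_mul (ih a ha) (hB b hb)
    push_cast
    rwa [add_mul, one_mul]

lemma core_bound {A B : Finset G} {k : ℕ} (h : Hyp A k) {σ ρ N : ℝ} {r J : ℕ} (hr : 0 < r)
    (hh : ∀ y ∈ Bl A 42 σ, ∀ f ∈ Sp ((A ^ 41 : Finset G) : Set G),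
      n1 (s y * (f * mu B) - f * mu B) ≤ 1 / 2 * n1 f)
    (hB : B.Nonempty) (hBl : ∀ b ∈ B, b ∈ Bl A 1 ρ) (hρ : 0 ≤ ρ)
    (hJ : J * ρ ≤ 1 / (2 * k : ℝ) ^ 16)
    (hN : 1 ≤ N) (hcard : (A.card : ℝ) ≤ N * B.card)
    {x : G} (hx : x ^ r = 1) (hx4 : x ∈ A ^ 4) (hxl : ∀ l < r, x ^ l ∈ Bl A 42 σ) :
    ‖s x * (u A * mu B ^ (J + 1)) - u A * mu B ^ (J + 1)‖ ≤ 2 * (1 / 2) ^ J * N := by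
  have hmem : ∀ j ≤ J, s x * (u A * mu B ^ j) - u A * mu B ^ j ∈ Sp ((A ^ 41 : Finset G) : Set G) := by
    intro j hj
    have h1 : mu B ^ j ∈ Sp ((A ^ 4 : Finset G) : Set G) := by
      refine Sp_mono ?_ (pow_mem_Sp (mu_mem B) j)
      intro y hy
      have := Bl_setpow (B : Set G) hBl j y hy
      have : y ∈ A ^ 4 := Bl_sub h le_rfl (le_trans (by gcongr) hJ) this
      exact_mod_cast this
    have h2 : u A * mu B ^ j ∈ Sp ((A ^ 37 : Finset G) : Set G) := by
      rw [show 37 = 33 + 4 from rfl, pow_add]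
      exact mul_mem_Spf (u_mem A) h1
    exact Submodule.sub_mem _ (s_mul_mem h2 hx4) (Sp_mono (by exact_mod_cast h.mono (by norm_num)) h2)
  have hn : ∀ j ≤ J, n1 (s x * (u A * mu B ^ j) - u A * mu B ^ j) ≤
      2 * (1 / 2) ^ j * Real.sqrt A.card := by
    intro j
    induction j with
    | zero =>
      intro _
      have h1 := n1_sub_le (s x * u A) (u A)
      have h2 := n1_s_mul x (u A)
      have h3 := n1_u A
      simp only [pow_zero, mul_one]
      linarith
    | succ j ih =>
      intro hj
      have h1 := core_step hr hh hx hxl (hmem j (by omega))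
      have h2 := ih (by omega)
      rw [mul_assoc, ← pow_succ] at h1
      refine h1.trans ?_
      rw [pow_succ]
      linarith
  have e : s x * (u A * mu B ^ (J + 1)) - u A * mu B ^ (J + 1)
      = (s x * (u A * mu B ^ J) - u A * mu B ^ J) * mu B := by
    rw [sub_mul, mul_assoc, mul_assoc, ← pow_succ]
  rw [e]
  refine (norm_mul_le_n1 _ _).trans ?_
  have hb : (0 : ℝ) < B.card := by exact_mod_cast hB.card_pos
  have hs : ‖mu B‖ * Real.sqrt A.card ≤ N := by
    refine le_of_sq_le_sq ?_ (by linarith)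
    rw [mul_pow, norm_mu_sq B hB, Real.sq_sqrt (by positivity), inv_mul_le_iff₀ hb]
    nlinarith
  calc _ ≤ ‖mu B‖ * (2 * (1 / 2) ^ J * Real.sqrt A.card) := by
        gcongr; exact hn J le_rfl
    _ = 2 * (1 / 2) ^ J * (‖mu B‖ * Real.sqrt A.card) := by ring
    _ ≤ _ := by gcongr

lemma pow_bound (V : Set G) (w : E G) (κ : ℝ) (h : ∀ x ∈ V, ‖s x * w - w‖ ≤ κ) (n : ℕ) :
    ∀ x ∈ V ^ n, ‖s x * w - w‖ ≤ n * κ := by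
  induction n with
  | zero => intro x hx; simp at hx; subst hx; simp [s_one]
  | succ n ih =>
    intro x hx
    rw [pow_succ] at hx
    obtain ⟨a, ha, b, hb, rfl⟩ := Set.mem_mul.1 hx
    have e : s (a * b) * w - w = s a * (s b * w - w) + (s a * w - w) := by
      rw [mul_sub, s_mul_s]; abel
    rw [e]
    refine (norm_add_le _ _).trans ?_
    rw [norm_s_mul]
    have := ih a ha
    have := h b hb
    push_cast; linarith

lemma stab (V D : Finset G) (m : ℕ) (h1 : (1 : G) ∈ V) (hinv : V⁻¹ = V) (hD : V ^ (3 * m + 1) ⊆ D)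
    (hc : D.card < (m + 1) * V.card) :
    ∃ H : Subgroup G, (V : Set G) ⊆ H ∧ (H : Set G) ⊆ D := by
  have hmono : ∀ {a b : ℕ}, a ≤ b → V ^ a ⊆ V ^ b := fun hab => Finset.pow_subset_pow_right h1 hab
  have hj : ∃ j < 3 * m, V ^ (j + 1) ⊆ V ^ j := by
    by_contra hcon
    push Not at hcon
    have grow : ∀ q ≤ m, (q + 1) * V.card ≤ (V ^ (3 * q + 1)).card := by
      intro q
      induction q with
      | zero => intro _; simp
      | succ q ih =>
        intro hq
        have ih := ih (by omega)
        obtain ⟨x, hx, hx'⟩ := Finset.not_subset.1 (hcon (3 * q + 2) (by omega))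
        have hdis : Disjoint (V ^ (3 * q + 1)) (V.image (x * ·)) := by
          rw [Finset.disjoint_left]
          intro y hy hy'
          obtain ⟨v, hv, rfl⟩ := Finset.mem_image.1 hy'
          apply hx'
          have : x = x * v * v⁻¹ := by group
          rw [this, pow_succ]
          refine Finset.mul_mem_mul hy ?_
          rw [← hinv]; exact Finset.inv_mem_inv hv
        have hsub : V ^ (3 * q + 1) ∪ V.image (x * ·) ⊆ V ^ (3 * (q + 1) + 1) := by
          refine Finset.union_subset (hmono (by omega)) ?_
          intro y hy
          obtain ⟨v, hv, rfl⟩ := Finset.mem_image.1 hy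
          rw [pow_succ]
          exact Finset.mul_mem_mul hx hv
        have := Finset.card_le_card hsub
        rw [Finset.card_union_of_disjoint hdis,
          Finset.card_image_of_injective _ (mul_right_injective x)] at this
        linarith
    have := grow m le_rfl
    have := Finset.card_le_card hD
    omega
  obtain ⟨j, hjm, hj⟩ := hj
  have hst : ∀ n, V ^ (j + n) ⊆ V ^ j := by
    intro n
    induction n with
    | zero => simp
    | succ n ih =>
      rw [← add_assoc, pow_succ]
      exact (Finset.mul_subset_mul_right ih).trans (by rw [← pow_succ]; exact hj)
  refine ⟨{ carrier := (V ^ j : Finset G), mul_mem' := ?_, one_mem' := ?_, inv_mem' := ?_ }, ?_, ?_⟩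
  · intro a b ha hb
    have ha : a ∈ V ^ j := by exact_mod_cast ha
    have hb : b ∈ V ^ j := by exact_mod_cast hb
    have : a * b ∈ V ^ j := hst j (by rw [pow_add]; exact Finset.mul_mem_mul ha hb)
    exact_mod_cast this
  · have : (1 : G) ∈ V ^ j := hmono (Nat.zero_le j) (by simp)
    exact_mod_cast this
  · intro a ha
    have ha : a ∈ V ^ j := by exact_mod_cast ha
    have hi : (V ^ j)⁻¹ = V ^ j := by rw [← inv_pow, hinv]
    have : a⁻¹ ∈ V ^ j := by rw [← hi]; exact Finset.inv_mem_inv ha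
    exact_mod_cast this
  · intro v hv
    have hv : v ∈ V := by exact_mod_cast hv
    have : v ∈ V ^ j := hj (hmono (by omega : 1 ≤ j + 1) (by simpa using hv))
    exact_mod_cast this
  · intro v hv
    have hv : v ∈ V ^ j := by exact_mod_cast hv
    have : v ∈ D := hD (hmono (by omega) hv)
    exact_mod_cast this

lemma pigeon (a : ℕ → ℝ) (R : ℕ) (h : a R < (5 / 4) ^ R * a 0) :
    ∃ q < R, a (q + 1) ≤ (1 + 1 / 4) * a q := by
  by_contra hcon
  push Not at hcon
  have : ∀ q ≤ R, (5 / 4) ^ q * a 0 ≤ a q := by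
    intro q
    induction q with
    | zero => simp
    | succ q ih =>
      intro hq
      have h1 := ih (by omega)
      have h2 := hcon q (by omega)
      rw [pow_succ]; linarith
  linarith [this R le_rfl]

end
end STB

namespace STB
noncomputable section

lemma params (k r C1 C2 : ℕ) (hk : 0 < k) : ∃ t : ℕ, 1 ≤ t ∧
    r * (4 * (C1 * t ^ 5 + 4 * k + 1)) ≤ t ^ 16 ∧
    128 * (2 * k) ^ 16 ≤ t ^ 2 ∧
    (3 * (k ^ 4 * 2 ^ (C2 * (t ^ 2) ^ 5)) + 1) * (4 * (2 * k) ^ 16) * 2 ^ (C1 * t ^ 5)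
      ≤ 2 ^ (t ^ 14) := by
  obtain ⟨t, ht⟩ : ∃ t, t = C1 + C2 + 4 * r + (4 * k + 1) + 128 * (2 * k) ^ 16 := ⟨_, rfl⟩
  have hkk : 1 ≤ (2 * k) ^ 16 := Nat.one_le_pow _ _ (by omega)
  have h1 : C1 ≤ t := by omega
  have h2 : C2 ≤ t := by omega
  have h3 : 4 * r ≤ t := by omega
  have h4 : 4 * k + 1 ≤ t := by omega
  have h5 : 128 * (2 * k) ^ 16 ≤ t := by omega
  have h6 : 128 ≤ t := by omega
  have hm : ∀ {a b : ℕ}, a ≤ b → t ^ a ≤ t ^ b := fun h => Nat.pow_le_pow_right (by omega) h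
  have c1 : C1 * t ^ 5 ≤ t ^ 6 := by
    calc _ ≤ t * t ^ 5 := by gcongr
      _ = _ := by ring
  refine ⟨t, by omega, ?_, ?_, ?_⟩
  · have : 4 * k + 1 ≤ t ^ 6 := h4.trans (by simpa using hm (by norm_num : 1 ≤ 6))
    calc r * (4 * (C1 * t ^ 5 + 4 * k + 1)) = 4 * r * (C1 * t ^ 5 + (4 * k + 1)) := by ring
      _ ≤ t * (t ^ 6 + t ^ 6) := by gcongr
      _ = 2 * t ^ 7 := by ring
      _ ≤ t * t ^ 7 := by gcongr; omega
      _ = t ^ 8 := by ring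
      _ ≤ _ := hm (by norm_num)
  · exact h5.trans (by simpa using hm (by norm_num : 1 ≤ 2))
  · have e1 : C2 * (t ^ 2) ^ 5 ≤ t ^ 11 := by
      calc _ ≤ t * (t ^ 2) ^ 5 := by gcongr
        _ = _ := by ring
    have e2 : C1 * t ^ 5 ≤ t ^ 11 := c1.trans (hm (by norm_num))
    have hk4 : 16 * k ^ 4 ≤ t := by
      calc 16 * k ^ 4 = (2 * k) ^ 4 := by ring
        _ ≤ (2 * k) ^ 16 := Nat.pow_le_pow_right (by omega) (by norm_num)
        _ ≤ t := by omega
    have e3 : t ≤ 2 ^ t := Nat.lt_two_pow_self.le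
    have e4 : 1 ≤ k ^ 4 * 2 ^ (C2 * (t ^ 2) ^ 5) := Nat.one_le_iff_ne_zero.2 (by positivity)
    calc _ ≤ (4 * (k ^ 4 * 2 ^ (C2 * (t ^ 2) ^ 5))) * (4 * (2 * k) ^ 16) * 2 ^ (C1 * t ^ 5) := by
          gcongr; omega
      _ = (16 * k ^ 4) * (2 * k) ^ 16 * (2 ^ (C2 * (t ^ 2) ^ 5) * 2 ^ (C1 * t ^ 5)) := by ring
      _ ≤ 2 ^ t * 2 ^ t * (2 ^ (t ^ 11) * 2 ^ (t ^ 11)) := by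
          have z1 : (2 * k) ^ 16 ≤ 2 ^ t := le_trans (by omega) e3
          exact Nat.mul_le_mul (Nat.mul_le_mul (hk4.trans e3) z1)
            (Nat.mul_le_mul (Nat.pow_le_pow_right (by norm_num) e1)
              (Nat.pow_le_pow_right (by norm_num) e2))
      _ = 2 ^ (t + t + (t ^ 11 + t ^ 11)) := by rw [pow_add, pow_add, pow_add]
      _ ≤ _ := by
          apply Nat.pow_le_pow_right (by norm_num)
          have : t ≤ t ^ 11 := by simpa using hm (by norm_num : 1 ≤ 11)
          calc _ ≤ 4 * t ^ 11 := by omega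
            _ ≤ t * t ^ 11 := by gcongr; omega
            _ = t ^ 12 := by ring
            _ ≤ _ := hm (by norm_num)

variable {G : Type} [Group G] [DecidableEq G]

lemma main_aux (k r C1 C2 t : ℕ) (hk : 0 < k) (hr : 0 < r) (ht : 1 ≤ t)
    (p1 : r * (4 * (C1 * t ^ 5 + 4 * k + 1)) ≤ t ^ 16)
    (p2 : 128 * (2 * k) ^ 16 ≤ t ^ 2)
    (p3 : (3 * (k ^ 4 * 2 ^ (C2 * (t ^ 2) ^ 5)) + 1) * (4 * (2 * k) ^ 16) * 2 ^ (C1 * t ^ 5)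
      ≤ 2 ^ (t ^ 14)) (hG : ∀ x : G, x ^ r = 1) (A : Finset G) (h : Hyp A k)
    (n1' : ∃ F ⊆ A, F.card ≤ 2 ^ (C1 * t ^ 5) ∧ ∀ y ∈ A, ∃ y' ∈ F,
      y'⁻¹ * y ∈ Bl A 1 (8 / (t : ℝ) ^ 16))
    (n2' : ∃ F ⊆ A, F.card ≤ 2 ^ (C2 * (t ^ 2) ^ 5) ∧ ∀ y ∈ A, ∃ y' ∈ F,
      y'⁻¹ * y ∈ Bl A 42 (8 / ((t ^ 2 : ℕ) : ℝ) ^ 16)) :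
    ∃ (H : Subgroup G) (F : Finset G),
        F.card ≤ 2 ^ (C2 * (t ^ 2) ^ 5) ∧ (A : Set G) ⊆ (F : Set G) * (H : Set G) ∧
        (H : Set G) ⊆ ↑(A ^ 4) := by
  classical
  obtain ⟨F1, -, hF1c, hF1⟩ := n1'
  obtain ⟨F, -, hFc, hF⟩ := n2'
  have hkp : (0 : ℝ) < k := by exact_mod_cast hk
  have ht' : (1 : ℝ) ≤ t := by exact_mod_cast ht
  have ht0 : (0 : ℝ) < t := by linarith
  obtain ⟨c0, hc0⟩ : ∃ c0 : ℝ, c0 = 1 / (2 * k : ℝ) ^ 16 := ⟨_, rfl⟩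
  have hc0p : 0 < c0 := by rw [hc0]; positivity
  have q2 : 64 / (t : ℝ) ^ 2 ≤ c0 / 2 := by
    rw [hc0, div_div, div_le_div_iff₀ (by positivity) (by positivity)]
    have : (128 : ℝ) * (2 * k) ^ 16 ≤ t ^ 2 := by exact_mod_cast p2
    linarith
  obtain ⟨N1, hN1⟩ : ∃ N1 : ℕ, N1 = 2 ^ (C1 * t ^ 5) := ⟨_, rfl⟩
  obtain ⟨N2, hN2⟩ : ∃ N2 : ℕ, N2 = 2 ^ (C2 * (t ^ 2) ^ 5) := ⟨_, rfl⟩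
  have hN1p : 1 ≤ N1 := by rw [hN1]; exact Nat.one_le_two_pow
  obtain ⟨R, hR⟩ : ∃ R : ℕ, R = 4 * (C1 * t ^ 5 + 4 * k + 1) := ⟨_, rfl⟩
  have hRp : (0 : ℝ) < R := by
    have : 0 < R := by omega
    exact_mod_cast this
  obtain ⟨σ, hσ⟩ : ∃ σ : ℝ, σ = 8 / ((t : ℝ) ^ 16 * R) := ⟨_, rfl⟩
  have hσp : 0 < σ := by rw [hσ]; positivity
  have hRσ : R * σ = 8 / (t : ℝ) ^ 16 := by rw [hσ]; field_simp
  obtain ⟨ρ, hρ⟩ : ∃ ρ : ℕ → ℝ, ∀ q, ρ q = 8 / (t : ℝ) ^ 16 + q * σ := ⟨_, fun _ => rfl⟩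
  have ht16 : (t : ℝ) ^ 2 ≤ (t : ℝ) ^ 16 := pow_le_pow_right₀ ht' (by norm_num)
  have hρ0 : ∀ q, 0 ≤ ρ q := fun q => by rw [hρ]; positivity
  have hρle : ∀ q ≤ R, ρ q ≤ 16 / (t : ℝ) ^ 16 := by
    intro q hq
    have : (q : ℝ) * σ ≤ R * σ := by gcongr
    rw [hρ]
    calc _ ≤ 8 / (t : ℝ) ^ 16 + 8 / (t : ℝ) ^ 16 := by linarith
      _ = _ := by ring
  have h16 : 16 / (t : ℝ) ^ 16 ≤ c0 := by
    have : 16 / (t : ℝ) ^ 16 ≤ 64 / (t : ℝ) ^ 2 := by gcongr; norm_num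
    linarith
  let B : ℕ → Finset G := fun q => (A ^ 4).filter (· ∈ Bl A 1 (ρ q))
  have hBmem : ∀ q ≤ R, ∀ y, y ∈ B q ↔ y ∈ Bl A 1 (ρ q) := by
    intro q hq y
    simp only [B, Finset.mem_filter, and_iff_right_iff_imp]
    intro hy
    exact Bl_sub h le_rfl (((hρle q hq).trans h16).trans hc0.le) hy
  have hB4 : ∀ q, B q ⊆ A ^ 4 := fun q => Finset.filter_subset _ _
  have hBmono : ∀ q ≤ R, B 0 ⊆ B q := by
    intro q hq y hy
    rw [hBmem q hq]
    rw [hBmem 0 (by omega)] at hy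
    refine Bl_mono ?_ hy
    rw [hρ, hρ]; push_cast
    have : 0 ≤ (q : ℝ) * σ := by positivity
    linarith
  have cov : ∀ (F' V' : Finset G), (∀ y ∈ A, ∃ y' ∈ F', y'⁻¹ * y ∈ V') → A.card ≤ F'.card * V'.card := by
    intro F' V' hh
    refine le_trans (Finset.card_le_card ?_) (Finset.card_mul_le (s := F') (t := V'))
    intro y hy
    obtain ⟨y', hy', hyy⟩ := hh y hy
    rw [Finset.mem_mul]
    exact ⟨y', hy', _, hyy, by group⟩
  have hAB0 : (A.card : ℝ) ≤ N1 * (B 0).card := by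
    have := cov F1 (B 0) (by
      intro y hy
      obtain ⟨y', hy', hyy⟩ := hF1 y hy
      refine ⟨y', hy', (hBmem 0 (by omega) _).2 ?_⟩
      rw [hρ]; simpa using hyy)
    have h2 : A.card ≤ N1 * (B 0).card := this.trans (Nat.mul_le_mul_right _ (hN1 ▸ hF1c))
    exact_mod_cast h2
  have hAB : ∀ q ≤ R, (A.card : ℝ) ≤ N1 * (B q).card := by
    intro q hq
    refine hAB0.trans ?_
    have := Finset.card_le_card (hBmono q hq)
    gcongr
  obtain ⟨q, hqR, hq⟩ := pigeon (fun q => ((B q).card : ℝ)) R (by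
    have a1 : ((B R).card : ℝ) ≤ k ^ 4 * A.card := by
      refine le_trans ?_ (h.card_pow 4)
      exact_mod_cast Finset.card_le_card (hB4 R)
    have a2 : (2 : ℝ) ^ (C1 * t ^ 5 + 4 * k + 1) ≤ (5 / 4) ^ R := by
      rw [hR, pow_mul]
      gcongr
      norm_num
    have a3 : (k : ℝ) ^ 4 ≤ 2 ^ (4 * k) := by
      have : k ≤ 2 ^ k := Nat.lt_two_pow_self.le
      have : k ^ 4 ≤ 2 ^ (4 * k) := by
        calc k ^ 4 ≤ (2 ^ k) ^ 4 := by gcongr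
          _ = _ := by rw [← pow_mul]; ring_nf
      exact_mod_cast this
    have b0 : (0 : ℝ) < (B 0).card := by
      have := h.cardpos
      by_contra hcon
      have : ((B 0).card : ℝ) = 0 := le_antisymm (not_lt.1 hcon) (by positivity)
      rw [this] at hAB0; linarith
    have hN1r : (N1 : ℝ) = 2 ^ (C1 * t ^ 5) := by rw [hN1]; push_cast; rfl
    calc ((B R).card : ℝ) ≤ k ^ 4 * A.card := a1
      _ ≤ 2 ^ (4 * k) * (N1 * (B 0).card) := by gcongr
      _ < 2 * (2 ^ (4 * k) * (N1 * (B 0).card)) := by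
          have : (0 : ℝ) < N1 := by rw [hN1r]; positivity
          have : 0 < (2 : ℝ) ^ (4 * k) * (N1 * (B 0).card) := by positivity
          linarith
      _ = 2 ^ (C1 * t ^ 5 + 4 * k + 1) * (B 0).card := by rw [hN1r, pow_succ, pow_add]; ring
      _ ≤ _ := by gcongr)
  have hBne : (B q).Nonempty := ⟨1, (hBmem q hqR.le 1).2 (Bl_one A 1 (hρ0 q))⟩
  have hBl : ∀ b ∈ B q, b ∈ Bl A 1 (ρ q) := fun b hb => (hBmem q hqR.le b).1 hb
  have hρs : σ + ρ q = ρ (q + 1) := by rw [hρ, hρ]; push_cast; ring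
  have hhalf : ∀ y ∈ Bl A 42 σ, ∀ f ∈ Sp ((A ^ 41 : Finset G) : Set G),
      n1 (s y * (f * mu (B q)) - f * mu (B q)) ≤ 1 / 2 * n1 f := by
    intro y hy f hf
    refine half (c := 41) (A := A) (B' := B (q + 1)) hBne ?_ hq ?_ hy hf
    · intro b hb
      rw [hBmem (q + 1) hqR]
      exact Bl_mono (by rw [← hρs]; linarith) (hBl b hb)
    · intro w hw b hb
      rw [hBmem (q + 1) hqR, ← hρs]
      exact Bl_mul hw (hBl b hb)
  -- the small ball
  obtain ⟨τ, hτ⟩ : ∃ τ : ℝ, τ = 8 / ((t ^ 2 : ℕ) : ℝ) ^ 16 := ⟨_, rfl⟩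
  have hτ0 : 0 ≤ τ := by rw [hτ]; positivity
  have hτσ : ∀ l < r, l * τ ≤ σ := by
    intro l hl
    have a1 : (l : ℝ) * τ ≤ r * τ := by gcongr
    refine a1.trans ?_
    rw [hτ, hσ, ← mul_div_assoc, div_le_div_iff₀ (by positivity) (by positivity)]
    have : (r : ℝ) * R ≤ t ^ 16 := by rw [hR]; exact_mod_cast p1
    push_cast
    calc (r : ℝ) * 8 * ((t : ℝ) ^ 16 * R) = 8 * (t : ℝ) ^ 16 * ((r : ℝ) * R) := by ring
      _ ≤ 8 * (t : ℝ) ^ 16 * (t : ℝ) ^ 16 := by gcongr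
      _ = _ := by ring
  have hτc : τ ≤ c0 := by
    refine le_trans ?_ h16
    rw [hτ]
    push_cast
    have : (t : ℝ) ^ 16 ≤ ((t : ℝ) ^ 2) ^ 16 := by
      gcongr; nlinarith
    gcongr; norm_num
  let V : Finset G := (A ^ 4).filter (· ∈ Bl A 42 τ)
  have hVmem : ∀ y, y ∈ V ↔ y ∈ Bl A 42 τ := by
    intro y
    simp only [V, Finset.mem_filter, and_iff_right_iff_imp]
    intro hy
    exact Bl_sub h (by norm_num) (hτc.trans hc0.le) hy
  have hJ : ((t ^ 14 + 1 : ℕ) : ℝ) * ρ q ≤ 32 / (t : ℝ) ^ 2 := by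
    have e : ((t ^ 14 + 1 : ℕ) : ℝ) ≤ 2 * t ^ 14 := by
      have : (1 : ℝ) ≤ t ^ 14 := one_le_pow₀ ht'
      push_cast; linarith
    calc _ ≤ (2 * t ^ 14) * (16 / (t : ℝ) ^ 16) := by
          gcongr
          · exact hρ0 q
          · exact hρle q hqR.le
      _ = _ := by field_simp; ring
  have hJ' : ((t ^ 14 : ℕ) : ℝ) * ρ q ≤ 1 / (2 * k : ℝ) ^ 16 := by
    rw [← hc0]
    have a1 : ((t ^ 14 : ℕ) : ℝ) * ρ q ≤ ((t ^ 14 + 1 : ℕ) : ℝ) * ρ q := by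
      have := hρ0 q
      gcongr; omega
    have : 32 / (t : ℝ) ^ 2 ≤ 64 / (t : ℝ) ^ 2 := by gcongr; norm_num
    linarith
  obtain ⟨w, hw⟩ : ∃ w, w = u A * mu (B q) ^ (t ^ 14 + 1) := ⟨_, rfl⟩
  have hV1 : ∀ x ∈ (V : Set G), ‖s x * w - w‖ ≤ 2 * (1 / 2) ^ (t ^ 14) * N1 := by
    intro x hx
    have hx : x ∈ V := Finset.mem_coe.1 hx
    rw [hw]
    refine core_bound h hr hhalf hBne hBl (hρ0 q) hJ' (by exact_mod_cast hN1p) (hAB q hqR.le)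
      (hG x) (Finset.mem_filter.1 hx).1 ?_
    intro l hl
    exact Bl_mono (hτσ l hl) (Bl_pow ((hVmem x).1 hx) l)
  have hwu : ‖w - u A‖ ≤ 32 / (t : ℝ) ^ 2 := by
    rw [hw]; exact (u_beta h (B q) hBne hBl _).trans hJ
  have hVn : V ^ (3 * (k ^ 4 * N2) + 1) ⊆ A ^ 4 := by
    intro x hx
    apply small_mem h
    rw [← hc0]
    have hx' : x ∈ (V : Set G) ^ (3 * (k ^ 4 * N2) + 1) := by
      rw [← Finset.coe_pow]; exact Finset.mem_coe.2 hx
    have a1 := pow_bound (V : Set G) w _ hV1 _ x hx'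
    have a2 : ((3 * (k ^ 4 * N2) + 1 : ℕ) : ℝ) * (2 * (1 / 2) ^ (t ^ 14) * N1) ≤ c0 / 2 := by
      have p3' : (((3 * (k ^ 4 * N2) + 1 : ℕ) : ℝ)) * (4 * (2 * k) ^ 16) * N1 ≤ 2 ^ (t ^ 14) := by
        rw [hN1, hN2]; exact_mod_cast p3
      rw [hc0, div_div, le_div_iff₀ (by positivity), one_div, inv_pow]
      have hpos : (0 : ℝ) < 2 ^ (t ^ 14) := by positivity
      calc _ = ((((3 * (k ^ 4 * N2) + 1 : ℕ) : ℝ)) * (4 * (2 * k) ^ 16) * N1) * (2 ^ (t ^ 14))⁻¹ := by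
            ring
        _ ≤ 2 ^ (t ^ 14) * (2 ^ (t ^ 14))⁻¹ := by gcongr
        _ = 1 := mul_inv_cancel₀ hpos.ne'
    have e : s x * u A - u A = (s x * w - w) + (w - u A) - s x * (w - u A) := by
      rw [mul_sub]; abel
    rw [e]
    refine (norm_sub_le _ _).trans ?_
    rw [norm_s_mul]
    have a3 := norm_add_le (s x * w - w) (w - u A)
    have a4 : 64 / (t : ℝ) ^ 2 = 32 / (t : ℝ) ^ 2 + 32 / (t : ℝ) ^ 2 := by ring
    linarith
  have hVA : ∀ y ∈ A, ∃ y' ∈ F, y'⁻¹ * y ∈ V := by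
    intro y hy
    obtain ⟨y', hy', hyy⟩ := hF y hy
    exact ⟨y', hy', (hVmem _).2 (by rw [hτ]; exact hyy)⟩
  obtain ⟨H, hVH, hHA⟩ := stab V (A ^ 4) (k ^ 4 * N2) ((hVmem 1).2 (Bl_one A 42 hτ0)) (by
      ext y
      rw [Finset.mem_inv', hVmem, hVmem]
      exact ⟨fun hy => by simpa using Bl_inv hy, fun hy => Bl_inv hy⟩) hVn (by
      have a1 : (A ^ 4).card ≤ k ^ 4 * A.card := by exact_mod_cast h.card_pow 4
      have a2 : A.card ≤ N2 * V.card := (cov F V hVA).trans (Nat.mul_le_mul_right _ (hN2 ▸ hFc))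
      have a3 : 0 < V.card := Finset.card_pos.2 ⟨1, (hVmem 1).2 (Bl_one A 42 hτ0)⟩
      calc (A ^ 4).card ≤ k ^ 4 * (N2 * V.card) := a1.trans (Nat.mul_le_mul_left _ a2)
        _ < (k ^ 4 * N2 + 1) * V.card := by rw [add_mul, mul_assoc]; omega)
  refine ⟨H, F, hFc, ?_, hHA⟩
  intro y hy
  obtain ⟨y', hy', hyy⟩ := hVA y (Finset.mem_coe.1 hy)
  exact Set.mem_mul.2 ⟨y', Finset.mem_coe.2 hy', y'⁻¹ * y, hVH (Finset.mem_coe.2 hyy), by group⟩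

end
end STB

/-- For all positive integers `k` and `r` there is `C` such that: if `G` is a group of
exponent `r` and `A ⊆ G` is a nonempty finite symmetric set with `|A³| ≤ k|A|`, then there
is a subgroup `H ≤ G` such that `A` is covered by at most `C` left translates of `H` and
`H ⊆ A⁴`. -/
theorem small_tripling_bounded_exponent_symmetric (k r : ℕ) (hk : 0 < k) (hr : 0 < r) :
    ∃ C : ℕ, ∀ (G : Type) [Group G] [DecidableEq G],
      (∀ x : G, x ^ r = 1) →
      ∀ A : Finset G, A.Nonempty → (1 : G) ∈ A → A⁻¹ = A →
      (A ^ 3).card ≤ k * A.card →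
      ∃ (H : Subgroup G) (F : Finset G),
        F.card ≤ C ∧ (A : Set G) ⊆ (F : Set G) * (H : Set G) ∧
        (H : Set G) ⊆ ↑(A ^ 4) := by
  obtain ⟨C1, h1⟩ := STB.netlem k 1 hk
  obtain ⟨C2, h2⟩ := STB.netlem k 42 hk
  obtain ⟨t, ht, p1, p2, p3⟩ := STB.params k r C1 C2 hk
  refine ⟨2 ^ (C2 * (t ^ 2) ^ 5), ?_⟩
  intro G _ _ hG A _ hone hinv htrip
  have h : STB.Hyp A k := ⟨hone, hinv, htrip, hk⟩
  exact STB.main_aux k r C1 C2 t hk hr ht p1 p2 p3 hG A h (h1 t ht G A h)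
    (h2 (t ^ 2) (Nat.one_le_pow _ _ ht) G A h)
end
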